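/- arXiv:2512.23164 — 3 statements merged into one kernel-verified Lean document; each statement's English description precedes it below -/
import Mathlib

section
/- Let α > 1, p > 0 and ε ∈ {1, −1}, and let C_α be a random variable with the α-Cauchy distribution. Then the law of |C_α|^{εp} is infinitely divisible provided one of the following holds: (i) ε = 1, 1 < α ≤ 2 and p ≥ (α+1)/3; (ii) ε = 1, α > 2 and p ≥ α/2; (iii) ε = −1, 1 < α ≤ 2 and p ≥ α/2; (iv) ε = −1, α > 2 and p ≥ (2α−1)/3. -/
open MeasureTheory Real

/-- The `n`-fold convolution power of a measure on `ℝ`. -/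
noncomputable def convPow (ν : Measure ℝ) : ℕ → Measure ℝ
  | 0 => Measure.dirac 0
  | n + 1 => (convPow ν n).conv ν

/-- A probability measure on `ℝ` is infinitely divisible if for every positive integer `n`
it is the `n`-fold convolution of some probability measure with itself. -/
def IsInfinitelyDivisible (μ : Measure ℝ) : Prop :=
  ∀ n : ℕ, 0 < n → ∃ ν : Measure ℝ, IsProbabilityMeasure ν ∧ μ = convPow ν n

/-- The `α`-Cauchy distribution: density `α·sin(π/α)/(2π) · (1+|t|^α)⁻¹` w.r.t. Lebesgue. -/
noncomputable def alphaCauchy (α : ℝ) : Measure ℝ :=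
  volume.withDensity fun t => ENNReal.ofReal (α * Real.sin (π / α) / (2 * π) * (1 + |t| ^ α)⁻¹)

/-- The Koebe-type kernel `z / (1 - ρ z)²`. -/
noncomputable def koebeKernel (ρ : ℝ) (z : ℂ) : ℂ := z / (1 - ρ * z) ^ 2

theorem koebeKernel_im (ρ : ℝ) (z : ℂ) :
    (koebeKernel ρ z).im =
      z.im * ((1 - ρ ^ 2 * Complex.normSq z) / Complex.normSq ((1 - ρ * z) ^ 2)) := by
  simp only [koebeKernel, Complex.div_im, Complex.normSq_apply, sq, Complex.mul_re, Complex.mul_im,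
    Complex.sub_re, Complex.sub_im, Complex.one_re, Complex.one_im, Complex.ofReal_re,
    Complex.ofReal_im]
  ring

theorem one_sub_mul_ne_zero_of_lt {ρ : ℝ} {z : ℂ} (h0 : 0 < ρ) (h1 : ρ < 1) (hz : ‖z‖ ≤ 1) :
    1 - (ρ : ℂ) * z ≠ 0 := by
  intro h
  have h2 : (ρ : ℂ) * z = 1 := by linear_combination -h
  have h3 : ρ * ‖z‖ = 1 := by
    have := congrArg norm h2
    rwa [norm_mul, Complex.norm_real, Real.norm_of_nonneg h0.le, norm_one] at this
  nlinarith [norm_nonneg z]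

theorem koebeKernel_im_factor_pos {ρ : ℝ} {z : ℂ} (h0 : 0 < ρ) (h1 : ρ < 1) (hz : ‖z‖ ≤ 1) :
    0 < (1 - ρ ^ 2 * Complex.normSq z) / Complex.normSq ((1 - ρ * z) ^ 2) := by
  apply div_pos
  · rw [Complex.normSq_eq_norm_sq]
    have : ρ * ‖z‖ < 1 := by nlinarith [norm_nonneg z]
    have h3 : 0 ≤ ρ * ‖z‖ := by positivity
    nlinarith
  · exact Complex.normSq_pos.2 (pow_ne_zero _ (one_sub_mul_ne_zero_of_lt h0 h1 hz))

theorem koebeKernel_inv {ρ : ℝ} {z : ℂ} (h0 : 0 < ρ) (h1 : ρ ≠ 1) (hz : ‖z‖ = 1) :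
    koebeKernel ρ z = ((ρ⁻¹ ^ 2 : ℝ) : ℂ) * (starRingEnd ℂ) (koebeKernel ρ⁻¹ z) := by
  have hzz : z * (starRingEnd ℂ) z = 1 := by
    rw [Complex.mul_conj, Complex.normSq_eq_norm_sq, hz]; simp
  have hz0 : z ≠ 0 := by rintro rfl; simp at hz
  have hc : (starRingEnd ℂ) z = z⁻¹ := by
    rw [← eq_inv_of_mul_eq_one_right hzz]
  have hρ : (ρ : ℂ) ≠ 0 := by exact_mod_cast h0.ne'
  have hA : ∀ r : ℝ, 0 < r → r ≠ 1 → 1 - (r : ℂ) * z ≠ 0 := by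
    intro r hr0 hr1 h
    have h2 : (r : ℂ) * z = 1 := by linear_combination -h
    have := congrArg norm h2
    rw [norm_mul, Complex.norm_real, Real.norm_of_nonneg hr0.le, norm_one, hz, mul_one] at this
    exact hr1 this
  have h2 := hA ρ h0 h1
  simp only [koebeKernel, map_div₀, map_pow, map_sub, map_mul, map_one, Complex.conj_ofReal, hc]
  push_cast
  have e : (1 - (ρ : ℂ)⁻¹ * z⁻¹) = -(1 - ρ * z) * (ρ * z)⁻¹ := by
    field_simp; ring
  rw [e]
  field_simp

section circle
variable {ι : Type*} [Fintype ι]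

theorem norm_sum_le_of_re_eq (w T : ι → ℂ) (s : ℝ) (m : ι → ℝ) (hm : ∀ i, 0 ≤ m i)
    (hre : ∀ i, (w i).re = (T i).re) (hT : ∀ i, (T i).im = s * m i)
    (him : ∀ i, |(w i).im| ≤ |(T i).im|) : ‖∑ i, w i‖ ≤ ‖∑ i, T i‖ := by
  rw [← Real.sqrt_sq (norm_nonneg (∑ i, w i)), ← Real.sqrt_sq (norm_nonneg (∑ i, T i))]
  apply Real.sqrt_le_sqrt
  rw [← Complex.normSq_eq_norm_sq, ← Complex.normSq_eq_norm_sq, Complex.normSq_apply,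
    Complex.normSq_apply, Complex.re_sum, Complex.re_sum, Complex.im_sum, Complex.im_sum,
    Finset.sum_congr rfl (fun i _ => hre i), ← abs_mul_abs_self (∑ i, (w i).im),
    ← abs_mul_abs_self (∑ i, (T i).im)]
  have : |∑ i, (w i).im| ≤ |∑ i, (T i).im| := by
    calc |∑ i, (w i).im| ≤ ∑ i, |(w i).im| := Finset.abs_sum_le_sum_abs _ _
      _ ≤ ∑ i, |(T i).im| := Finset.sum_le_sum fun i _ => him i
      _ = |s| * ∑ i, m i := by
          rw [Finset.mul_sum]; exact Finset.sum_congr rfl fun i _ => by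
            rw [hT, abs_mul, abs_of_nonneg (hm i)]
      _ = |∑ i, (T i).im| := by
          rw [Finset.sum_congr rfl fun i _ => hT i, ← Finset.mul_sum, abs_mul,
            abs_of_nonneg (Finset.sum_nonneg fun i _ => hm i)]
  gcongr

theorem sum_koebe_ne_zero [Nonempty ι] {c q : ι → ℝ} (hc : ∀ i, 0 < c i) (hq : ∀ i, 0 < q i)
    (hq1 : ∀ i, q i < 1) {z : ℂ} (hz : ‖z‖ ≤ 1) : ∑ i, (c i : ℂ) / (1 - q i * z) ^ 2 ≠ 0 := by
  intro h
  by_cases him : z.im = 0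
  · obtain ⟨x, rfl⟩ : ∃ x : ℝ, z = x := ⟨z.re, by apply Complex.ext <;> simp [him]⟩
    have : (∑ i, c i / (1 - q i * x) ^ 2 : ℝ) = 0 := by
      have := h; exact_mod_cast this
    refine absurd this (ne_of_gt (Finset.sum_pos (fun i _ => ?_) Finset.univ_nonempty))
    have := one_sub_mul_ne_zero_of_lt (hq i) (hq1 i) hz
    have h4 : 1 - q i * x ≠ 0 := by exact_mod_cast this
    have := hc i
    positivity
  · have h2 : ∑ i, (c i : ℂ) * koebeKernel (q i) z = 0 := by
      rw [← mul_zero z, ← h, Finset.mul_sum]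
      exact Finset.sum_congr rfl fun i _ => by rw [koebeKernel]; ring
    have h3 := congrArg Complex.im h2
    simp only [Complex.im_sum, Complex.im_ofReal_mul, koebeKernel_im,
      Complex.zero_im] at h3
    have h4 : z.im * ∑ i, c i * ((1 - q i ^ 2 * Complex.normSq z) /
        Complex.normSq ((1 - q i * z) ^ 2)) = 0 := by
      rw [← h3, Finset.mul_sum]; exact Finset.sum_congr rfl fun i _ => by ring
    rcases mul_eq_zero.1 h4 with h5 | h5
    · exact him h5
    · refine absurd h5 (ne_of_gt (Finset.sum_pos (fun i _ => ?_) Finset.univ_nonempty))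
      exact mul_pos (hc i) (koebeKernel_im_factor_pos (hq i) (hq1 i) hz)

theorem norm_sum_koebe_le {c q : ι → ℝ} (hc : ∀ i, 0 < c i) (hq : ∀ i, 0 < q i)
    (hq1 : ∀ i, q i ≠ 1) {z : ℂ} (hz : ‖z‖ = 1) :
    ‖∑ i, (c i : ℂ) / (1 - q i * z) ^ 2‖ ≤
      ‖∑ i, ((if q i < 1 then c i else c i * (q i)⁻¹ ^ 2 : ℝ) : ℂ) /
        (1 - ((if q i < 1 then q i else (q i)⁻¹ : ℝ) : ℂ) * z) ^ 2‖ := by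
  have key : ∀ a b : ι → ℝ, ‖∑ i, (a i : ℂ) / (1 - b i * z) ^ 2‖ =
      ‖∑ i, (a i : ℂ) * koebeKernel (b i) z‖ := by
    intro a b
    rw [← one_mul ‖∑ i, (a i : ℂ) / (1 - b i * z) ^ 2‖, ← hz, ← norm_mul, Finset.mul_sum]
    congr 1
    exact Finset.sum_congr rfl fun i _ => by rw [koebeKernel]; ring
  rw [key, key]
  set c' : ι → ℝ := fun i => if q i < 1 then c i else c i * (q i)⁻¹ ^ 2
  set q' : ι → ℝ := fun i => if q i < 1 then q i else (q i)⁻¹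
  have hq' : ∀ i, 0 < q' i ∧ q' i < 1 := by
    intro i
    simp only [q']; split_ifs with h
    · exact ⟨hq i, h⟩
    · exact ⟨inv_pos.2 (hq i), inv_lt_one_of_one_lt₀ (lt_of_le_of_ne (not_lt.1 h) (hq1 i).symm)⟩
  have hc' : ∀ i, 0 < c' i := by
    intro i
    have := hc i; have := hq i
    simp only [c']; split_ifs <;> positivity
  refine norm_sum_le_of_re_eq _ _ z.im
    (fun i => c' i * ((1 - q' i ^ 2 * Complex.normSq z) / Complex.normSq ((1 - q' i * z) ^ 2)))
    (fun i => (mul_pos (hc' i) (koebeKernel_im_factor_pos (hq' i).1 (hq' i).2 hz.le)).le) ?_ ?_ ?_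
  · intro i
    by_cases h : q i < 1
    · simp [h]
    · rw [koebeKernel_inv (hq i) (hq1 i) hz]
      simp only [h, if_false, Complex.re_ofReal_mul, Complex.conj_re]
      ring
  · intro i
    rw [Complex.im_ofReal_mul, koebeKernel_im]; ring
  · intro i
    by_cases h : q i < 1
    · simp [h]
    · rw [koebeKernel_inv (hq i) (hq1 i) hz]
      simp only [h, if_false, Complex.im_ofReal_mul, Complex.conj_im]
      rw [mul_neg, mul_neg, abs_neg]; apply le_of_eq; congr 1; ring

end circle

theorem circleAverage_log_norm_one_sub_mul (ζ : ℂ) :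
    circleAverage (fun z => log ‖1 - ζ * z‖) 0 1 = log⁺ ‖ζ‖ := by
  have : Set.EqOn (fun z => log ‖1 - ζ * z‖) (fun z => log ‖z - (starRingEnd ℂ) ζ‖)
      (Metric.sphere 0 |1|) := by
    intro z hz
    have hz : ‖z‖ = 1 := by simpa using hz
    have hzz : z * (starRingEnd ℂ) z = 1 := by
      rw [Complex.mul_conj, Complex.normSq_eq_norm_sq, hz]; simp
    have : (starRingEnd ℂ) (z - (starRingEnd ℂ) ζ) * z = 1 - ζ * z := by
      simp only [map_sub, Complex.conj_conj]; linear_combination hzz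
    simp only [← this, norm_mul, hz, mul_one, Complex.norm_conj]
  rw [circleAverage_congr_sphere this, circleAverage_log_norm_sub_const_eq_posLog]
  simp

theorem circleIntegrable_log_norm_one_sub_mul (ζ : ℂ) :
    CircleIntegrable (fun z => log ‖1 - ζ * z‖) 0 1 := by
  apply MeromorphicOn.circleIntegrable_log_norm
  intro x _
  exact (by fun_prop : AnalyticAt ℂ (fun z : ℂ => 1 - ζ * z) x).meromorphicAt

theorem sum_posLog_le_of_factorization {ι : Type*} [Fintype ι] [Nonempty ι] [DecidableEq ι]
    {c q : ι → ℝ} (hc : ∀ i, 0 < c i) (hq : ∀ i, 0 < q i) (hq1 : ∀ i, q i ≠ 1)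
    {κ : Type*} [Fintype κ] (ζ : κ → ℂ) (hζ : ∀ j, ‖ζ j‖ ≠ 1)
    (hfac : ∀ z : ℂ, ∑ i, (c i : ℂ) * ∏ j ∈ Finset.univ.erase i, (1 - q j * z) ^ 2 =
      (∑ i, c i : ℝ) * ∏ j, (1 - ζ j * z)) :
    ∑ j, log⁺ ‖ζ j‖ ≤ 2 * ∑ i, log⁺ (q i) := by
  set c' : ι → ℝ := fun i => if q i < 1 then c i else c i * (q i)⁻¹ ^ 2 with hc'd
  set q' : ι → ℝ := fun i => if q i < 1 then q i else (q i)⁻¹ with hq'd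
  have hq' : ∀ i, 0 < q' i ∧ q' i < 1 := by
    intro i
    simp only [q']; split_ifs with h
    · exact ⟨hq i, h⟩
    · exact ⟨inv_pos.2 (hq i), inv_lt_one_of_one_lt₀ (lt_of_le_of_ne (not_lt.1 h) (hq1 i).symm)⟩
  have hc' : ∀ i, 0 < c' i := by
    intro i
    have := hc i; have := hq i
    simp only [c']; split_ifs <;> positivity
  have hc'le : ∀ i, c' i ≤ c i := by
    intro i
    simp only [c']; split_ifs with h
    · exact le_rfl
    · have h1 : (q i)⁻¹ ≤ 1 := inv_le_one_of_one_le₀ (not_lt.1 h)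
      have h2 : 0 ≤ (q i)⁻¹ := (inv_pos.2 (hq i)).le
      have : (q i)⁻¹ ^ 2 ≤ 1 := pow_le_one₀ h2 h1
      nlinarith [hc i]
  set C := ∑ i, c i with hC
  have hCpos : 0 < C := Finset.sum_pos (fun i _ => hc i) Finset.univ_nonempty
  set H : ℂ → ℂ := fun z => ∑ i, (c i : ℂ) / (1 - q i * z) ^ 2 with hH
  set H' : ℂ → ℂ := fun z => ∑ i, (c' i : ℂ) / (1 - q' i * z) ^ 2 with hH'
  have hAn : ∀ z, ‖z‖ ≤ 1 → AnalyticAt ℂ H' z := by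
    intro z hz
    have e : H' = ∑ i, fun z : ℂ => (c' i : ℂ) / (1 - q' i * z) ^ 2 := by ext z; simp [hH']
    rw [e]
    apply Finset.analyticAt_sum
    intro i _
    refine AnalyticAt.div (by fun_prop) (by fun_prop) ?_
    exact pow_ne_zero _ (one_sub_mul_ne_zero_of_lt (hq' i).1 (hq' i).2 hz)
  have hav : circleAverage (fun z => log ‖H' z‖) 0 1 = log (∑ i, c' i) := by
    rw [AnalyticOnNhd.circleAverage_log_norm_of_ne_zero]
    · simp only [hH', mul_zero, sub_zero, one_pow, div_one]
      rw [← Complex.ofReal_sum, Complex.norm_real, Real.norm_of_nonneg]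
      exact Finset.sum_nonneg fun i _ => (hc' i).le
    · intro z hz
      have hz : ‖z‖ ≤ 1 := by simpa using hz
      exact hAn z hz
    · intro z hz
      exact sum_koebe_ne_zero hc' (fun i => (hq' i).1) (fun i => (hq' i).2) (by simpa using hz)
  have hq1z : ∀ i, ∀ z : ℂ, ‖z‖ = 1 → 1 - (q i : ℂ) * z ≠ 0 := by
    intro i z hz h
    have h2 : (q i : ℂ) * z = 1 := by linear_combination -h
    have := congrArg norm h2
    rw [norm_mul, Complex.norm_real, Real.norm_of_nonneg (hq i).le, norm_one, hz, mul_one] at this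
    exact hq1 i this
  have hζ1z : ∀ j, ∀ z : ℂ, ‖z‖ = 1 → 1 - ζ j * z ≠ 0 := by
    intro j z hz h
    have h2 : ζ j * z = 1 := by linear_combination -h
    have := congrArg norm h2
    rw [norm_mul, norm_one, hz, mul_one] at this
    exact hζ j this
  have hHfac : ∀ z : ℂ, ‖z‖ = 1 → H z * ∏ i, (1 - q i * z) ^ 2 = C * ∏ j, (1 - ζ j * z) := by
    intro z hz
    rw [← hfac z, hH, Finset.sum_mul]
    refine Finset.sum_congr rfl fun i _ => ?_
    rw [← Finset.mul_prod_erase _ _ (Finset.mem_univ i)]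
    have := hq1z i z hz
    field_simp
  have hHne : ∀ z : ℂ, ‖z‖ = 1 → H z ≠ 0 := by
    intro z hz h
    have h1 := hHfac z hz
    rw [h, zero_mul] at h1
    refine absurd h1.symm (mul_ne_zero (by exact_mod_cast hCpos.ne') ?_)
    exact Finset.prod_ne_zero_iff.2 fun j _ => hζ1z j z hz
  have hlog : ∀ z : ℂ, ‖z‖ = 1 → log C + ∑ j, log ‖1 - ζ j * z‖ =
      log ‖H z‖ + 2 * ∑ i, log ‖1 - (q i : ℂ) * z‖ := by
    intro z hz
    have h1 := congrArg (fun w => log ‖w‖) (hHfac z hz)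
    simp only [norm_mul, norm_prod, norm_pow, Complex.norm_real, Real.norm_of_nonneg hCpos.le] at h1
    rw [Real.log_mul (norm_ne_zero_iff.2 (hHne z hz)) (Finset.prod_ne_zero_iff.2 fun i _ =>
      pow_ne_zero _ (norm_ne_zero_iff.2 (hq1z i z hz))), Real.log_mul hCpos.ne'
      (Finset.prod_ne_zero_iff.2 fun j _ => (norm_ne_zero_iff.2 (hζ1z j z hz))), Real.log_prod,
      Real.log_prod] at h1
    · rw [← h1, Finset.mul_sum]; simp
    · exact fun j _ => (norm_ne_zero_iff.2 (hζ1z j z hz))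
    · exact fun i _ => pow_ne_zero _ (norm_ne_zero_iff.2 (hq1z i z hz))
  have hle : ∀ z : ℂ, ‖z‖ = 1 → log ‖H z‖ ≤ log ‖H' z‖ := fun z hz =>
    Real.log_le_log (norm_pos_iff.2 (hHne z hz)) (norm_sum_koebe_le hc hq hq1 hz)
  have hI1 : CircleIntegrable (fun z => log C + ∑ j, log ‖1 - ζ j * z‖) 0 1 := by
    apply CircleIntegrable.add (circleIntegrable_const _ _ _)
    exact CircleIntegrable.fun_sum _ fun j _ => circleIntegrable_log_norm_one_sub_mul _
  have hI2 : CircleIntegrable (fun z => 2 * ∑ i, log ‖1 - (q i : ℂ) * z‖) 0 1 := by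
    apply CircleIntegrable.const_fun_smul (a := (2:ℝ))
    exact CircleIntegrable.fun_sum _ fun j _ => circleIntegrable_log_norm_one_sub_mul _
  have hI3 : CircleIntegrable (fun z => log ‖H' z‖) 0 1 := by
    apply MeromorphicOn.circleIntegrable_log_norm
    intro z hz
    have hz : ‖z‖ = 1 := by simpa using hz
    exact (hAn z hz.le).meromorphicAt
  have hmono : circleAverage (fun z => log C + ∑ j, log ‖1 - ζ j * z‖) 0 1 ≤
      circleAverage (fun z => log ‖H' z‖ + 2 * ∑ i, log ‖1 - (q i : ℂ) * z‖) 0 1 := by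
    refine circleAverage_mono hI1 (hI3.add hI2) fun z hz => ?_
    have hz : ‖z‖ = 1 := by simpa using hz
    rw [hlog z hz]; have := hle z hz; simpa using this
  rw [circleAverage_fun_add (circleIntegrable_const _ _ _)
    (CircleIntegrable.fun_sum _ fun j _ => circleIntegrable_log_norm_one_sub_mul _),
    circleAverage_fun_add hI3 hI2, circleAverage_const, hav,
    circleAverage_fun_sum (fun j _ => circleIntegrable_log_norm_one_sub_mul _)] at hmono
  have h2 : circleAverage (fun z => 2 * ∑ i, log ‖1 - (q i : ℂ) * z‖) 0 1 =
      2 * ∑ i, log⁺ (q i) := by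
    have := circleAverage_fun_smul (a := (2:ℝ)) (f := fun z => ∑ i, log ‖1 - (q i : ℂ) * z‖)
      (c := 0) (R := 1)
    simp only [smul_eq_mul] at this
    rw [this, circleAverage_fun_sum (fun j _ => circleIntegrable_log_norm_one_sub_mul _)]
    congr 1
    refine Finset.sum_congr rfl fun i _ => ?_
    rw [circleAverage_log_norm_one_sub_mul, Complex.norm_real, Real.norm_of_nonneg (hq i).le]
  rw [h2] at hmono
  have h3 : ∑ i, circleAverage (fun z => log ‖1 - ζ i * z‖) 0 1 = ∑ j, log⁺ ‖ζ j‖ :=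
    Finset.sum_congr rfl fun j _ => circleAverage_log_norm_one_sub_mul _
  rw [h3] at hmono
  have h4 : log (∑ i, c' i) ≤ log C :=
    Real.log_le_log (Finset.sum_pos (fun i _ => hc' i) Finset.univ_nonempty)
      (Finset.sum_le_sum fun i _ => hc'le i)
  linarith

theorem tendsto_log_mul_pow_inv {a : ℝ} (ha : 0 < a) {n : ℕ} (hn : 0 < n) :
    Filter.Tendsto (fun R : ℝ => -((n * log (a * R) + 1) * (R ^ n)⁻¹)) Filter.atTop (nhds 0) := by
  have h1 : Filter.Tendsto (fun R : ℝ => log R * (R ^ n)⁻¹) Filter.atTop (nhds 0) := by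
    have := (isLittleO_log_rpow_atTop (r := n) (by exact_mod_cast hn)).tendsto_div_nhds_zero
    simpa [div_eq_mul_inv] using this
  have h2 : Filter.Tendsto (fun R : ℝ => (R ^ n)⁻¹) Filter.atTop (nhds 0) :=
    (Filter.tendsto_pow_atTop hn.ne').inv_tendsto_atTop
  have h3 : Filter.Tendsto (fun R : ℝ => -(n * (log R * (R ^ n)⁻¹) + (n * log a + 1) * (R ^ n)⁻¹))
      Filter.atTop (nhds 0) := by
    have := ((h1.const_mul (n : ℝ)).add (h2.const_mul (n * log a + 1))).neg
    simpa using this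
  refine h3.congr' ?_
  filter_upwards [Filter.eventually_gt_atTop 0] with R hR
  rw [Real.log_mul ha.ne' hR.ne']; ring

theorem integral_posLog_mul_pow {a : ℝ} (ha : 0 ≤ a) {n : ℕ} (hn : 0 < n) :
    IntegrableOn (fun R : ℝ => log⁺ (a * R) * (n ^ 2 * (R ^ (n + 1))⁻¹)) (Set.Ioi 0) ∧
      ∫ R in Set.Ioi (0 : ℝ), log⁺ (a * R) * (n ^ 2 * (R ^ (n + 1))⁻¹) = a ^ n := by
  rcases ha.eq_or_lt with rfl | ha
  · simp [hn.ne']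
  have hd : ∀ R ∈ Set.Ici a⁻¹, HasDerivAt (fun R : ℝ => -((n * log (a * R) + 1) * (R ^ n)⁻¹))
      (log (a * R) * (n ^ 2 * (R ^ (n + 1))⁻¹)) R := by
    intro R hR
    have hR0 : 0 < R := lt_of_lt_of_le (inv_pos.2 ha) hR
    have h1 : HasDerivAt (fun R : ℝ => log (a * R)) (a / (a * R)) R := by
      refine HasDerivAt.log ?_ (by positivity)
      simpa using (hasDerivAt_id R).const_mul a
    have h2 := ((hasDerivAt_pow n R).inv (by positivity))
    have h3 := (((h1.const_mul (n : ℝ)).add_const 1).mul h2).neg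
    refine HasDerivAt.congr_deriv h3 ?_
    obtain ⟨m, rfl⟩ : ∃ m, n = m + 1 := ⟨n - 1, by omega⟩
    simp only [Pi.inv_apply, Nat.add_sub_cancel]
    field_simp
    push_cast
    ring
  have hpos : ∀ R ∈ Set.Ioi a⁻¹, 0 ≤ log (a * R) * (n ^ 2 * (R ^ (n + 1))⁻¹) := by
    intro R hR
    have hR0 : 0 < R := lt_trans (inv_pos.2 ha) hR
    have : 1 ≤ a * R := by
      have := mul_le_mul_of_nonneg_left (le_of_lt hR) ha.le
      rwa [mul_inv_cancel₀ ha.ne'] at this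
    have := Real.log_nonneg this
    positivity
  have hInt := integrableOn_Ioi_deriv_of_nonneg' hd hpos (tendsto_log_mul_pow_inv ha hn)
  have hval := integral_Ioi_of_hasDerivAt_of_nonneg' hd hpos (tendsto_log_mul_pow_inv ha hn)
  have hsub : Set.Ioi a⁻¹ ⊆ Set.Ioi (0 : ℝ) := Set.Ioi_subset_Ioi (inv_pos.2 ha).le
  have heq : ∀ R ∈ Set.Ioi a⁻¹, log⁺ (a * R) * (n ^ 2 * (R ^ (n + 1))⁻¹) =
      log (a * R) * (n ^ 2 * (R ^ (n + 1))⁻¹) := by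
    intro R hR
    have hR0 : 0 < R := lt_trans (inv_pos.2 ha) hR
    have : 1 ≤ a * R := by
      have := mul_le_mul_of_nonneg_left (le_of_lt hR) ha.le
      rwa [mul_inv_cancel₀ ha.ne'] at this
    rw [posLog_eq_log]
    rwa [abs_of_pos (by positivity)]
  have hz : ∀ R ∈ Set.Ioi (0 : ℝ) \ Set.Ioi a⁻¹,
      log⁺ (a * R) * ((n : ℝ) ^ 2 * (R ^ (n + 1))⁻¹) = 0 := by
    intro R hR
    have hR0 : 0 < R := hR.1
    have : a * R ≤ 1 := by
      have := mul_le_mul_of_nonneg_left (not_lt.1 hR.2) ha.le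
      rwa [mul_inv_cancel₀ ha.ne'] at this
    rw [(posLog_eq_zero_iff _).2, zero_mul]
    rwa [abs_of_pos (by positivity)]
  constructor
  · refine IntegrableOn.of_forall_sdiff_eq_zero
      ((integrableOn_congr_fun heq measurableSet_Ioi).2 hInt) measurableSet_Ioi hz
  · rw [setIntegral_eq_of_subset_of_forall_sdiff_eq_zero measurableSet_Ioi hsub hz,
      setIntegral_congr_fun measurableSet_Ioi heq, hval]
    simp [ha.ne']

theorem sum_pow_norm_le_of_factorization {ι : Type*} [Fintype ι] [Nonempty ι] [DecidableEq ι]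
    {c q : ι → ℝ} (hc : ∀ i, 0 < c i) (hq : ∀ i, 0 < q i)
    {κ : Type*} [Fintype κ] (ζ : κ → ℂ)
    (hfac : ∀ z : ℂ, ∑ i, (c i : ℂ) * ∏ j ∈ Finset.univ.erase i, (1 - q j * z) ^ 2 =
      (∑ i, c i : ℝ) * ∏ j, (1 - ζ j * z)) {n : ℕ} (hn : 0 < n) :
    ∑ j, ‖ζ j‖ ^ n ≤ 2 * ∑ i, q i ^ n := by
  have hR : ∀ R : ℝ, 0 < R → R ∉ Set.range (fun i => (q i)⁻¹) ∪ Set.range (fun j => ‖ζ j‖⁻¹) →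
      ∑ j, log⁺ (‖ζ j‖ * R) ≤ 2 * ∑ i, log⁺ (q i * R) := by
    intro R hR0 hR
    simp only [Set.mem_union, Set.mem_range, not_or, not_exists] at hR
    have := sum_posLog_le_of_factorization hc (fun i => mul_pos (hq i) hR0) (q := fun i => q i * R)
      (fun i h => hR.1 i (inv_eq_of_mul_eq_one_right h)) (fun j => ζ j * R)
      (fun j h => hR.2 j (inv_eq_of_mul_eq_one_right (by
        simpa [abs_of_pos hR0] using h))) (fun z => by
          have := hfac (R * z)
          push_cast at this ⊢
          simpa only [mul_assoc] using this)
    simpa [abs_of_pos hR0] using this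
  have hfin : (Set.range (fun i => (q i)⁻¹) ∪ Set.range (fun j => ‖ζ j‖⁻¹)).Finite :=
    (Set.finite_range _).union (Set.finite_range _)
  have e1 : ∑ j, ‖ζ j‖ ^ n = ∫ R in Set.Ioi (0 : ℝ),
      ∑ j, log⁺ (‖ζ j‖ * R) * (n ^ 2 * (R ^ (n + 1))⁻¹) := by
    rw [integral_finsetSum _ fun j _ => (integral_posLog_mul_pow (norm_nonneg (ζ j)) hn).1]
    exact Finset.sum_congr rfl fun j _ => (integral_posLog_mul_pow (norm_nonneg (ζ j)) hn).2.symm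
  have e2 : ∑ i, q i ^ n = ∫ R in Set.Ioi (0 : ℝ),
      ∑ i, log⁺ (q i * R) * (n ^ 2 * (R ^ (n + 1))⁻¹) := by
    rw [integral_finsetSum _ fun j _ => (integral_posLog_mul_pow (hq j).le hn).1]
    exact Finset.sum_congr rfl fun j _ => (integral_posLog_mul_pow (hq j).le hn).2.symm
  rw [e1, e2, ← integral_const_mul]
  refine integral_mono_ae
    (integrable_finsetSum _ fun j _ => (integral_posLog_mul_pow (norm_nonneg (ζ j)) hn).1)
    ((integrable_finsetSum _ fun j _ => (integral_posLog_mul_pow (hq j).le hn).1).const_mul 2) ?_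
  have hae : ∀ᵐ R : ℝ ∂(volume.restrict (Set.Ioi 0)),
      R ∉ Set.range (fun i => (q i)⁻¹) ∪ Set.range (fun j => ‖ζ j‖⁻¹) :=
    ae_restrict_of_ae (measure_eq_zero_iff_ae_notMem.1 (hfin.measure_zero _))
  filter_upwards [hae, ae_restrict_mem measurableSet_Ioi] with R h1 h2
  have h2 : 0 < R := h2
  have h3 : 0 ≤ (n : ℝ) ^ 2 * (R ^ (n + 1))⁻¹ := by positivity
  simp only [← Finset.sum_mul]
  rw [← mul_assoc (2 : ℝ)]
  exact mul_le_mul_of_nonneg_right (hR R h2 h1) h3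

theorem Polynomial.exists_factorization_one_sub (N : Polynomial ℂ) (h0 : N.coeff 0 ≠ 0) :
    ∃ (d : ℕ) (ζ : Fin d → ℂ), N = C (N.coeff 0) * ∏ j, (1 - C (ζ j) * X) := by
  obtain ⟨l, hl⟩ : ∃ l : List ℂ, N.roots = l := ⟨N.roots.toList, by simp⟩
  have hN0 : N ≠ 0 := by rintro rfl; simp at h0
  have hl0 : ∀ a ∈ l, a ≠ 0 := by
    rintro a ha rfl
    have : (0 : ℂ) ∈ N.roots := by rw [hl]; exact ha
    rw [mem_roots hN0, IsRoot.def, ← coeff_zero_eq_eval_zero] at this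
    exact h0 this
  have hN : N = C N.leadingCoeff * (l.map fun a => X - C a).prod := by
    have := (IsAlgClosed.splits N).eq_prod_roots
    rwa [hl, Multiset.map_coe, Multiset.prod_coe] at this
  have hfac : (l.map fun a : ℂ => X - C a).prod =
      C (l.map fun a => -a).prod * (l.map fun a => 1 - C a⁻¹ * X).prod := by
    clear hl hN
    induction l with
    | nil => simp
    | cons a l ih =>
      have ha : a ≠ 0 := hl0 a (by simp)
      simp only [List.map_cons, List.prod_cons, ih fun b hb => hl0 b (by simp [hb]), map_mul]
      have : (X - C a : Polynomial ℂ) = C (-a) * (1 - C a⁻¹ * X) := by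
        rw [mul_sub, ← mul_assoc, ← C_mul, neg_mul, mul_inv_cancel₀ ha]
        simp; ring
      rw [this]; ring
  have h1 : N = C (N.leadingCoeff * (l.map fun a => -a).prod) *
      (l.map fun a => 1 - C a⁻¹ * X).prod := by
    rw [map_mul, mul_assoc, ← hfac]; exact hN
  have h2 : N.coeff 0 = N.leadingCoeff * (l.map fun a => -a).prod := by
    conv_lhs => rw [h1]
    rw [mul_coeff_zero, coeff_C_zero]
    have : ((l.map fun a : ℂ => 1 - C a⁻¹ * X).prod).coeff 0 = 1 := by
      rw [coeff_zero_eq_eval_zero, eval_list_prod]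
      apply List.prod_eq_one
      simp
    rw [this, mul_one]
  refine ⟨l.length, fun i => (l[i])⁻¹, ?_⟩
  rw [h2]
  exact h1.trans (by rw [← Fin.prod_univ_fun_getElem l fun a => (1 - C a⁻¹ * X : Polynomial ℂ)]; rfl)

/-- The coefficients `r` of the power series `P' / P`, where `P = ∑ p n Xⁿ`. -/
noncomputable def logDerivCoeff (p : ℕ → ℝ) (n : ℕ) : ℝ :=
  ((n + 1) * p (n + 1) - ∑ k : Fin n, logDerivCoeff p k * p (n - k)) / p 0
termination_by n
decreasing_by exact k.2

theorem logDerivCoeff_eq (p : ℕ → ℝ) (n : ℕ) : logDerivCoeff p n =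
    ((n + 1) * p (n + 1) - ∑ k : Fin n, logDerivCoeff p k * p (n - k)) / p 0 := by
  rw [logDerivCoeff]

theorem sum_logDerivCoeff_mul {p : ℕ → ℝ} (h0 : p 0 ≠ 0) (n : ℕ) :
    ∑ k ∈ Finset.range (n + 1), logDerivCoeff p k * p (n - k) = (n + 1) * p (n + 1) := by
  rw [Finset.sum_range_succ, Nat.sub_self]
  rw [logDerivCoeff_eq p n, div_mul_cancel₀ _ h0, ← Fin.sum_univ_eq_sum_range (fun k => logDerivCoeff p k * p (n - k))]
  ring

theorem logDerivCoeff_unique {p : ℕ → ℝ} (h0 : p 0 ≠ 0) (s : ℕ → ℝ)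
    (hs : ∀ n : ℕ, ∑ k ∈ Finset.range (n + 1), s k * p (n - k) = (n + 1) * p (n + 1)) (n : ℕ) :
    logDerivCoeff p n = s n := by
  induction n using Nat.strong_induction_on with
  | _ n ih =>
    have h1 := hs n
    rw [← sum_logDerivCoeff_mul h0 n, Finset.sum_range_succ, Finset.sum_range_succ,
      Finset.sum_congr rfl fun k hk => by rw [← ih k (Finset.mem_range.1 hk)], Nat.sub_self] at h1
    exact (mul_right_cancel₀ h0 (by linarith))

theorem tendsto_logDerivCoeff {P : ℕ → ℕ → ℝ} {p : ℕ → ℝ} (h0 : p 0 ≠ 0) (n : ℕ)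
    (h : ∀ m ≤ n + 1, Filter.Tendsto (fun j => P j m) Filter.atTop (nhds (p m))) :
    Filter.Tendsto (fun j => logDerivCoeff (P j) n) Filter.atTop (nhds (logDerivCoeff p n)) := by
  induction n using Nat.strong_induction_on with
  | _ n ih =>
    simp_rw [logDerivCoeff_eq _ n]
    refine Filter.Tendsto.div (Filter.Tendsto.sub ((h _ le_rfl).const_mul _) ?_) (h 0 (by omega)) h0
    refine tendsto_finsetSum _ fun k _ => Filter.Tendsto.mul (ih k k.2 fun m hm => h m ?_) (h _ ?_)
    · have := k.2; omega
    · omega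

section PowerSeries
open PowerSeries

theorem PowerSeries.mk_pow_mul_one_sub {R : Type*} [CommRing R] (a : R) :
    (mk fun n => a ^ n) * (1 - C a * X) = 1 := by
  ext n
  rw [mul_sub, mul_one, ← mul_assoc, map_sub]
  cases n with
  | zero => simp
  | succ n =>
    rw [coeff_succ_mul_X, mul_comm _ (C a), coeff_C_mul]
    simp [pow_succ', coeff_one]

theorem PowerSeries.mk_pow_sq {R : Type*} [CommRing R] (a : R) :
    (mk fun n => a ^ n) ^ 2 = mk fun n => (n + 1 : R) * a ^ n := by
  ext n
  rw [sq, coeff_mul, coeff_mk]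
  simp only [coeff_mk]
  rw [Finset.sum_congr rfl fun x hx => by
    rw [← pow_add, show x.1 + x.2 = n by simpa using hx], Finset.sum_const, Finset.Nat.card_antidiagonal]
  simp

theorem PowerSeries.derivative_prod_eq {R : Type*} [CommRing R] {κ : Type*} (s : Finset κ)
    (A T : κ → R⟦X⟧) (h : ∀ j ∈ s, d⁄dX R (A j) = T j * A j) :
    d⁄dX R (∏ j ∈ s, A j) = (∑ j ∈ s, T j) * ∏ j ∈ s, A j := by
  classical
  induction s using Finset.induction_on with
  | empty => simp
  | insert a s ha ih =>
    rw [Finset.prod_insert ha, Finset.sum_insert ha, Derivation.leibniz,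
      ih fun j hj => h j (by simp [hj]), h a (by simp)]
    simp only [smul_eq_mul]; ring

theorem PowerSeries.derivative_one_sub {R : Type*} [CommRing R] (a : R) :
    d⁄dX R (1 - C a * X) = (-mk fun n => a ^ (n + 1)) * (1 - C a * X) := by
  have h1 : (mk fun n => a ^ (n + 1)) = C a * mk fun n => a ^ n := by
    ext n; simp [pow_succ']
  rw [h1, neg_mul, mul_assoc, mk_pow_mul_one_sub, map_sub, Derivation.leibniz]
  simp

theorem logDerivCoeff_nonneg {ι : Type*} [Fintype ι] [Nonempty ι] {c q : ι → ℝ}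
    (hc : ∀ i, 0 < c i) (hq : ∀ i, 0 < q i) (n : ℕ) :
    0 ≤ logDerivCoeff (fun n => ∑ i, c i * ((n + 1) * q i ^ n)) n := by
  classical
  set Np : Polynomial ℂ := ∑ i, Polynomial.C (c i : ℂ) *
    ∏ j ∈ Finset.univ.erase i, (1 - Polynomial.C (q j : ℂ) * Polynomial.X) ^ 2 with hNp
  have hCpos : 0 < ∑ i, c i := Finset.sum_pos (fun i _ => hc i) Finset.univ_nonempty
  have heval : ∀ z, Np.eval z = ∑ i, (c i : ℂ) * ∏ j ∈ Finset.univ.erase i, (1 - q j * z) ^ 2 := by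
    intro z
    simp [hNp, Polynomial.eval_finsetSum, Polynomial.eval_prod]
  have hN0 : Np.coeff 0 = (∑ i, c i : ℝ) := by
    rw [Polynomial.coeff_zero_eq_eval_zero, heval]; simp
  have hN0' : Np.coeff 0 ≠ 0 := by rw [hN0]; exact_mod_cast hCpos.ne'
  obtain ⟨d, ζ, hζ⟩ := Np.exists_factorization_one_sub hN0'
  have hpow := fun m (hm : 0 < m) => sum_pow_norm_le_of_factorization hc hq ζ (fun z => by
    rw [← heval, hζ, hN0]; simp [Polynomial.eval_prod, -map_sum, -Complex.ofReal_sum]) (n := m) hm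
  set P : ℂ⟦X⟧ := mk fun n => ((∑ i, c i * ((n + 1) * q i ^ n) : ℝ) : ℂ) with hP
  set D : ℂ⟦X⟧ := ∏ i, (1 - C (q i : ℂ) * X) ^ 2 with hD
  have hPs : P = ∑ i, C (c i : ℂ) * (mk fun n => (q i : ℂ) ^ n) ^ 2 := by
    ext n
    simp [hP, mk_pow_sq]
  have hPD : P * D = C (Np.coeff 0) * ∏ j, (1 - C (ζ j) * X) := by
    have h1 := congrArg (Polynomial.coeToPowerSeries.ringHom (R := ℂ)) (hNp.symm.trans hζ)
    simp only [map_sum, map_mul, map_prod, map_pow, map_sub, map_one,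
      Polynomial.coeToPowerSeries.ringHom_apply, Polynomial.coe_C, Polynomial.coe_X] at h1
    rw [← h1, hPs, Finset.sum_mul]
    refine Finset.sum_congr rfl fun i _ => ?_
    rw [hD, ← Finset.mul_prod_erase _ _ (Finset.mem_univ i), mul_assoc, ← mul_assoc (_ ^ 2),
      ← mul_pow, mk_pow_mul_one_sub, one_pow, one_mul]
  set TD : ℂ⟦X⟧ := ∑ i, 2 * (-mk fun n => (q i : ℂ) ^ (n + 1)) with hTD
  set TN : ℂ⟦X⟧ := ∑ j, (-mk fun n => (ζ j) ^ (n + 1)) with hTN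
  have hDd : d⁄dX ℂ D = TD * D := by
    refine derivative_prod_eq _ _ _ fun i _ => ?_
    rw [sq, Derivation.leibniz, derivative_one_sub]
    simp only [smul_eq_mul]; ring
  have hNd : d⁄dX ℂ (P * D) = TN * (P * D) := by
    rw [hPD, Derivation.leibniz, derivative_prod_eq _ _ _ fun j _ => derivative_one_sub (ζ j)]
    simp only [smul_eq_mul, derivative_C]; ring
  have hDne : D ≠ 0 := by
    intro h
    have := congrArg constantCoeff h
    simp [hD] at this
  have hPd : d⁄dX ℂ P = (TN - TD) * P := by
    rw [Derivation.leibniz, hDd] at hNd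
    simp only [smul_eq_mul] at hNd
    refine mul_right_cancel₀ hDne ?_
    linear_combination hNd
  set s : ℕ → ℝ := fun n => (coeff n (TN - TD)).re with hs
  have hTc : ∀ n, coeff n (TN - TD) = 2 * ∑ i, (q i : ℂ) ^ (n + 1) - ∑ j, ζ j ^ (n + 1) := by
    intro n
    have h2 : (2 : ℂ⟦X⟧) = C 2 := (map_ofNat C 2).symm
    simp only [hTN, hTD, map_sub, map_sum, map_neg, coeff_mk, h2, coeff_C_mul,
      Finset.sum_neg_distrib, Finset.mul_sum, mul_neg]
    ring
  have hrec : ∀ n : ℕ, ∑ k ∈ Finset.range (n + 1), s k *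
      (∑ i, c i * (((n - k : ℕ) + 1) * q i ^ (n - k))) =
      (n + 1) * ∑ i, c i * (((n + 1 : ℕ) + 1) * q i ^ (n + 1)) := by
    intro n
    have h1 := congrArg (fun A => (coeff n A).re) hPd
    simp only [coeff_derivative, coeff_mul, hP, coeff_mk] at h1
    rw [Finset.Nat.sum_antidiagonal_eq_sum_range_succ_mk] at h1
    simp only [Complex.re_sum, Complex.re_mul_ofReal] at h1
    rw [hs]
    rw [← h1]
    have : ((n : ℂ) + 1) = ((n + 1 : ℝ) : ℂ) := by push_cast; rfl
    rw [this, ← Complex.ofReal_mul, Complex.ofReal_re]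
    push_cast; ring
  rw [logDerivCoeff_unique (p := fun n : ℕ => ∑ i, c i * (((n : ℝ) + 1) * q i ^ n))
    (by simpa using hCpos.ne') s hrec n, hs]
  simp only [hTc]
  have h1 := hpow (n + 1) (by omega)
  have h2 : (∑ j, ζ j ^ (n + 1)).re ≤ ∑ j, ‖ζ j‖ ^ (n + 1) := by
    refine (Complex.re_le_norm _).trans ((norm_sum_le _ _).trans (le_of_eq ?_))
    simp
  have h3 : (2 * ∑ i, (q i : ℂ) ^ (n + 1)).re = 2 * ∑ i, q i ^ (n + 1) := by
    have : (2 * ∑ i, (q i : ℂ) ^ (n + 1)) = ((2 * ∑ i, q i ^ (n + 1) : ℝ) : ℂ) := by push_cast; rfl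
    rw [this, Complex.ofReal_re]
  rw [Complex.sub_re, h3]
  linarith

end PowerSeries

/-- A function on `(0, ∞)` lying in the closed convex cone generated by the exponentials
`x ↦ exp (-l x)`, `0 ≤ l`, expressed by duality. -/
def IsCM (g : ℝ → ℝ) : Prop :=
  ∀ (n : ℕ) (x c : Fin n → ℝ), (∀ i, 0 < x i) →
    (∀ l : ℝ, 0 ≤ l → 0 ≤ ∑ i, c i * exp (-(l * x i))) → 0 ≤ ∑ i, c i * g (x i)

namespace IsCM
variable {f g : ℝ → ℝ}

theorem congr (hf : IsCM f) (h : ∀ x, 0 < x → f x = g x) : IsCM g := by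
  intro n x c hx hc
  rw [Finset.sum_congr rfl fun i _ => by rw [← h _ (hx i)]]
  exact hf n x c hx hc

theorem exp_neg {l : ℝ} (hl : 0 ≤ l) : IsCM fun x => exp (-(l * x)) := fun _ _ _ _ hc => hc l hl

theorem const {a : ℝ} (ha : 0 ≤ a) : IsCM fun _ => a := by
  intro n x c hx hc
  have := hc 0 le_rfl
  simp only [zero_mul, neg_zero, exp_zero, mul_one] at this
  rw [← Finset.sum_mul]; positivity

theorem add (hf : IsCM f) (hg : IsCM g) : IsCM fun x => f x + g x := by
  intro n x c hx hc
  simp only [mul_add, Finset.sum_add_distrib]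
  exact add_nonneg (hf n x c hx hc) (hg n x c hx hc)

theorem mul (hf : IsCM f) (hg : IsCM g) : IsCM fun x => f x * g x := by
  intro n x c hx hc
  have h1 : ∀ m : ℝ, 0 ≤ m → 0 ≤ ∑ i, (c i * f (x i)) * exp (-(m * x i)) := by
    intro m hm
    have := hf n x (fun i => c i * exp (-(m * x i))) hx (fun l hl => by
      refine (hc (l + m) (add_nonneg hl hm)).trans (le_of_eq ?_)
      refine Finset.sum_congr rfl fun i _ => ?_
      rw [mul_assoc, ← exp_add]; congr 2; ring)
    refine this.trans (le_of_eq (Finset.sum_congr rfl fun i _ => by ring))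
  refine (hg n x (fun i => c i * f (x i)) hx h1).trans
    (le_of_eq (Finset.sum_congr rfl fun i _ => by ring))

theorem pow (hf : IsCM f) (k : ℕ) : IsCM fun x => f x ^ k := by
  induction k with
  | zero => simpa using const zero_le_one
  | succ k ih => simpa only [pow_succ] using ih.mul hf

theorem const_mul (hf : IsCM f) {a : ℝ} (ha : 0 ≤ a) : IsCM fun x => a * f x := (const ha).mul hf

theorem sum {ι : Type*} (s : Finset ι) {G : ι → ℝ → ℝ} (hG : ∀ i ∈ s, IsCM (G i)) :
    IsCM fun x => ∑ i ∈ s, G i x := by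
  classical
  induction s using Finset.induction_on with
  | empty => simpa using const le_rfl
  | insert a s ha ih =>
    simp only [Finset.sum_insert ha]
    exact (hG a (by simp)).add (ih fun i hi => hG i (by simp [hi]))

theorem of_tendsto {ι : Type*} {F : Filter ι} [F.NeBot] {G : ι → ℝ → ℝ}
    (hG : ∀ᶠ i in F, IsCM (G i))
    (h : ∀ x, 0 < x → Filter.Tendsto (fun i => G i x) F (nhds (g x))) : IsCM g := by
  intro n x c hx hc
  have : Filter.Tendsto (fun j => ∑ i, c i * G j (x i)) F (nhds (∑ i, c i * g (x i))) :=
    tendsto_finsetSum _ fun i _ => (h _ (hx i)).const_mul _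
  exact ge_of_tendsto this (hG.mono fun j hj => hj n x c hx hc)

theorem integral {T : Type*} [MeasurableSpace T] {μ : Measure T} {G : T → ℝ → ℝ}
    (hG : ∀ᵐ t ∂μ, IsCM (G t)) (hi : ∀ x, 0 < x → Integrable (fun t => G t x) μ) :
    IsCM fun x => ∫ t, G t x ∂μ := by
  intro n x c hx hc
  have : ∑ i, c i * ∫ t, G t (x i) ∂μ = ∫ t, ∑ i, c i * G t (x i) ∂μ := by
    rw [integral_finsetSum _ fun i _ => (hi _ (hx i)).const_mul _]
    exact Finset.sum_congr rfl fun i _ => (integral_const_mul _ _).symm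
  rw [this]
  exact integral_nonneg_of_ae (hG.mono fun t ht => ht n x c hx hc)

theorem comp {φ : ℝ → ℝ} (hf : IsCM f) (hpos : ∀ x, 0 < x → 0 < φ x)
    (hφ : ∀ l : ℝ, 0 ≤ l → IsCM fun x => Real.exp (-(l * φ x))) : IsCM fun x => f (φ x) :=
  fun n x c hx hc => hf n (fun i => φ (x i)) c (fun i => hpos _ (hx i))
    fun l hl => hφ l hl n x c hx hc

theorem exp_comp (hf : IsCM f) : IsCM fun x => Real.exp (f x) := by
  refine of_tendsto (F := Filter.atTop) (G := fun N x => ∑ k ∈ Finset.range N, f x ^ k / k.factorial)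
    (Filter.Eventually.of_forall fun N => sum _ fun k _ => ?_) fun x _ => ?_
  · simp only [div_eq_inv_mul]
    exact (hf.pow k).const_mul (by positivity)
  · rw [Real.exp_eq_exp_ℝ]
    exact (NormedSpace.expSeries_div_hasSum_exp (𝔸 := ℝ) (f x)).tendsto_sum_nat

end IsCM

theorem logDerivCoeff_nonneg' {ι : Type*} [Fintype ι] {c q : ι → ℝ}
    (hc : ∀ i, 0 ≤ c i) (hq : ∀ i, 0 < q i) (hs : 0 < ∑ i, c i) (n : ℕ) :
    0 ≤ logDerivCoeff (fun n => ∑ i, c i * ((n + 1) * q i ^ n)) n := by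
  classical
  have key : ∀ F : ι → ℝ, ∑ i, c i * F i = ∑ i : {i // 0 < c i}, c i * F i := by
    intro F
    rw [← Finset.sum_subtype (Finset.univ.filter fun i => 0 < c i) (by simp) fun i => c i * F i]
    refine (Finset.sum_filter_of_ne fun i _ hi => (hc i).lt_of_ne' ?_).symm
    rintro h
    simp [h] at hi
  have : Nonempty {i // 0 < c i} := by
    by_contra h
    rw [not_nonempty_iff] at h
    have := key fun _ => 1
    simp at this; linarith
  simp only [key]
  exact logDerivCoeff_nonneg (fun i => i.2) (fun i => hq _) n

/-- The cone of finite moment sequences of discrete measures on `(0, 1]`. -/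
def momentCone (N : ℕ) : Set (Fin N → ℝ) :=
  {v | ∃ (ι : Type) (_ : Fintype ι) (c q : ι → ℝ), (∀ i, 0 ≤ c i) ∧ (∀ i, 0 < q i) ∧
    ∀ n, v n = ∑ i, c i * q i ^ (n : ℕ)}

theorem smul_mem_momentCone {N : ℕ} {v : Fin N → ℝ} (hv : v ∈ momentCone N) {a : ℝ} (ha : 0 ≤ a) :
    a • v ∈ momentCone N := by
  obtain ⟨ι, _, c, q, hc, hq, h⟩ := hv
  refine ⟨ι, inferInstance, fun i => a * c i, q, fun i => mul_nonneg ha (hc i), hq, fun n => ?_⟩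
  simp [h, Finset.mul_sum, mul_assoc]

theorem convex_momentCone (N : ℕ) : Convex ℝ (momentCone N) := by
  intro v hv w hw a b ha hb _
  obtain ⟨ι, _, c, q, hc, hq, h⟩ := smul_mem_momentCone hv ha
  obtain ⟨κ, _, d, r, hd, hr, h'⟩ := smul_mem_momentCone hw hb
  refine ⟨ι ⊕ κ, inferInstance, Sum.elim c d, Sum.elim q r, ?_, ?_, fun n => ?_⟩
  · rintro (i | i) <;> simp [hc, hd]
  · rintro (i | i) <;> simp [hq, hr]
  · rw [Pi.add_apply, h, h']; simp

theorem IsCM.mem_closure_momentCone {g : ℝ → ℝ} (hg : IsCM g) {h : ℝ} (hh : 0 < h) (N : ℕ) :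
    (fun n : Fin N => g ((n + 1) * h)) ∈ closure (momentCone N) := by
  by_contra hv
  obtain ⟨f, u, hf, hu⟩ := geometric_hahn_banach_closed_point
    (convex_momentCone N).closure isClosed_closure hv
  have hf' : ∀ a ∈ momentCone N, f a < u := fun a ha => hf a (subset_closure ha)
  have hu0 : 0 < u := by
    simpa using hf' 0 ⟨Empty, inferInstance, Empty.elim, Empty.elim, by simp, by simp, by simp⟩
  have hneg : ∀ a ∈ momentCone N, f a ≤ 0 := by
    intro a ha
    by_contra h0
    push Not at h0
    have := hf' _ (smul_mem_momentCone ha (div_pos hu0 h0).le)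
    rw [map_smul, smul_eq_mul, div_mul_cancel₀ _ h0.ne'] at this
    exact lt_irrefl _ this
  have hrep : ∀ v : Fin N → ℝ, f v = ∑ n, f (Pi.single n 1) * v n := by
    intro v
    conv_lhs => rw [← Finset.univ_sum_single v, map_sum]
    refine Finset.sum_congr rfl fun n _ => ?_
    have : (Pi.single n (v n) : Fin N → ℝ) = v n • Pi.single n 1 := by
      rw [← Pi.single_smul]; simp
    rw [this, map_smul, smul_eq_mul, mul_comm]
  have := hg N (fun n => (n + 1) * h) (fun n => -f (Pi.single n 1)) (fun n => by positivity) ?_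
  · simp only [neg_mul, Finset.sum_neg_distrib] at this
    rw [hrep] at hu
    linarith
  · intro l hl
    have h1 := hneg (fun n => exp (-(l * h)) * exp (-(l * h)) ^ (n : ℕ))
      ⟨Unit, inferInstance, fun _ => exp (-(l * h)), fun _ => exp (-(l * h)),
        fun _ => (exp_pos _).le, fun _ => exp_pos _, by simp⟩
    rw [hrep] at h1
    simp only [neg_mul, Finset.sum_neg_distrib, Left.nonneg_neg_iff]
    refine (le_of_eq (Finset.sum_congr rfl fun n _ => ?_)).trans h1
    rw [← Real.exp_nat_mul, ← exp_add]
    congr 2; ring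

theorem IsCM.logDerivCoeff_nonneg {g : ℝ → ℝ} (hg : IsCM g) {h : ℝ} (hh : 0 < h) (hgh : 0 < g h)
    (n : ℕ) : 0 ≤ logDerivCoeff (fun n => (n + 1) * g ((n + 1) * h)) n := by
  obtain ⟨V, hV, hlim⟩ := mem_closure_iff_seq_limit.1 (hg.mem_closure_momentCone hh (n + 2))
  choose ι _ c q hc hq hVe using hV
  have hlim' : ∀ m ≤ n + 1, Filter.Tendsto (fun j => ∑ i, c j i * (((m : ℝ) + 1) * q j i ^ m))
      Filter.atTop (nhds ((m + 1) * g ((m + 1) * h))) := by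
    intro m hm
    have h1 := (tendsto_pi_nhds.1 hlim ⟨m, by omega⟩).const_mul ((m : ℝ) + 1)
    refine h1.congr fun j => ?_
    rw [hVe, Finset.mul_sum]
    exact Finset.sum_congr rfl fun i _ => by ring
  have hpos : ∀ᶠ j in Filter.atTop, 0 < ∑ i, c j i := by
    have := (hlim' 0 (by omega)).eventually_const_lt (u := 0) (by simpa using hgh)
    simpa using this
  refine ge_of_tendsto (tendsto_logDerivCoeff (p := fun n : ℕ => ((n : ℝ) + 1) * g ((n + 1) * h))
    (P := fun j (m : ℕ) => ∑ i, c j i * (((m : ℝ) + 1) * q j i ^ m))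
    (by simpa using hgh.ne') n hlim') ?_
  filter_upwards [hpos] with j hj
  exact logDerivCoeff_nonneg' (hc j) (hq j) hj n

instance isProbabilityMeasure_convPow (ν : Measure ℝ) [IsProbabilityMeasure ν] (n : ℕ) :
    IsProbabilityMeasure (convPow ν n) := by
  induction n with
  | zero => rw [convPow]; infer_instance
  | succ n ih => rw [convPow]; infer_instance

theorem charFun_convPow (ν : Measure ℝ) [IsProbabilityMeasure ν] (n : ℕ) (t : ℝ) :
    charFun (convPow ν n) t = charFun ν t ^ n := by
  induction n with
  | zero => simp [convPow, charFun_dirac]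
  | succ n ih => rw [convPow, charFun_conv, ih, pow_succ]

theorem conv_apply_ge (κ ν : Measure ℝ) [IsProbabilityMeasure κ] [IsProbabilityMeasure ν]
    (hκ : κ (Set.Ici 0) = 1) {s : Set ℝ} (hs : MeasurableSet s)
    (hup : ∀ x ∈ s, ∀ y, 0 ≤ y → y + x ∈ s) : ν s ≤ (κ.conv ν) s := by
  rw [Measure.conv, Measure.map_apply (by fun_prop) hs]
  calc ν s = (κ.prod ν) (Set.Ici 0 ×ˢ s) := by rw [Measure.prod_prod, hκ, one_mul]
    _ ≤ _ := measure_mono fun p hp => hup _ hp.2 _ hp.1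

theorem convPow_Ici (ν : Measure ℝ) [IsProbabilityMeasure ν] (hν : ν (Set.Ici 0) = 1) (n : ℕ) :
    convPow ν n (Set.Ici 0) = 1 := by
  induction n with
  | zero => simp [convPow]
  | succ n ih =>
    refine le_antisymm prob_le_one ?_
    rw [← hν]
    exact conv_apply_ge _ _ ih measurableSet_Ici fun x hx y hy => add_nonneg hy hx

theorem le_convPow_Ioi (ν : Measure ℝ) [IsProbabilityMeasure ν] (hν : ν (Set.Ici 0) = 1) {n : ℕ}
    (hn : 0 < n) (M : ℝ) : ν (Set.Ioi M) ≤ convPow ν n (Set.Ioi M) := by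
  obtain ⟨n, rfl⟩ : ∃ k, n = k + 1 := ⟨n - 1, by omega⟩
  refine conv_apply_ge _ _ (convPow_Ici ν hν n) measurableSet_Ioi fun x hx y hy => ?_
  simp only [Set.mem_Ioi] at *; linarith

section root
open PowerSeries

/-- The coefficients of a power series with logarithmic derivative `r` and constant term `a`. -/
noncomputable def expCoeff (r : ℕ → ℝ) (a : ℝ) : ℕ → ℝ
  | 0 => a
  | n + 1 => (∑ k : Fin (n + 1), r k * expCoeff r a (n - k)) / (n + 1)
decreasing_by omega

theorem expCoeff_succ (r : ℕ → ℝ) (a : ℝ) (n : ℕ) : expCoeff r a (n + 1) =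
    (∑ k ∈ Finset.range (n + 1), r k * expCoeff r a (n - k)) / (n + 1) := by
  rw [expCoeff, ← Fin.sum_univ_eq_sum_range (fun k => r k * expCoeff r a (n - k))]

theorem expCoeff_nonneg {r : ℕ → ℝ} (hr : ∀ n, 0 ≤ r n) {a : ℝ} (ha : 0 ≤ a) (n : ℕ) :
    0 ≤ expCoeff r a n := by
  induction n using Nat.strong_induction_on with
  | _ n ih =>
    cases n with
    | zero => simpa [expCoeff] using ha
    | succ n =>
      rw [expCoeff_succ]
      refine div_nonneg (Finset.sum_nonneg fun k _ => mul_nonneg (hr k) (ih _ ?_)) (by positivity)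
      omega

theorem expCoeff_unique {r v : ℕ → ℝ} (hv : ∀ n : ℕ, (n + 1) * v (n + 1) =
    ∑ k ∈ Finset.range (n + 1), r k * v (n - k)) (n : ℕ) : v n = expCoeff r (v 0) n := by
  induction n using Nat.strong_induction_on with
  | _ n ih =>
    cases n with
    | zero => simp [expCoeff]
    | succ n =>
      have h0 : (n + 1 : ℝ) ≠ 0 := by positivity
      rw [expCoeff_succ, eq_div_iff h0, mul_comm, hv]
      exact Finset.sum_congr rfl fun k _ => by rw [ih _ (by omega)]

theorem derivative_eq_iff_recurrence (r v : ℕ → ℝ) :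
    d⁄dX ℝ (mk v) = mk r * mk v ↔
      ∀ n : ℕ, (n + 1) * v (n + 1) = ∑ k ∈ Finset.range (n + 1), r k * v (n - k) := by
  rw [PowerSeries.ext_iff]
  refine forall_congr' fun n => ?_
  rw [coeff_derivative, coeff_mul, Finset.Nat.sum_antidiagonal_eq_sum_range_succ_mk]
  simp only [coeff_mk]
  rw [mul_comm]

theorem exists_pow_eq_of_logDerivCoeff_nonneg {w : ℕ → ℝ} (h0 : 0 < w 0)
    (hr : ∀ n, 0 ≤ logDerivCoeff w n) {m : ℕ} (hm : 0 < m) :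
    ∃ v : ℕ → ℝ, 0 < v 0 ∧ (∀ n, 0 ≤ v n) ∧ (mk v) ^ m = mk w := by
  set r : ℕ → ℝ := fun n => logDerivCoeff w n / m with hrd
  have hm' : (m : ℝ) ≠ 0 := by positivity
  set a : ℝ := w 0 ^ (1 / m : ℝ)
  have ha : 0 < a := Real.rpow_pos_of_pos h0 _
  set v := expCoeff r a with hv
  have hv0 : v 0 = a := by simp [v, expCoeff]
  refine ⟨v, by rwa [hv0], expCoeff_nonneg (fun n => div_nonneg (hr n) (by positivity)) ha.le, ?_⟩
  have hV : d⁄dX ℝ (mk v) = mk r * mk v := by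
    rw [derivative_eq_iff_recurrence]
    intro n
    have h0 : (n + 1 : ℝ) ≠ 0 := by positivity
    rw [hv, expCoeff_succ, mul_div_cancel₀ _ h0]
  have hW : ∀ n : ℕ, (n + 1) * w (n + 1) =
      ∑ k ∈ Finset.range (n + 1), logDerivCoeff w k * w (n - k) :=
    fun n => (sum_logDerivCoeff_mul h0.ne' n).symm
  set u : ℕ → ℝ := fun n => coeff n ((mk v) ^ m) with hu
  have hmku : mk u = (mk v) ^ m := by ext n; simp [hu]
  have hU : d⁄dX ℝ (mk u) = mk (logDerivCoeff w) * mk u := by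
    have e1 : mk (logDerivCoeff w) = C (m : ℝ) * mk r := by
      ext n; simp only [coeff_mk, coeff_C_mul, hrd]; field_simp
    rw [hmku, Derivation.leibniz_pow, hV, e1]
    obtain ⟨k, rfl⟩ : ∃ k, m = k + 1 := ⟨m - 1, by omega⟩
    simp only [Nat.add_sub_cancel, smul_eq_mul, nsmul_eq_mul, pow_succ]
    rw [map_natCast]; ring
  have hu0 : u 0 = w 0 := by
    have : u 0 = a ^ m := by
      simp only [hu, coeff_zero_eq_constantCoeff, map_pow]
      rw [← coeff_zero_eq_constantCoeff_apply, coeff_mk, hv0]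
    rw [this, ← Real.rpow_natCast, ← Real.rpow_mul h0.le]
    simp [hm']
  rw [← hmku]
  ext n
  rw [coeff_mk, coeff_mk, expCoeff_unique ((derivative_eq_iff_recurrence _ _).1 hU) n,
    expCoeff_unique hW n, hu0]

theorem tsum_coeff_pow {v : ℕ → ℝ} (hs : Summable v) (h0 : ∀ n, 0 ≤ v n) {z : ℂ}
    (hz : ‖z‖ ≤ 1) (k : ℕ) :
    (Summable fun n => ‖((coeff n ((mk v) ^ k) : ℝ) : ℂ) * z ^ n‖) ∧
      (∑' n, (v n : ℂ) * z ^ n) ^ k = ∑' n, ((coeff n ((mk v) ^ k) : ℝ) : ℂ) * z ^ n := by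
  have hsv : Summable fun n => ‖(v n : ℂ) * z ^ n‖ := by
    refine hs.of_nonneg_of_le (fun n => norm_nonneg _) fun n => ?_
    rw [norm_mul, Complex.norm_real, Real.norm_of_nonneg (h0 n), norm_pow]
    exact mul_le_of_le_one_right (h0 n) (pow_le_one₀ (norm_nonneg z) hz)
  induction k with
  | zero =>
    have : ∀ n, n ∉ ({0} : Finset ℕ) → ((coeff n ((mk v) ^ 0) : ℝ) : ℂ) * z ^ n = 0 := by
      intro n hn
      have hn : n ≠ 0 := by simpa using hn
      simp [coeff_one, hn]
    constructor
    · exact summable_of_ne_finset_zero (s := {0}) fun n hn => by rw [this n hn, norm_zero]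
    · rw [tsum_eq_sum this]; simp
  | succ k ih =>
    have e : ∀ n, ((coeff n ((mk v) ^ (k + 1)) : ℝ) : ℂ) * z ^ n = ∑ p ∈ Finset.HasAntidiagonal.antidiagonal n,
        (((coeff p.1 ((mk v) ^ k) : ℝ) : ℂ) * z ^ p.1) * ((v p.2 : ℂ) * z ^ p.2) := by
      intro n
      rw [pow_succ, coeff_mul]
      push_cast
      rw [Finset.sum_mul]
      refine Finset.sum_congr rfl fun p hp => ?_
      rw [← (by simpa using hp : p.1 + p.2 = n), pow_add, coeff_mk]; ring
    have h := tsum_mul_tsum_eq_tsum_sum_antidiagonal_of_summable_norm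
      (f := fun n => ((coeff n ((mk v) ^ k) : ℝ) : ℂ) * z ^ n) (g := fun n => (v n : ℂ) * z ^ n)
      ih.1 hsv
    constructor
    · have h' := summable_norm_sum_mul_antidiagonal_of_summable_norm
        (f := fun n => ((coeff n ((mk v) ^ k) : ℝ) : ℂ) * z ^ n) (g := fun n => (v n : ℂ) * z ^ n)
        ih.1 hsv
      exact h'.congr fun n => by rw [e n]
    · calc (∑' n, (v n : ℂ) * z ^ n) ^ (k + 1)
          = (∑' n, (v n : ℂ) * z ^ n) ^ k * ∑' n, (v n : ℂ) * z ^ n := pow_succ _ _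
        _ = (∑' n, ((coeff n ((mk v) ^ k) : ℝ) : ℂ) * z ^ n) * ∑' n, (v n : ℂ) * z ^ n := by
          rw [ih.2]
        _ = _ := h
        _ = _ := (tsum_congr e).symm

theorem coeff_pow_nonneg {v : ℕ → ℝ} (h0 : ∀ n, 0 ≤ v n) (k n : ℕ) :
    0 ≤ coeff n ((mk v) ^ k) := by
  induction k generalizing n with
  | zero => rw [pow_zero, coeff_one]; split_ifs <;> simp
  | succ k ih =>
    rw [pow_succ, coeff_mul]
    exact Finset.sum_nonneg fun p _ => mul_nonneg (ih _) (by simpa using h0 _)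

theorem le_coeff_pow_succ {v : ℕ → ℝ} (h0 : ∀ n, 0 ≤ v n) (k n : ℕ) :
    v 0 ^ k * v n ≤ coeff n ((mk v) ^ (k + 1)) := by
  rw [pow_succ, coeff_mul]
  have : v 0 ^ k * v n = coeff 0 ((mk v) ^ k) * coeff n (mk v) := by
    rw [coeff_zero_eq_constantCoeff, map_pow, ← coeff_zero_eq_constantCoeff_apply]
    simp
  rw [this]
  exact Finset.single_le_sum (f := fun p : ℕ × ℕ => coeff p.1 ((mk v) ^ k) * coeff p.2 (mk v))
    (fun p _ => mul_nonneg (coeff_pow_nonneg h0 k _) (by simpa using h0 _))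
    (a := (0, n)) (by simp)

end root

/-- The measure on the lattice `ℕ h` with weights `v`. -/
noncomputable def latticeMeasure (v : ℕ → ℝ) (h : ℝ) : Measure ℝ :=
  Measure.sum fun n : ℕ => ENNReal.ofReal (v n) • Measure.dirac (n * h)

theorem isProbabilityMeasure_latticeMeasure {v : ℕ → ℝ} (hv : ∀ n, 0 ≤ v n) (hs : HasSum v 1)
    (h : ℝ) : IsProbabilityMeasure (latticeMeasure v h) := by
  constructor
  rw [latticeMeasure, Measure.sum_apply _ MeasurableSet.univ]
  simp only [Measure.smul_apply, measure_univ, smul_eq_mul, mul_one]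
  rw [← ENNReal.ofReal_tsum_of_nonneg hv hs.summable, hs.tsum_eq, ENNReal.ofReal_one]

theorem latticeMeasure_Ici {v : ℕ → ℝ} (hv : ∀ n, 0 ≤ v n) (hs : HasSum v 1)
    {h : ℝ} (hh : 0 ≤ h) : latticeMeasure v h (Set.Ici 0) = 1 := by
  rw [latticeMeasure, Measure.sum_apply _ measurableSet_Ici]
  have : ∀ n : ℕ, Measure.dirac (n * h : ℝ) (Set.Ici 0) = 1 := by
    intro n
    rw [Measure.dirac_apply_of_mem]
    simp only [Set.mem_Ici]; positivity
  simp only [Measure.smul_apply, this, smul_eq_mul, mul_one]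
  rw [← ENNReal.ofReal_tsum_of_nonneg hv hs.summable, hs.tsum_eq, ENNReal.ofReal_one]

theorem charFun_latticeMeasure {v : ℕ → ℝ} (hv : ∀ n, 0 ≤ v n) (hs : HasSum v 1) (h t : ℝ) :
    charFun (latticeMeasure v h) t = ∑' n, (v n : ℂ) * Complex.exp (t * h * Complex.I) ^ n := by
  have := isProbabilityMeasure_latticeMeasure hv hs h
  rw [charFun_apply_real]
  have hInt : Integrable (fun x : ℝ => Complex.exp (t * x * Complex.I)) (latticeMeasure v h) := by
    refine (integrable_const (1 : ℝ)).mono' (by fun_prop) (Filter.Eventually.of_forall fun x => ?_)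
    rw [← Complex.ofReal_mul, Complex.norm_exp_ofReal_mul_I]
  rw [latticeMeasure, integral_sum_measure (by exact hInt)]
  refine tsum_congr fun n => ?_
  rw [integral_smul_measure, integral_dirac, ENNReal.toReal_ofReal (hv n), ← Complex.exp_nat_mul]
  simp only [Complex.real_smul]
  congr 2; push_cast; ring

theorem exists_latticeMeasure_eq_convPow {w : ℕ → ℝ} (hw : ∀ n, 0 ≤ w n) (h0 : 0 < w 0)
    (hs : HasSum w 1) (hr : ∀ n, 0 ≤ logDerivCoeff w n) {m : ℕ} (hm : 0 < m) {h : ℝ} (hh : 0 ≤ h) :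
    ∃ ν : Measure ℝ, IsProbabilityMeasure ν ∧ ν (Set.Ici 0) = 1 ∧
      latticeMeasure w h = convPow ν m := by
  obtain ⟨v, hv0, hv, hvm⟩ := exists_pow_eq_of_logDerivCoeff_nonneg h0 hr hm
  have hsv : Summable v := by
    obtain ⟨k, rfl⟩ : ∃ k, m = k + 1 := ⟨m - 1, by omega⟩
    refine (hs.summable.mul_left ((v 0 ^ k)⁻¹)).of_nonneg_of_le hv fun n => ?_
    rw [inv_mul_eq_div, le_div_iff₀ (by positivity), mul_comm]
    have := le_coeff_pow_succ hv k n
    rwa [hvm, PowerSeries.coeff_mk] at this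
  have key : ∀ z : ℂ, ‖z‖ ≤ 1 → (∑' n, (v n : ℂ) * z ^ n) ^ m = ∑' n, (w n : ℂ) * z ^ n := by
    intro z hz
    rw [(tsum_coeff_pow hsv hv hz m).2, hvm]; simp
  have hs1 : HasSum v 1 := by
    have h1 := key 1 (by simp)
    simp only [one_pow, mul_one] at h1
    rw [← Complex.ofReal_tsum, ← Complex.ofReal_tsum, hs.tsum_eq, ← Complex.ofReal_pow,
      Complex.ofReal_inj] at h1
    have h2 := (pow_eq_one_iff_of_nonneg (tsum_nonneg hv) hm.ne').1 h1
    rw [← h2]; exact hsv.hasSum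
  have hP := isProbabilityMeasure_latticeMeasure hv hs1 h
  have hPw := isProbabilityMeasure_latticeMeasure hw hs h
  refine ⟨latticeMeasure v h, hP, latticeMeasure_Ici hv hs1 hh, ?_⟩
  refine Measure.ext_of_charFun (funext fun t => ?_)
  rw [charFun_convPow, charFun_latticeMeasure hv hs1, charFun_latticeMeasure hw hs, key]
  rw [← Complex.ofReal_mul, Complex.norm_exp_ofReal_mul_I]

theorem isTightMeasureSet_range_of_convPow {μ ν : ℕ → Measure ℝ} [∀ j, IsProbabilityMeasure (ν j)]
    (hν : ∀ j, ν j (Set.Ici 0) = 1) {m : ℕ} (hm : 0 < m) (h : ∀ j, μ j = convPow (ν j) m)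
    (hμ : IsTightMeasureSet (Set.range μ)) : IsTightMeasureSet (Set.range ν) := by
  rw [isTightMeasureSet_iff_exists_isCompact_measure_compl_le] at hμ ⊢
  intro ε hε
  obtain ⟨K, hK, hle⟩ := hμ ε hε
  obtain ⟨M, hM⟩ := hK.bddAbove
  refine ⟨Set.Icc 0 M, isCompact_Icc, ?_⟩
  rintro _ ⟨j, rfl⟩
  calc ν j (Set.Icc 0 M)ᶜ ≤ ν j (Set.Ioi M ∪ (Set.Ici 0)ᶜ) := by
        refine measure_mono fun x hx => ?_
        simp only [Set.mem_compl_iff, Set.mem_Icc, not_and_or, not_le, Set.mem_union, Set.mem_Ioi,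
          Set.mem_Ici] at *
        exact hx.symm
    _ ≤ ν j (Set.Ioi M) + ν j (Set.Ici 0)ᶜ := measure_union_le _ _
    _ = ν j (Set.Ioi M) := by
        rw [(prob_compl_eq_zero_iff measurableSet_Ici).2 (hν j), add_zero]
    _ ≤ μ j (Set.Ioi M) := by rw [h j]; exact le_convPow_Ioi _ (hν j) hm M
    _ ≤ μ j Kᶜ := measure_mono fun x hx hxK => not_le.2 hx (hM hxK)
    _ ≤ ε := hle _ ⟨j, rfl⟩

theorem isInfinitelyDivisible_of_tendsto_charFun {μ : Measure ℝ} [IsProbabilityMeasure μ]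
    {μs : ℕ → Measure ℝ} [∀ j, IsProbabilityMeasure (μs j)]
    (hroot : ∀ m, 0 < m → ∀ j, ∃ ν : Measure ℝ, IsProbabilityMeasure ν ∧ ν (Set.Ici 0) = 1 ∧
      μs j = convPow ν m)
    (hlim : ∀ t, Filter.Tendsto (fun j => charFun (μs j) t) Filter.atTop (nhds (charFun μ t))) :
    IsInfinitelyDivisible μ := by
  intro m hm
  choose ν hνp hν0 hνm using hroot m hm
  have htight := isTightMeasureSet_range_of_convPow hν0 hm hνm
    (isTightMeasureSet_of_tendsto_charFun (by fun_prop) hlim)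
  set N : ℕ → ProbabilityMeasure ℝ := fun j => ⟨ν j, hνp j⟩ with hN
  have hcomp : IsCompact (closure (Set.range N)) := by
    apply isCompact_closure_of_isTightMeasureSet
    convert htight using 1
    ext ρ
    constructor
    · rintro ⟨_, ⟨j, rfl⟩, rfl⟩; exact ⟨j, rfl⟩
    · rintro ⟨j, rfl⟩; exact ⟨_, ⟨j, rfl⟩, rfl⟩
  set U : Ultrafilter ℕ := Filter.hyperfilter ℕ
  obtain ⟨ν', -, hν'⟩ := hcomp.ultrafilter_le_nhds (U.map N) (by
    rw [Filter.le_principal_iff]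
    exact Filter.mem_of_superset Filter.range_mem_map subset_closure)
  have hconv : Filter.Tendsto N U (nhds ν') := hν'
  have hUat : (U : Filter ℕ) ≤ Filter.atTop := by
    rw [← Nat.cofinite_eq_atTop]; exact Filter.hyperfilter_le_cofinite
  refine ⟨ν', inferInstance, Measure.ext_of_charFun (funext fun t => ?_)⟩
  rw [charFun_convPow]
  have h1 : Filter.Tendsto (fun j => charFun (ν j) t) U (nhds (charFun (ν' : Measure ℝ) t)) := by
    rw [ProbabilityMeasure.tendsto_iff_forall_integral_rclike_tendsto ℂ] at hconv
    simp_rw [charFun_eq_integral_innerProbChar]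
    exact hconv (BoundedContinuousFunction.innerProbChar t)
  refine tendsto_nhds_unique ((hlim t).mono_left hUat) ((h1.pow m).congr fun j => ?_)
  rw [hνm j, charFun_convPow]

section riemann

open Set Filter Topology

theorem hasSum_integral_comp_natCeil {c : ℕ → ℂ} {h : ℝ} (hh : 0 < h)
    (hi : IntegrableOn (fun x : ℝ => c (⌈x / h⌉₊ - 1)) (Ioi 0)) :
    HasSum (fun n => (h : ℂ) * c n) (∫ x in Ioi 0, c (⌈x / h⌉₊ - 1)) := by
  have hceil : ∀ (n : ℕ) (x : ℝ), x ∈ Ioc (n * h) ((n + 1) * h) → ⌈x / h⌉₊ = n + 1 := by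
    intro n x hx
    rw [Nat.ceil_eq_iff (by omega)]
    push_cast
    rw [lt_div_iff₀ hh, div_le_iff₀ hh]
    exact hx
  have hU : (⋃ n : ℕ, Ioc (n * h) ((n + 1) * h)) = Ioi 0 := by
    ext x
    simp only [mem_iUnion, mem_Ioi]
    constructor
    · rintro ⟨n, hn⟩
      exact lt_of_le_of_lt (by positivity) hn.1
    · intro hx
      have h0 : 0 < ⌈x / h⌉₊ := Nat.ceil_pos.2 (by positivity)
      obtain ⟨n, hn⟩ : ∃ n, ⌈x / h⌉₊ = n + 1 := ⟨⌈x / h⌉₊ - 1, by omega⟩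
      have := (Nat.ceil_eq_iff (by omega)).1 hn
      push_cast at this
      rw [lt_div_iff₀ hh, div_le_iff₀ hh] at this
      exact ⟨n, this⟩
  have hd : Pairwise (Function.onFun Disjoint fun n : ℕ => Ioc (n * h) ((n + 1) * h)) := by
    intro n m hnm
    refine Set.disjoint_left.2 fun x hx hx' => hnm ?_
    have := (hceil n x hx).symm.trans (hceil m x hx')
    omega
  rw [← hU] at hi ⊢
  refine (hasSum_integral_iUnion (fun n => measurableSet_Ioc) hd hi).congr_fun ?_
  intro n
  rw [setIntegral_congr_fun (g := fun _ => c n) measurableSet_Ioc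
    (fun x hx => by simp only [hceil n x hx, Nat.add_sub_cancel])]
  rw [setIntegral_const]
  simp [measureReal_def, add_mul, hh.le]

theorem tendsto_riemannSum {f F : ℝ → ℝ} (hf : ∀ x, 0 < x → 0 ≤ f x)
    (hc : ContinuousOn f (Ioi 0)) (hF : IntegrableOn F (Ioi 0))
    (hle : ∀ x, 0 < x → ∀ y ∈ Icc x (x + 1), f y ≤ F x) (t : ℝ) :
    (∀ j : ℕ, Summable fun n : ℕ => ((1 / (j + 1 : ℝ) : ℝ) : ℂ) *
      ((f ((n + 1) * (1 / (j + 1))) : ℂ) * Complex.exp (t * (1 / (j + 1 : ℝ) : ℝ) * Complex.I) ^ n)) ∧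
    Tendsto (fun j : ℕ => ∑' n : ℕ, ((1 / (j + 1 : ℝ) : ℝ) : ℂ) *
      ((f ((n + 1) * (1 / (j + 1))) : ℂ) * Complex.exp (t * (1 / (j + 1 : ℝ) : ℝ) * Complex.I) ^ n))
      atTop (𝓝 (∫ x in Ioi 0, (f x : ℂ) * Complex.exp (t * x * Complex.I))) := by
  set c : ℕ → ℕ → ℂ := fun j n => (f ((n + 1) * (1 / (j + 1))) : ℂ) *
    Complex.exp (t * (1 / (j + 1 : ℝ) : ℝ) * Complex.I) ^ n with hcdef
  have hy : ∀ (j : ℕ) (x : ℝ), 0 < x → ∃ n : ℕ, ⌈x / (1 / (j + 1 : ℝ))⌉₊ - 1 = n ∧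
      x ≤ (n + 1) * (1 / (j + 1 : ℝ)) ∧ (n + 1) * (1 / (j + 1 : ℝ)) ≤ x + 1 / (j + 1 : ℝ) := by
    intro j x hx
    have h0 : 0 < ⌈x / (1 / (j + 1 : ℝ))⌉₊ := Nat.ceil_pos.2 (by positivity)
    obtain ⟨n, hn⟩ : ∃ n, ⌈x / (1 / (j + 1 : ℝ))⌉₊ = n + 1 :=
      ⟨⌈x / (1 / (j + 1 : ℝ))⌉₊ - 1, by omega⟩
    have := (Nat.ceil_eq_iff (by omega)).1 hn
    push_cast at this
    rw [lt_div_iff₀ (by positivity), div_le_iff₀ (by positivity)] at this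
    refine ⟨n, by omega, this.2, by linarith [this.1]⟩
  have hnorm : ∀ j n, ‖c j n‖ = |f ((n + 1) * (1 / (j + 1)))| := by
    intro j n
    rw [hcdef]
    simp only [norm_mul, norm_pow, Complex.norm_real, Real.norm_eq_abs]
    rw [← Complex.ofReal_mul, Complex.norm_exp_ofReal_mul_I, one_pow, mul_one]
  have hbound : ∀ j : ℕ, ∀ᵐ x ∂(volume.restrict (Ioi (0 : ℝ))),
      ‖c j (⌈x / (1 / (j + 1 : ℝ))⌉₊ - 1)‖ ≤ F x := by
    intro j
    filter_upwards [ae_restrict_mem measurableSet_Ioi] with x hx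
    obtain ⟨n, hn, h1, h2⟩ := hy j x hx
    rw [hn, hnorm, abs_of_nonneg (hf _ (by positivity))]
    refine hle x hx _ ⟨h1, h2.trans ?_⟩
    gcongr
    rw [div_le_one (by positivity)]; linarith [(Nat.cast_nonneg j : (0 : ℝ) ≤ j)]
  have hmeas : ∀ j : ℕ, AEStronglyMeasurable (fun x : ℝ => c j (⌈x / (1 / (j + 1 : ℝ))⌉₊ - 1))
      (volume.restrict (Ioi (0 : ℝ))) := by
    intro j
    have h1 : Measurable fun n : ℕ => c j (n - 1) := measurable_from_nat
    exact (h1.comp (Nat.measurable_ceil.comp (measurable_id.div_const _))).aestronglyMeasurable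
  have hInt : ∀ j : ℕ, IntegrableOn (fun x : ℝ => c j (⌈x / (1 / (j + 1 : ℝ))⌉₊ - 1)) (Ioi 0) :=
    fun j => hF.mono' (hmeas j) (hbound j)
  have hs := fun j : ℕ => hasSum_integral_comp_natCeil (c := c j) (h := 1 / (j + 1 : ℝ))
    (by positivity) (hInt j)
  refine ⟨fun j => (hs j).summable, ?_⟩
  rw [funext fun j => (hs j).tsum_eq]
  refine tendsto_integral_of_dominated_convergence F hmeas hF hbound ?_
  filter_upwards [ae_restrict_mem measurableSet_Ioi] with x hx
  choose n hn h1 h2 using fun j : ℕ => hy j x hx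
  have hh : Tendsto (fun j : ℕ => 1 / (j + 1 : ℝ)) atTop (𝓝 0) := tendsto_one_div_add_atTop_nhds_zero_nat
  have hlim : Tendsto (fun j : ℕ => (n j + 1 : ℝ) * (1 / (j + 1 : ℝ))) atTop (𝓝 x) := by
    refine tendsto_of_tendsto_of_tendsto_of_le_of_le tendsto_const_nhds ?_ h1 h2
    simpa using hh.const_add x
  have hlim2 : Tendsto (fun j : ℕ => (n j + 1 : ℝ) * (1 / (j + 1 : ℝ)) - 1 / (j + 1)) atTop (𝓝 x) := by
    simpa using hlim.sub hh
  simp_rw [hn]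
  have e : ∀ j, c j (n j) = (f ((n j + 1) * (1 / (j + 1))) : ℂ) *
      Complex.exp (t * (((n j + 1 : ℝ) * (1 / (j + 1 : ℝ)) - 1 / (j + 1) : ℝ) : ℂ) * Complex.I) := by
    intro j
    simp only [hcdef]
    rw [← Complex.exp_nat_mul]
    congr 2; push_cast; ring
  simp_rw [e]
  refine Tendsto.mul ?_ ?_
  · refine (Complex.continuous_ofReal.tendsto _).comp ?_
    exact ((hc.continuousAt (Ioi_mem_nhds hx)).tendsto).comp hlim
  · have : Continuous fun y : ℝ => Complex.exp (t * y * Complex.I) := by fun_prop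
    exact (this.tendsto x).comp hlim2

end riemann

open Set Filter Topology in
/-- A density `x * g x` on `(0, ∞)` with `g` completely monotone is infinitely divisible. -/
theorem isInfinitelyDivisible_withDensity_of_isCM {g F : ℝ → ℝ} (hg : IsCM g)
    (hpos : ∀ x, 0 < x → 0 < g x) (hc : ContinuousOn g (Ioi 0)) (hF : IntegrableOn F (Ioi 0))
    (hle : ∀ x, 0 < x → ∀ y ∈ Icc x (x + 1), y * g y ≤ F x)
    (h1 : ∫ x in Ioi 0, x * g x = 1) :
    IsInfinitelyDivisible
      ((volume.restrict (Ioi 0)).withDensity fun x => ENNReal.ofReal (x * g x)) := by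
  set f : ℝ → ℝ := fun x => x * g x with hf
  have hfpos : ∀ x, 0 < x → 0 < f x := fun x hx => mul_pos hx (hpos x hx)
  have hfc : ContinuousOn f (Ioi 0) := continuousOn_id.mul hc
  set μ := (volume.restrict (Ioi (0 : ℝ))).withDensity fun x => ENNReal.ofReal (f x) with hμ
  have hfm : AEStronglyMeasurable f (volume.restrict (Ioi 0)) :=
    hfc.aestronglyMeasurable measurableSet_Ioi
  have hfi : IntegrableOn f (Ioi 0) := by
    refine hF.mono' hfm ?_
    filter_upwards [ae_restrict_mem measurableSet_Ioi] with x hx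
    rw [Real.norm_of_nonneg (hfpos x hx).le]
    exact hle x hx x ⟨le_rfl, by linarith⟩
  have hf0 : 0 ≤ᵐ[volume.restrict (Ioi 0)] f := by
    filter_upwards [ae_restrict_mem measurableSet_Ioi] with x hx using (hfpos x hx).le
  have hprob : IsProbabilityMeasure μ := by
    constructor
    rw [hμ, withDensity_apply _ MeasurableSet.univ, Measure.restrict_univ,
      ← ofReal_integral_eq_lintegral_ofReal hfi hf0, h1, ENNReal.ofReal_one]
  have hchar : ∀ t, charFun μ t = ∫ x in Ioi 0, (f x : ℂ) * Complex.exp (t * x * Complex.I) := by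
    intro t
    rw [charFun_apply_real, hμ, integral_withDensity_eq_integral_toReal_smul₀
      hfm.aemeasurable.ennreal_ofReal (by simp)]
    refine setIntegral_congr_fun measurableSet_Ioi fun x hx => ?_
    rw [ENNReal.toReal_ofReal (hfpos x hx).le, Complex.real_smul]
  set a : ℕ → ℕ → ℝ := fun j n => (1 / (j + 1 : ℝ)) * f ((n + 1) * (1 / (j + 1))) with ha
  have hapos : ∀ j n, 0 < a j n := fun j n => mul_pos (by positivity) (hfpos _ (by positivity))
  have hR := tendsto_riemannSum (fun x hx => (hfpos x hx).le) hfc hF hle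
  have hsum : ∀ j, Summable (a j) := by
    intro j
    have := (hR 0).1 j
    simp only [Complex.ofReal_zero, zero_mul, Complex.exp_zero, one_pow, mul_one] at this
    rw [← Complex.summable_ofReal]
    exact this.congr fun n => by simp [ha]
  set S : ℕ → ℝ := fun j => ∑' n, a j n with hS
  have hSpos : ∀ j, 0 < S j := fun j => (hsum j).tsum_pos (fun n => (hapos j n).le) 0 (hapos j 0)
  have hSlim : Tendsto (fun j => (S j : ℂ)) atTop (𝓝 1) := by
    have := (hR 0).2
    simp only [Complex.ofReal_zero, zero_mul, Complex.exp_zero, one_pow, mul_one] at this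
    rw [integral_complex_ofReal, h1, Complex.ofReal_one] at this
    refine this.congr fun j => ?_
    rw [hS, Complex.ofReal_tsum]
    exact tsum_congr fun n => by simp [ha]
  set w : ℕ → ℕ → ℝ := fun j n => (n + 1) * ((1 / (j + 1 : ℝ)) ^ 2 / S j *
    g ((n + 1) * (1 / (j + 1)))) with hw
  have hwa : ∀ j n, w j n = a j n / S j := by
    intro j n
    simp only [hw, ha, hf]; ring
  have hwpos : ∀ j n, 0 < w j n := fun j n => by
    rw [hwa]; exact div_pos (hapos j n) (hSpos j)
  have hws : ∀ j, HasSum (w j) 1 := by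
    intro j
    have := ((hsum j).hasSum).div_const (S j)
    rw [div_self (hSpos j).ne'] at this
    simpa only [← hwa] using this
  have hPw := fun j => isProbabilityMeasure_latticeMeasure (fun n => (hwpos j n).le) (hws j)
    (1 / (j + 1 : ℝ))
  refine isInfinitelyDivisible_of_tendsto_charFun
    (μs := fun j : ℕ => latticeMeasure (w j) (1 / (j + 1 : ℝ))) ?_ ?_
  · intro m hm j
    refine exists_latticeMeasure_eq_convPow (fun n => (hwpos j n).le) (hwpos j 0) (hws j) ?_ hm
      (by positivity)
    have hh : 0 < 1 / (j + 1 : ℝ) := by positivity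
    exact fun n => (hg.const_mul (div_nonneg (sq_nonneg _) (hSpos j).le)).logDerivCoeff_nonneg hh
      (mul_pos (div_pos (by positivity) (hSpos j)) (hpos _ hh)) n
  · intro t
    have h2 := ((hR t).2).div hSlim one_ne_zero
    rw [div_one, ← hchar] at h2
    refine h2.congr fun j => ?_
    simp only [Pi.div_apply]
    rw [charFun_latticeMeasure (fun n => (hwpos j n).le) (hws j), ← tsum_div_const]
    refine tsum_congr fun n => ?_
    rw [hwa]
    simp only [ha]
    push_cast; ring

theorem integrableOn_rpow_mul_exp_neg_mul {s x : ℝ} (hs : 0 < s) (hx : 0 < x) :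
    IntegrableOn (fun t : ℝ => t ^ (s - 1) * Real.exp (-(t * x))) (Set.Ioi 0) := by
  refine (integrableOn_rpow_mul_exp_neg_mul_rpow (p := 1) (s := s - 1) (by linarith) one_pos
    hx).congr_fun (fun t _ => ?_) measurableSet_Ioi
  simp only [Real.rpow_one]; ring_nf

theorem integral_exp_neg_mul_cos {y : ℝ} (hy : 0 < y) (s φ : ℝ) :
    IntegrableOn (fun t : ℝ => Real.exp (-(t * y)) * Real.cos (s * t + φ)) (Set.Ioi 0) ∧
    ∫ t in Set.Ioi (0 : ℝ), Real.exp (-(t * y)) * Real.cos (s * t + φ) =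
      (y * Real.cos φ - s * Real.sin φ) / (y ^ 2 + s ^ 2) := by
  have ha : ((-y + s * Complex.I : ℂ)).re < 0 := by simpa using hy
  have he : ∀ t : ℝ, Real.exp (-(t * y)) * Real.cos (s * t + φ) =
      RCLike.re (Complex.exp (φ * Complex.I) * Complex.exp ((-y + s * Complex.I) * t)) := by
    intro t
    rw [← Complex.exp_add]
    simp [Complex.exp_re]
    ring_nf
  have hi := ((integrableOn_exp_mul_complex_Ioi ha 0).const_mul (Complex.exp (φ * Complex.I)))
  simp_rw [he]
  refine ⟨hi.re, ?_⟩
  rw [integral_re hi, integral_const_mul, integral_exp_mul_complex_Ioi ha]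
  have hn : (-y + s * Complex.I : ℂ) ≠ 0 := fun h => by rw [h] at ha; simp at ha
  have hp : y ^ 2 + s ^ 2 ≠ 0 := by positivity
  have hp' : (y ^ 2 + s ^ 2 : ℂ) ≠ 0 := by exact_mod_cast hp
  have e : -Complex.exp ((-y + s * Complex.I) * (0 : ℝ)) / (-y + s * Complex.I) =
      ((y / (y ^ 2 + s ^ 2) : ℝ) : ℂ) + ((s / (y ^ 2 + s ^ 2) : ℝ) : ℂ) * Complex.I := by
    push_cast
    rw [mul_zero, Complex.exp_zero]
    field_simp
    linear_combination (-(s ^ 2 : ℂ)) * Complex.I_sq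
  rw [e]
  simp only [RCLike.re_to_complex, Complex.mul_re, Complex.exp_ofReal_mul_I_re,
    Complex.exp_ofReal_mul_I_im, Complex.add_re, Complex.add_im, Complex.ofReal_re,
    Complex.ofReal_im, Complex.I_re, Complex.I_im, Complex.mul_im]
  ring

namespace IsCM

open Set Filter Topology

theorem of_laplace {f : ℝ → ℝ} (hf : ∀ t, 0 < t → 0 ≤ f t)
    (hi : ∀ x, 0 < x → IntegrableOn (fun t => Real.exp (-(t * x)) * f t) (Ioi 0)) :
    IsCM fun x => ∫ t in Ioi 0, Real.exp (-(t * x)) * f t := by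
  refine IsCM.integral (G := fun t x => Real.exp (-(t * x)) * f t) ?_ hi
  filter_upwards [ae_restrict_mem measurableSet_Ioi] with t ht
  exact (IsCM.exp_neg (le_of_lt ht)).mul (const (hf t ht))

theorem rpow_neg {s : ℝ} (hs : 0 < s) : IsCM fun x => x ^ (-s) := by
  have h : IsCM fun x => ∫ t in Ioi (0 : ℝ), t ^ (s - 1) * Real.exp (-(t * x)) := by
    have := of_laplace (f := fun t => t ^ (s - 1)) (fun t ht => Real.rpow_nonneg ht.le _)
      fun x hx => by simpa only [mul_comm] using integrableOn_rpow_mul_exp_neg_mul hs hx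
    simpa only [mul_comm] using this
  refine (h.const_mul (inv_nonneg.2 (Real.Gamma_pos_of_pos hs).le)).congr fun x hx => ?_
  have := Real.integral_rpow_mul_exp_neg_mul_Ioi hs hx
  simp_rw [mul_comm x] at this
  rw [this, one_div, Real.inv_rpow hx.le, Real.rpow_neg hx.le]
  have := (Real.Gamma_pos_of_pos hs).ne'
  field_simp

theorem inv_add {t : ℝ} (ht : 0 ≤ t) : IsCM fun x => (t + x)⁻¹ := by
  have h := (rpow_neg one_pos).comp (φ := fun x => t + x) (fun x hx => by positivity)
    fun l hl => ((exp_neg hl).const_mul (Real.exp_pos (-(l * t))).le).congr fun x _ => by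
      rw [← Real.exp_add]; ring_nf
  simpa [Real.rpow_neg_one] using h

theorem exp_neg_rpow {γ l : ℝ} (hγ : γ ∈ Ioo 0 1) (hl : 0 ≤ l) :
    IsCM fun x => Real.exp (-(l * x ^ γ)) := by
  set K := (∫ t in Ioi 0, rpowIntegrand₀₁ γ t 1)⁻¹ with hK
  have hK0 : 0 ≤ K := inv_nonneg.2 (integral_rpowIntegrand₀₁_one_pos hγ).le
  have hA : ∀ n : ℕ, IntegrableOn (fun t : ℝ => t ^ (γ - 1)) (Ioc 0 n) := fun n =>
    (intervalIntegrable_iff_integrableOn_Ioc_of_le (Nat.cast_nonneg n)).1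
      (intervalIntegral.intervalIntegrable_rpow' (by linarith [hγ.1]))
  have hR : ∀ (n : ℕ) (x : ℝ), 0 < x → IntegrableOn (fun t : ℝ => rpowIntegrand₀₁ γ t x) (Ioc 0 n) :=
    fun n x hx => (integrableOn_rpowIntegrand₀₁_Ioi hγ hx.le).mono_set Ioc_subset_Ioi_self
  have he : ∀ t x : ℝ, 0 < t → t ^ γ * (t + x)⁻¹ = t ^ (γ - 1) - rpowIntegrand₀₁ γ t x := by
    intro t x ht
    rw [rpowIntegrand₀₁, Real.rpow_sub_one ht.ne']; ring
  have hB : ∀ (n : ℕ) (x : ℝ), 0 < x → IntegrableOn (fun t : ℝ => t ^ γ * (t + x)⁻¹) (Ioc 0 n) := by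
    intro n x hx
    refine ((hA n).sub (hR n x hx)).congr_fun (fun t ht => ?_) measurableSet_Ioc
    exact (he t x ht.1).symm
  have hCM : ∀ n : ℕ, IsCM fun x => Real.exp (-(l * (K * ∫ t in Ioc (0 : ℝ) n, rpowIntegrand₀₁ γ t x))) := by
    intro n
    have h1 : IsCM fun x => ∫ t in Ioc (0 : ℝ) n, t ^ γ * (t + x)⁻¹ := by
      refine IsCM.integral (G := fun t x => t ^ γ * (t + x)⁻¹) ?_ (hB n)
      filter_upwards [ae_restrict_mem measurableSet_Ioc] with t ht
      exact (inv_add ht.1.le).const_mul (Real.rpow_nonneg ht.1.le _)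
    refine (((h1.const_mul (mul_nonneg hl hK0)).exp_comp).const_mul (Real.exp_pos
      (-(l * (K * ∫ t in Ioc (0 : ℝ) n, t ^ (γ - 1))))).le).congr fun x hx => ?_
    rw [← Real.exp_add, setIntegral_congr_fun measurableSet_Ioc (fun t ht => he t x ht.1),
      integral_sub (hA n) (hR n x hx)]
    ring_nf
  refine of_tendsto (F := atTop) (Eventually.of_forall hCM) fun x hx => ?_
  rw [rpow_eq_const_mul_integral hγ hx.le, ← hK]
  refine (Real.continuous_exp.tendsto _).comp (((Tendsto.const_mul K ?_).const_mul l).neg)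
  refine (intervalIntegral_tendsto_integral_Ioi 0 (integrableOn_rpowIntegrand₀₁_Ioi hγ hx.le)
    tendsto_natCast_atTop_atTop).congr fun n => ?_
  rw [intervalIntegral.integral_of_le (Nat.cast_nonneg n)]

theorem comp_rpow {f : ℝ → ℝ} (hf : IsCM f) {γ : ℝ} (hγ0 : 0 < γ) (hγ1 : γ ≤ 1) :
    IsCM fun x => f (x ^ γ) := by
  rcases hγ1.eq_or_lt with rfl | hγ1
  · simpa using hf
  · exact hf.comp (fun x hx => Real.rpow_pos_of_pos hx _) fun l hl => exp_neg_rpow ⟨hγ0, hγ1⟩ hl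

theorem rpow_nonpos {s : ℝ} (hs : s ≤ 0) : IsCM fun x => x ^ s := by
  rcases hs.eq_or_lt with rfl | hs
  · simpa using const zero_le_one
  · simpa using rpow_neg (neg_pos.2 hs)

/-- Complete monotonicity of `x ^ (a - 2) / (1 + x ^ b)` is inherited when `a`, `b` are both
divided by a number `q ≥ 1`. -/
theorem rpow_div_one_add_rpow_of_le {a b q : ℝ} (hq : 1 ≤ q)
    (h : IsCM fun x => x ^ (a - 2) / (1 + x ^ b)) :
    IsCM fun x => x ^ (a / q - 2) / (1 + x ^ (b / q)) := by
  have hq0 : 0 < q := by linarith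
  refine ((rpow_nonpos (s := 2 / q - 2) ?_).mul (h.comp_rpow (γ := 1 / q) (by positivity) ?_)).congr
    fun x hx => ?_
  · rw [sub_nonpos, div_le_iff₀ hq0]; linarith
  · rw [div_le_one hq0]; exact hq
  · rw [← Real.rpow_mul hx.le, ← Real.rpow_mul hx.le, ← mul_div_assoc, ← Real.rpow_add hx]
    have e1 : 2 / q - 2 + 1 / q * (a - 2) = a / q - 2 := by field_simp; ring
    have e2 : 1 / q * b = b / q := by ring
    rw [e1, e2]

theorem inv_mul_one_add_sq : IsCM fun x => (x * (1 + x ^ 2))⁻¹ := by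
  have h0 : ∀ x : ℝ, 0 < x →
      IntegrableOn (fun t : ℝ => Real.exp (-(t * x)) * (1 - Real.cos t)) (Ioi 0) ∧
      ∫ t in Ioi (0 : ℝ), Real.exp (-(t * x)) * (1 - Real.cos t) = (x * (1 + x ^ 2))⁻¹ := by
    intro x hx
    obtain ⟨h1, h2⟩ := integral_exp_neg_mul_cos hx 0 0
    obtain ⟨h3, h4⟩ := integral_exp_neg_mul_cos hx 1 0
    simp only [zero_mul, add_zero, Real.cos_zero, mul_one, one_mul, Real.sin_zero] at h1 h2 h3 h4
    simp only [mul_sub, mul_one]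
    refine ⟨h1.sub h3, ?_⟩
    rw [integral_sub h1 h3, h2, h4]
    field_simp
    ring
  exact (of_laplace (fun t _ => sub_nonneg.2 (Real.cos_le_one t)) fun x hx => (h0 x hx).1).congr
    fun x hx => (h0 x hx).2

theorem rpow_div_one_add_sq {a : ℝ} (ha : a ≤ 1) : IsCM fun x => x ^ (a - 2) / (1 + x ^ (2 : ℝ)) := by
  refine ((rpow_nonpos (s := a - 1) (by linarith)).mul inv_mul_one_add_sq).congr fun x hx => ?_
  rw [Real.rpow_two, show a - 2 = a - 1 - 1 by ring, Real.rpow_sub_one hx.ne' (a - 1)]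
  field_simp

end IsCM

section contour

open Set Filter Topology Complex

/-- Cauchy's theorem on a rectangle, allowing removable singularities in its interior. -/
theorem integral_boundary_rect_eq_zero_of_tendsto_mul {f : ℂ → ℂ} {a b c d : ℝ} (hab : a ≤ b)
    (hcd : c ≤ d) (S : Finset ℂ) (hS : ∀ p ∈ S, p.re ∈ Ioo a b ∧ p.im ∈ Ioo c d)
    (hd : ∀ z : ℂ, z.re ∈ Icc a b → z.im ∈ Icc c d → z ∉ S → DifferentiableAt ℂ f z)
    (hp : ∀ p ∈ S, (∀ᶠ z in 𝓝[≠] p, DifferentiableAt ℂ f z) ∧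
      Tendsto (fun z => (z - p) * f z) (𝓝[≠] p) (𝓝 0)) :
    (∫ x : ℝ in a..b, f (x + c * I)) - (∫ x : ℝ in a..b, f (x + d * I)) +
      I * (∫ y : ℝ in c..d, f (b + y * I)) - I * (∫ y : ℝ in c..d, f (a + y * I)) = 0 := by
  set g : ℂ → ℂ := fun z => if z ∈ S then limUnder (𝓝[≠] z) f else f z with hg
  have hgf : ∀ z, z ∉ S → g z = f z := fun z hz => by simp [hg, hz]
  have hgd : ∀ z : ℂ, z.re ∈ Icc a b → z.im ∈ Icc c d → DifferentiableAt ℂ g z := by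
    intro z hz1 hz2
    by_cases hz : z ∈ S
    · obtain ⟨h1, h2⟩ := hp z hz
      have hs : ∀ᶠ y in 𝓝 z, y ∉ S \ {z} :=
        (S \ {z}).finite_toSet.isClosed.isOpen_compl.mem_nhds (by simp)
      obtain ⟨s, hsn, hs1, hs2⟩ : ∃ s ∈ 𝓝 z, (∀ y ∈ s, y ∉ S \ {z}) ∧
          ∀ y ∈ s, y ≠ z → DifferentiableAt ℂ f y := by
        refine ⟨{y | y ∉ S \ {z}} ∩ {y | y ≠ z → DifferentiableAt ℂ f y},
          inter_mem hs (eventually_nhdsWithin_iff.1 h1), fun y hy => hy.1, fun y hy => hy.2⟩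
      have ho : (fun y => f y - f z) =o[𝓝[≠] z] fun y => (y - z)⁻¹ := by
        rw [Asymptotics.isLittleO_iff_tendsto' (by
          filter_upwards [self_mem_nhdsWithin] with y hy h0
          exact absurd h0 (inv_ne_zero (sub_ne_zero.2 hy)))]
        have h3 : Tendsto (fun y => (y - z) * f z) (𝓝[≠] z) (𝓝 0) := by
          have : Continuous fun y : ℂ => (y - z) * f z := by fun_prop
          simpa using (this.tendsto z).mono_left nhdsWithin_le_nhds
        have := h2.sub h3
        rw [sub_zero] at this
        refine this.congr fun y => ?_
        rw [div_inv_eq_mul]; ring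
      have hu := differentiableOn_update_limUnder_of_isLittleO hsn
        (fun y hy => (hs2 y hy.1 hy.2).differentiableWithinAt) ho
      refine (hu.differentiableAt hsn).congr_of_eventuallyEq ?_
      filter_upwards [hsn] with y hy
      by_cases hyz : y = z
      · subst hyz; simp [hg, hz]
      · have : y ∉ S := fun h => hs1 y hy (by simp [h, hyz])
        rw [hgf y this, Function.update_of_ne hyz]
    · refine (hd z hz1 hz2 hz).congr_of_eventuallyEq ?_
      have : ∀ᶠ y in 𝓝 z, y ∉ S := S.finite_toSet.isClosed.isOpen_compl.mem_nhds (by simpa using hz)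
      filter_upwards [this] with y hy using hgf y hy
  have key := integral_boundary_rect_eq_zero_of_differentiableOn g (a + c * I) (b + d * I) (by
    intro z hz
    rw [mem_reProdIm] at hz
    simp only [add_re, ofReal_re, mul_re, I_re, mul_zero, ofReal_im, I_im, mul_one, sub_self,
      add_zero, add_im, mul_im, zero_add, uIcc_of_le hab, uIcc_of_le hcd] at hz
    exact (hgd z hz.1 hz.2).differentiableWithinAt)
  simp only [add_re, ofReal_re, mul_re, I_re, mul_zero, ofReal_im, I_im, mul_one, sub_self,
      add_zero, add_im, mul_im, zero_add, smul_eq_mul] at key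
  have e1 : ∀ e : ℝ, e ∉ Ioo c d → ∀ x : ℝ, g (x + e * I) = f (x + e * I) := fun e he x =>
    hgf _ fun h => he (by simpa using (hS _ h).2)
  have e2 : ∀ e : ℝ, e ∉ Ioo a b → ∀ y : ℝ, g (e + y * I) = f (e + y * I) := fun e he x =>
    hgf _ fun h => he (by simpa using (hS _ h).1)
  simp only [e1 c (by simp), e1 d (by simp), e2 a (by simp), e2 b (by simp)] at key
  exact key

theorem tendsto_integral_vertical {f : ℂ → ℂ} {c : ℂ} {l : Filter ℝ}
    (hf : ∀ᶠ R : ℝ in l, ContinuousOn (fun y : ℝ => f (R + y * I)) (Icc (-π) π))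
    (h : Tendsto f (comap re l) (𝓝 c)) :
    Tendsto (fun R : ℝ => ∫ y : ℝ in -π..π, f (R + y * I)) l (𝓝 (2 * π * c)) := by
  rw [Metric.tendsto_nhds]
  intro ε hε
  have h1 : ∀ᶠ z in comap re l, dist (f z) c < ε / (4 * π) :=
    (Metric.tendsto_nhds.1 h) _ (by positivity)
  rw [eventually_comap] at h1
  filter_upwards [h1, hf] with R hR hc
  have e : (∫ y : ℝ in -π..π, f (R + y * I)) - 2 * π * c = ∫ y : ℝ in -π..π, (f (R + y * I) - c) := by
    rw [intervalIntegral.integral_sub (hc.intervalIntegrable_of_Icc (by linarith [pi_pos])) (by simp),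
      intervalIntegral.integral_const]
    simp only [sub_neg_eq_add, Complex.real_smul]
    push_cast; ring
  rw [dist_eq_norm, e]
  calc _ ≤ ε / (4 * π) * |π - -π| := intervalIntegral.norm_integral_le_of_norm_le_const
        fun y _ => by
          rw [← dist_eq_norm]
          exact (hR _ (by simp)).le
    _ < ε := by
      rw [abs_of_pos (by linarith [pi_pos])]
      have := pi_pos
      field_simp
      norm_num

theorem tendsto_exp_div_exp_sub_atTop (a : ℂ) :
    Tendsto (fun z => Complex.exp z / (Complex.exp z - a)) (comap re atTop) (𝓝 1) := by
  have h1 : Tendsto (fun z => (1 - a * (Complex.exp z)⁻¹)⁻¹) (comap re atTop) (𝓝 1) := by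
    have := (((tendsto_inv₀_cobounded.comp tendsto_exp_comap_re_atTop).const_mul
      a).const_sub 1).inv₀ (by simp)
    simpa using this
  refine h1.congr fun z => ?_
  have := Complex.exp_ne_zero z
  rw [← div_eq_mul_inv, one_sub_div this, inv_div]

theorem tendsto_exp_div_exp_sub_atBot {a : ℂ} (ha : a ≠ 0) :
    Tendsto (fun z => Complex.exp z / (Complex.exp z - a)) (comap re atBot) (𝓝 0) := by
  have h0 : Tendsto Complex.exp (comap re atBot) (𝓝 0) := tendsto_exp_comap_re_atBot
  have := h0.div (h0.sub_const a) (by simpa using ha)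
  rw [zero_div] at this
  exact this

/-- The residue theorem on the strip `|Im z| ≤ π`, for functions vanishing at both ends. -/
theorem integral_strip_eq_sum_residues {H : ℂ → ℂ} (S : Finset ℂ) (ρ : ℂ → ℂ)
    (hS : ∀ p ∈ S, p.im ∈ Ioo (-π) π)
    (hd : ∀ z : ℂ, z.im ∈ Icc (-π) π → z ∉ S → DifferentiableAt ℂ H z)
    (hp : ∀ p ∈ S, Tendsto (fun z => (z - p) * H z) (𝓝[≠] p) (𝓝 (ρ p)))
    (htop : Tendsto H (comap re atTop) (𝓝 0)) (hbot : Tendsto H (comap re atBot) (𝓝 0))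
    (hi : Integrable fun x : ℝ => H (x + (-π : ℝ) * I) - H (x + π * I)) :
    ∫ x : ℝ, (H (x + (-π : ℝ) * I) - H (x + π * I)) = 2 * π * I * ∑ p ∈ S, ρ p := by
  set k : ℂ → ℂ → ℂ := fun p z => Complex.exp z / (Complex.exp z - Complex.exp p) with hk
  have hexp : ∀ p : ℂ, p.im ∈ Ioo (-π) π → ∀ z : ℂ, z.im ∈ Icc (-π) π → Complex.exp z = Complex.exp p → z = p := by
    intro p hp z hz he
    obtain ⟨n, hn⟩ := exp_eq_exp_iff_exists_int.1 he
    have him := congrArg im hn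
    simp at him
    have h1 : |(n : ℝ)| < 1 := by
      rw [abs_lt]
      constructor <;> nlinarith [pi_pos, hp.1, hp.2, hz.1, hz.2]
    have h0 : n = 0 := by
      have : |n| < 1 := by exact_mod_cast h1
      exact Int.abs_lt_one_iff.1 this
    rw [hn, h0]; simp
  set f : ℂ → ℂ := fun z => H z - ∑ p ∈ S, ρ p * k p z with hf
  have hkd : ∀ p z, Complex.exp z ≠ Complex.exp p → DifferentiableAt ℂ (k p) z := fun p z h =>
    Complex.differentiable_exp.differentiableAt.div (Complex.differentiable_exp.differentiableAt.sub_const _)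
      (sub_ne_zero.2 h)
  have hfd : ∀ z : ℂ, z.im ∈ Icc (-π) π → z ∉ S → DifferentiableAt ℂ f z := by
    intro z hz hzS
    refine (hd z hz hzS).sub (DifferentiableAt.fun_sum fun p hpS => (hkd p z fun h => ?_).const_mul _)
    exact hzS (hexp p (hS p hpS) z hz h ▸ hpS)
  have hkp : ∀ p, Tendsto (fun z => (z - p) * k p z) (𝓝[≠] p) (𝓝 1) := by
    intro p
    have h1 := hasDerivAt_iff_tendsto_slope.1 (Complex.hasDerivAt_exp p)
    have h2 : Tendsto Complex.exp (𝓝[≠] p) (𝓝 (Complex.exp p)) :=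
      (Complex.continuous_exp.tendsto p).mono_left nhdsWithin_le_nhds
    have h3 := h2.mul (h1.inv₀ (Complex.exp_ne_zero p))
    rw [mul_inv_cancel₀ (Complex.exp_ne_zero p)] at h3
    refine h3.congr fun z => ?_
    rw [hk, slope_def_field]
    simp only [inv_div]
    ring
  have hfp : ∀ p ∈ S, (∀ᶠ z in 𝓝[≠] p, DifferentiableAt ℂ f z) ∧
      Tendsto (fun z => (z - p) * f z) (𝓝[≠] p) (𝓝 0) := by
    intro p hpS
    constructor
    · have h1 : ∀ᶠ z in 𝓝 p, z ∉ S \ {p} :=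
        (S \ {p}).finite_toSet.isClosed.isOpen_compl.mem_nhds (by simp)
      have h2 : ∀ᶠ z in 𝓝 p, z.im ∈ Ioo (-π) π :=
        continuous_im.continuousAt.eventually (Ioo_mem_nhds (hS p hpS).1 (hS p hpS).2)
      filter_upwards [nhdsWithin_le_nhds h1, nhdsWithin_le_nhds h2, self_mem_nhdsWithin]
        with z hz1 hz2 hz3
      have hz3 : z ≠ p := hz3
      exact hfd z (Ioo_subset_Icc_self hz2) fun h => hz1 (by simp [h, hz3])
    · have h1 : Tendsto (fun z => ∑ q ∈ S, ρ q * ((z - p) * k q z)) (𝓝[≠] p)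
          (𝓝 (∑ q ∈ S, ρ q * if q = p then 1 else 0)) := by
        refine tendsto_finsetSum _ fun q hq => Tendsto.const_mul _ ?_
        split_ifs with h
        · subst h; exact hkp q
        · have hne : Complex.exp p ≠ Complex.exp q := fun he =>
            h (hexp q (hS q hq) p (Ioo_subset_Icc_self (hS p hpS)) he).symm
          have hc : ContinuousAt (fun z => (z - p) * k q z) p :=
            (continuousAt_id.sub continuousAt_const).mul (hkd q p hne).continuousAt
          simpa using hc.tendsto.mono_left nhdsWithin_le_nhds
      have h2 := (hp p hpS).sub h1
      simp only [mul_ite, mul_one, mul_zero, Finset.sum_ite_eq', hpS, if_true, sub_self] at h2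
      refine h2.congr fun z => ?_
      simp only [hf, mul_sub, Finset.mul_sum]
      congr 1
      exact Finset.sum_congr rfl fun q _ => by ring
  have hktop : ∀ p, Tendsto (k p) (comap re atTop) (𝓝 1) := fun p =>
    tendsto_exp_div_exp_sub_atTop (Complex.exp p)
  have hkbot : ∀ p, Tendsto (k p) (comap re atBot) (𝓝 0) := fun p =>
    tendsto_exp_div_exp_sub_atBot (Complex.exp_ne_zero p)
  have hftop : Tendsto f (comap re atTop) (𝓝 (-∑ p ∈ S, ρ p)) := by
    simpa using htop.sub (tendsto_finsetSum S fun p _ => (hktop p).const_mul (ρ p))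
  have hfbot : Tendsto f (comap re atBot) (𝓝 0) := by
    simpa using hbot.sub (tendsto_finsetSum S fun p _ => (hkbot p).const_mul (ρ p))
  have hpi : -π ≤ π := by linarith [pi_pos]
  have hlarge : ∀ᶠ R : ℝ in atTop, 0 ≤ R ∧ ∀ p ∈ S, |p.re| < R := by
    refine (eventually_ge_atTop 0).and ?_
    rw [Finset.eventually_all]
    exact fun p _ => eventually_gt_atTop _
  have hcont : ∀ R : ℝ, (∀ p ∈ S, |p.re| < |R|) →
      ContinuousOn (fun y : ℝ => f (R + y * I)) (Icc (-π) π) := by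
    intro R hR y hy
    have h1 : ContinuousAt f (R + y * I) := by
      refine (hfd _ (by simpa using hy) fun h => ?_).continuousAt
      have := hR _ h
      simp at this
    have h2 : Continuous fun y : ℝ => (R + y * I : ℂ) := by fun_prop
    exact (ContinuousAt.comp (f := fun y : ℝ => (R + y * I : ℂ)) h1
      h2.continuousAt).continuousWithinAt
  have hcont' : ∀ e : ℝ, e = -π ∨ e = π → Continuous fun x : ℝ => f (x + e * I) := by
    intro e he
    have hne : e ∉ Ioo (-π) π := by rcases he with rfl | rfl <;> simp
    have hme : e ∈ Icc (-π) π := by rcases he with rfl | rfl <;> simp [hpi]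
    rw [continuous_iff_continuousAt]
    intro x
    have h1 : ContinuousAt f (x + e * I) := by
      refine (hfd _ (by simpa using hme) fun h => hne ?_).continuousAt
      simpa using hS _ h
    have h2 : Continuous fun x : ℝ => (x + e * I : ℂ) := by fun_prop
    exact ContinuousAt.comp (f := fun x : ℝ => (x + e * I : ℂ)) h1 h2.continuousAt
  have hper : ∀ x : ℝ, f (x + (-π : ℝ) * I) - f (x + π * I) =
      H (x + (-π : ℝ) * I) - H (x + π * I) := by
    intro x
    have he : Complex.exp (x + (-π : ℝ) * I) = Complex.exp (x + π * I) := by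
      rw [Complex.exp_eq_exp_iff_exists_int]
      exact ⟨-1, by push_cast; ring⟩
    simp only [hf, hk, he]
    ring
  have key : ∀ᶠ R : ℝ in atTop, (∫ x : ℝ in -R..R, (H (x + (-π : ℝ) * I) - H (x + π * I))) +
      I * (∫ y : ℝ in -π..π, f (R + y * I)) -
      I * (∫ y : ℝ in -π..π, f ((-R : ℝ) + y * I)) = 0 := by
    filter_upwards [hlarge] with R hR
    rw [← integral_boundary_rect_eq_zero_of_tendsto_mul (f := f) (a := -R) (b := R)
      (by linarith [hR.1]) hpi S (fun p hpS => ⟨abs_lt.1 (hR.2 p hpS), hS p hpS⟩)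
      (fun z _ => hfd z) hfp, ← intervalIntegral.integral_sub
      ((hcont' _ (Or.inl rfl)).intervalIntegrable _ _)
      ((hcont' _ (Or.inr rfl)).intervalIntegrable _ _)]
    simp only [hper]
  have h1 := tendsto_integral_vertical (l := atTop) (by
    filter_upwards [hlarge] with R hR
    exact hcont R (by rw [abs_of_nonneg hR.1]; exact hR.2)) hftop
  have h2 := (tendsto_integral_vertical (l := atBot) (by
    have := tendsto_neg_atBot_atTop.eventually hlarge
    filter_upwards [this] with R hR
    exact hcont R (by rw [abs_of_nonpos (by linarith [hR.1])]; exact hR.2)) hfbot).comp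
    tendsto_neg_atTop_atBot
  have h3 := intervalIntegral_tendsto_integral hi tendsto_neg_atTop_atBot tendsto_id
  have h4 := ((h3.add (h1.const_mul I)).sub (h2.const_mul I))
  have h5 := tendsto_nhds_unique (h4.congr' (by
    filter_upwards [key] with R hR using hR)) tendsto_const_nhds
  linear_combination h5

end contour

theorem integral_comp_exp_mul_exp (g : ℝ → ℝ) :
    (IntegrableOn g (Set.Ioi 0) ↔ Integrable fun v => Real.exp v * g (Real.exp v)) ∧
      ∫ u in Set.Ioi 0, g u = ∫ v, Real.exp v * g (Real.exp v) := by
  have hd : ∀ v ∈ (Set.univ : Set ℝ), HasDerivWithinAt Real.exp (Real.exp v) Set.univ v :=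
    fun v _ => (Real.hasDerivAt_exp v).hasDerivWithinAt
  have h1 := integrableOn_image_iff_integrableOn_abs_deriv_smul MeasurableSet.univ hd
    Real.exp_injective.injOn g
  have h2 := integral_image_eq_integral_abs_deriv_smul MeasurableSet.univ hd
    Real.exp_injective.injOn g
  simpa only [Set.image_univ, Real.range_exp, Real.abs_exp, smul_eq_mul, integrableOn_univ,
    Measure.restrict_univ] using And.intro h1 h2

/-- The density on `(0, ∞)` of the absolutely continuous part in the partial fraction expansion
of `x ^ (1 - b) / (1 + x ^ b)`. -/
noncomputable def cutDensity (b u : ℝ) : ℝ :=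
  -Real.sin (π * b) / π * (u ^ (1 - b) * ((1 + 2 * Real.cos (π * b) * u ^ b) /
    (1 + 2 * Real.cos (π * b) * u ^ b + (u ^ b) ^ 2)))

theorem measurable_cutDensity (b : ℝ) : Measurable (cutDensity b) := by
  unfold cutDensity
  fun_prop

section cutDensity

open Set

variable {b : ℝ}

theorem cos_pi_mul_nonneg (hb1 : 3 / 2 < b) (hb2 : b < 2) : 0 ≤ Real.cos (π * b) := by
  have := pi_pos
  rw [← Real.cos_sub_two_pi]
  exact Real.cos_nonneg_of_mem_Icc ⟨by nlinarith, by nlinarith⟩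

theorem neg_sin_pi_mul_pos (hb1 : 3 / 2 < b) (hb2 : b < 2) : 0 < -Real.sin (π * b) := by
  have := pi_pos
  rw [← Real.sin_sub_two_pi, ← Real.sin_neg]
  exact Real.sin_pos_of_pos_of_lt_pi (by nlinarith) (by nlinarith)

theorem cutDensity_nonneg (hb1 : 3 / 2 < b) (hb2 : b < 2)
    {u : ℝ} (hu : 0 ≤ u) : 0 ≤ cutDensity b u := by
  have := cos_pi_mul_nonneg hb1 hb2
  have := neg_sin_pi_mul_pos hb1 hb2
  have := pi_pos
  unfold cutDensity
  positivity

theorem cutDensity_le (hb1 : 3 / 2 < b) (hb2 : b < 2) {u : ℝ} (hu : 0 < u) :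
    cutDensity b u ≤ u ^ (1 - b) ∧ cutDensity b u ≤ 3 * u ^ (1 - 2 * b) := by
  have hq := cos_pi_mul_nonneg hb1 hb2
  have hq1 := Real.cos_le_one (π * b)
  have hs := neg_sin_pi_mul_pos hb1 hb2
  have hκ : -Real.sin (π * b) / π ≤ 1 := by
    rw [div_le_one pi_pos]
    linarith [Real.neg_one_le_sin (π * b), Real.pi_gt_three]
  have hκ0 : 0 ≤ -Real.sin (π * b) / π := by have := pi_pos; positivity
  unfold cutDensity
  set κ := -Real.sin (π * b) / π
  set q := Real.cos (π * b)
  have hU : 0 < u ^ b := Real.rpow_pos_of_pos hu _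
  have hV : 0 < u ^ (1 - b) := Real.rpow_pos_of_pos hu _
  have e : u ^ (1 - 2 * b) = u ^ (1 - b) / u ^ b := by
    rw [← Real.rpow_sub hu]; congr 1; ring
  rw [e]
  set U := u ^ b
  set V := u ^ (1 - b)
  have hD : 0 < 1 + 2 * q * U + U ^ 2 := by positivity
  have h1 : (1 + 2 * q * U) / (1 + 2 * q * U + U ^ 2) ≤ 1 := by
    rw [div_le_one hD]; nlinarith
  have h2 : (1 + 2 * q * U) / (1 + 2 * q * U + U ^ 2) ≤ 3 / U := by
    rw [div_le_div_iff₀ hD hU]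
    nlinarith [mul_nonneg hq hU.le, mul_nonneg (mul_nonneg hq hU.le) hU.le, sq_nonneg (U - 1),
      mul_le_mul_of_nonneg_right hq1 (sq_nonneg U)]
  have h0 : 0 ≤ (1 + 2 * q * U) / (1 + 2 * q * U + U ^ 2) := by positivity
  constructor
  · calc _ ≤ 1 * (V * 1) := by gcongr
      _ = V := by ring
  · calc _ ≤ 1 * (V * (3 / U)) := by gcongr
      _ = 3 * (V / U) := by ring

theorem integrableOn_cutDensity (hb1 : 3 / 2 < b) (hb2 : b < 2) :
    IntegrableOn (cutDensity b) (Ioi 0) ∧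
    IntegrableOn (fun u => u * cutDensity b u) (Ioi 0) := by
  have hm := measurable_cutDensity b
  rw [← Ioc_union_Ioi_eq_Ioi zero_le_one]
  have hn : ∀ u : ℝ, 0 < u → ‖cutDensity b u‖ = cutDensity b u := fun u hu =>
    Real.norm_of_nonneg (cutDensity_nonneg hb1 hb2 hu.le)
  have h1 : IntegrableOn (fun u : ℝ => u ^ (1 - b)) (Ioc 0 1) :=
    (intervalIntegrable_iff_integrableOn_Ioc_of_le zero_le_one).1
      (intervalIntegral.intervalIntegrable_rpow' (by linarith))
  constructor
  · refine IntegrableOn.union (h1.mono' hm.aestronglyMeasurable ?_)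
      (((integrableOn_Ioi_rpow_of_lt (a := 1 - 2 * b) (by linarith) one_pos).const_mul 3).mono'
        hm.aestronglyMeasurable ?_)
    · filter_upwards [ae_restrict_mem measurableSet_Ioc] with u hu
      rw [hn u hu.1]; exact (cutDensity_le hb1 hb2 hu.1).1
    · filter_upwards [ae_restrict_mem measurableSet_Ioi] with u hu
      have hu : 0 < u := zero_lt_one.trans hu
      rw [hn u hu]; exact (cutDensity_le hb1 hb2 hu).2
  · refine IntegrableOn.union (h1.mono' (measurable_id.mul hm).aestronglyMeasurable ?_)
      (((integrableOn_Ioi_rpow_of_lt (a := 2 - 2 * b) (by linarith) one_pos).const_mul 3).mono'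
        (measurable_id.mul hm).aestronglyMeasurable ?_)
    · filter_upwards [ae_restrict_mem measurableSet_Ioc] with u hu
      rw [norm_mul, hn u hu.1, Real.norm_of_nonneg hu.1.le]
      exact (mul_le_of_le_one_left (cutDensity_nonneg hb1 hb2 hu.1.le) hu.2).trans
        (cutDensity_le hb1 hb2 hu.1).1
    · filter_upwards [ae_restrict_mem measurableSet_Ioi] with u hu
      have hu : 0 < u := zero_lt_one.trans hu
      rw [norm_mul, hn u hu, Real.norm_of_nonneg hu.le]
      calc u * cutDensity b u ≤ u * (3 * u ^ (1 - 2 * b)) := by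
            gcongr; exact (cutDensity_le hb1 hb2 hu).2
        _ = 3 * u ^ (2 - 2 * b) := by
          rw [show 2 - 2 * b = 1 - 2 * b + 1 by ring, Real.rpow_add_one hu.ne']; ring

theorem integrableOn_cutDensity_div (hb1 : 3 / 2 < b) (hb2 : b < 2) {x : ℝ} (hx : 0 < x) :
    IntegrableOn (fun u => cutDensity b u / (x + u)) (Ioi 0) := by
  have hm := measurable_cutDensity b
  refine ((integrableOn_cutDensity hb1 hb2).1.const_mul x⁻¹).mono'
    (hm.div (measurable_const.add measurable_id)).aestronglyMeasurable ?_
  filter_upwards [ae_restrict_mem measurableSet_Ioi] with u hu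
  have hu : 0 < u := hu
  have h0 := cutDensity_nonneg hb1 hb2 hu.le
  rw [Real.norm_of_nonneg (by positivity), div_eq_inv_mul]
  gcongr
  linarith

open Complex in
theorem boundary_jump (hb1 : 3 / 2 < b) (hb2 : b < 2) {x : ℝ} (hx : 0 < x) (v : ℝ) :
    Complex.exp ((1 - b) * (v + (-π : ℝ) * I)) / (1 + Complex.exp (b * (v + (-π : ℝ) * I))) *
        (Complex.exp (v + (-π : ℝ) * I) / (Complex.exp (v + (-π : ℝ) * I) - x)) -
      Complex.exp ((1 - b) * (v + π * I)) / (1 + Complex.exp (b * (v + π * I))) *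
        (Complex.exp (v + π * I) / (Complex.exp (v + π * I) - x)) =
    2 * π * I * ((Real.exp v * (cutDensity b (Real.exp v) / (x + Real.exp v)) : ℝ) : ℂ) := by
  have hq := cos_pi_mul_nonneg hb1 hb2
  unfold cutDensity
  have hb : (0 : ℝ) < Real.exp v := Real.exp_pos v
  set q := Real.cos (π * b) with hqd
  set σ := Real.sin (π * b) with hσd
  have hqσ : q ^ 2 + σ ^ 2 = 1 := Real.cos_sq_add_sin_sq _
  set U : ℝ := Real.exp v ^ b with hU
  set V : ℝ := Real.exp v ^ (1 - b) with hV
  have hUp : 0 < U := Real.rpow_pos_of_pos hb _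
  have hUe : Complex.exp (b * v) = U := by
    rw [hU, ← Real.exp_mul, mul_comm v b]; push_cast; rfl
  have hVe : Complex.exp ((1 - b) * v) = V := by
    rw [hV, ← Real.exp_mul, mul_comm v]; push_cast; rfl
  have e1 : Complex.exp (v + (-π : ℝ) * I) = -(Real.exp v : ℝ) := by
    rw [Complex.exp_add]; push_cast; rw [neg_mul, Complex.exp_neg, Complex.exp_pi_mul_I]; norm_num
  have e2 : Complex.exp (v + π * I) = -(Real.exp v : ℝ) := by
    rw [Complex.exp_add, Complex.exp_pi_mul_I]; push_cast; ring
  have hrot : ∀ θ : ℝ, Complex.exp (θ * I) = Real.cos θ + Real.sin θ * I := fun θ => by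
    rw [Complex.exp_mul_I, Complex.ofReal_cos, Complex.ofReal_sin]
  have e3 : Complex.exp (b * (v + π * I)) = U * (q + σ * I) := by
    rw [mul_add, Complex.exp_add, hUe, hqd, hσd, ← hrot]
    push_cast; ring_nf
  have e4 : Complex.exp (b * (v + (-π : ℝ) * I)) = U * (q - σ * I) := by
    have := hrot (-(π * b))
    rw [Real.cos_neg, Real.sin_neg] at this
    rw [mul_add, Complex.exp_add, hUe, sub_eq_add_neg, ← neg_mul, ← Complex.ofReal_neg, ← this]
    push_cast; ring_nf
  have e5 : Complex.exp ((1 - b) * (v + π * I)) = -(V * (q - σ * I)) := by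
    have := hrot (π - π * b)
    rw [Real.cos_pi_sub, Real.sin_pi_sub, ← hqd, ← hσd] at this
    rw [mul_add, Complex.exp_add, hVe, show (1 - b : ℂ) * (π * I) = (π - π * b : ℝ) * I by
      push_cast; ring, this]
    push_cast; ring
  have e6 : Complex.exp ((1 - b) * (v + (-π : ℝ) * I)) = -(V * (q + σ * I)) := by
    have := hrot (-(π - π * b))
    rw [Real.cos_neg, Real.sin_neg, Real.cos_pi_sub, Real.sin_pi_sub, ← hqd, ← hσd] at this
    rw [mul_add, Complex.exp_add, hVe, show (1 - b : ℂ) * ((-π : ℝ) * I) = (-(π - π * b) : ℝ) * I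
      by push_cast; ring, this]
    push_cast; ring
  rw [e1, e2, e3, e4, e5, e6]
  have hD : (1 + 2 * q * U + U ^ 2 : ℂ) ≠ 0 := by
    have : 0 < 1 + 2 * q * U + U ^ 2 := by positivity
    exact_mod_cast this.ne'
  have hDD : (1 + U * (q + σ * I)) * (1 + U * (q - σ * I)) = (1 + 2 * q * U + U ^ 2 : ℂ) := by
    have : (q ^ 2 + σ ^ 2 : ℂ) = 1 := by exact_mod_cast hqσ
    linear_combination (-(U : ℂ) ^ 2 * σ ^ 2) * I_sq + (U : ℂ) ^ 2 * this
  have hD1 : (1 + U * (q + σ * I) : ℂ) ≠ 0 := fun h => hD (by rw [← hDD, h, zero_mul])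
  have hD2 : (1 + U * (q - σ * I) : ℂ) ≠ 0 := fun h => hD (by rw [← hDD, h, mul_zero])
  have hx' : ((x : ℂ) + (Real.exp v : ℝ)) ≠ 0 := by
    have : 0 < x + Real.exp v := by positivity
    exact_mod_cast this.ne'
  have hx'' : (-((Real.exp v : ℝ) : ℂ) - x) ≠ 0 := fun h => hx' (by linear_combination -h)
  have hpi : (π : ℂ) ≠ 0 := by exact_mod_cast pi_pos.ne'
  have key : -(V * (q + σ * I)) / (1 + U * (q - σ * I)) - -(V * (q - σ * I)) / (1 + U * (q + σ * I))
      = -2 * σ * I * (V * ((1 + 2 * q * U) / (1 + 2 * q * U + U ^ 2 : ℂ))) := by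
    rw [div_sub_div _ _ hD2 hD1, (mul_comm _ _).trans hDD]
    field_simp
    ring
  rw [← sub_mul, key, show -((Real.exp v : ℝ) : ℂ) / (-((Real.exp v : ℝ) : ℂ) - x) =
    (Real.exp v : ℝ) / (x + (Real.exp v : ℝ)) by rw [div_eq_div_iff hx'' hx']; ring]
  push_cast
  field_simp

end cutDensity

section PartialFraction

open Filter Topology Complex

theorem tendsto_sub_mul_div {f g : ℂ → ℂ} {f' p : ℂ} (hf : HasDerivAt f f' p) (h0 : f p = 0)
    (hf' : f' ≠ 0) (hg : ContinuousAt g p) :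
    Tendsto (fun z => (z - p) * (g z / f z)) (𝓝[≠] p) (𝓝 (g p / f')) := by
  have h1 := (hasDerivAt_iff_tendsto_slope.1 hf).inv₀ hf'
  have h2 := (hg.tendsto.mono_left nhdsWithin_le_nhds).mul h1
  rw [← div_eq_mul_inv] at h2
  refine h2.congr fun z => ?_
  rw [slope_def_field, h0, sub_zero, inv_div]
  ring

theorem tendsto_exp_ofReal_mul {a : ℝ} {l : Filter ℝ} (h : Tendsto (fun t => a * t) l atBot) :
    Tendsto (fun z : ℂ => Complex.exp (a * z)) (comap Complex.re l) (𝓝 0) := by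
  rw [tendsto_zero_iff_norm_tendsto_zero]
  refine ((Real.tendsto_exp_atBot.comp h).comp tendsto_comap).congr fun z => ?_
  simp [Complex.norm_exp]

theorem eq_of_exp_mul_eq_neg_one {b : ℝ} (hb0 : 0 < b) (hb2 : b < 2) {z : ℂ}
    (hz : z.im ∈ Set.Icc (-π) π) (h : Complex.exp (b * z) = -1) :
    z = (π / b : ℝ) * I ∨ z = -((π / b : ℝ) * I) := by
  have hpi := pi_pos
  rw [← Complex.exp_pi_mul_I, Complex.exp_eq_exp_iff_exists_int] at h
  obtain ⟨n, hn⟩ := h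
  have hre := congrArg Complex.re hn
  have him := congrArg Complex.im hn
  simp at hre him
  have h1 : (-2 : ℝ) < 1 + 2 * n := by nlinarith [hz.1]
  have h2 : (1 + 2 * n : ℝ) < 2 := by nlinarith [hz.2]
  have h1' : (-2 : ℤ) < 1 + 2 * n := by exact_mod_cast h1
  have h2' : (1 + 2 * n : ℤ) < 2 := by exact_mod_cast h2
  have hre' : z.re = 0 := by simpa [hb0.ne'] using hre
  obtain rfl | rfl : n = 0 ∨ n = -1 := by omega
  · left
    apply Complex.ext
    · simp [hre']
    · simp at him ⊢
      field_simp
      linarith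
  · right
    apply Complex.ext
    · simp [hre']
    · simp at him ⊢
      field_simp
      linarith

theorem eq_log_of_exp_eq {x : ℝ} (hx : 0 < x) {z : ℂ}
    (hz : z.im ∈ Set.Icc (-π) π) (h : Complex.exp z = x) : z = Real.log x := by
  have hpi := pi_pos
  rw [← Real.exp_log hx, Complex.ofReal_exp, Complex.exp_eq_exp_iff_exists_int] at h
  obtain ⟨n, hn⟩ := h
  have him := congrArg Complex.im hn
  simp at him
  have h1 : (-1 : ℝ) < n := by nlinarith [hz.1]
  have h2 : (n : ℝ) < 1 := by nlinarith [hz.2]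
  have h1' : (-1 : ℤ) < n := by exact_mod_cast h1
  have h2' : (n : ℤ) < 1 := by exact_mod_cast h2
  obtain rfl : n = 0 := by omega
  simpa using hn

/-- The partial fraction expansion of `x ^ (1 - b) / (1 + x ^ b)` over `(0, ∞)` and the zeros of
`1 + z ^ b` in the slit plane. -/
theorem rpow_div_one_add_rpow_eq {b : ℝ} (hb1 : 3 / 2 < b) (hb2 : b < 2) {x : ℝ} (hx : 0 < x) :
    x ^ (1 - b) / (1 + x ^ b) = (∫ u in Set.Ioi 0, cutDensity b u / (x + u)) -
      2 / b * (((x + -Real.cos (π / b)) * Real.cos (2 * (π / b) - π) -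
        Real.sin (π / b) * Real.sin (2 * (π / b) - π)) /
        ((x + -Real.cos (π / b)) ^ 2 + Real.sin (π / b) ^ 2)) := by
  have hpi := pi_pos
  have hb0 : 0 < b := by linarith
  set θ : ℝ := π / b with hθ
  have hθ0 : 0 < θ := by positivity
  have hbθ : b * θ = π := by rw [hθ]; field_simp
  have hθ1 : θ < π := by nlinarith
  have hs : 0 < Real.sin θ := Real.sin_pos_of_pos_of_lt_pi hθ0 hθ1
  set P : ℂ := (θ : ℂ) * I with hP
  set L : ℂ := ((Real.log x : ℝ) : ℂ) with hL
  have hbC : (b : ℂ) ≠ 0 := by exact_mod_cast hb0.ne'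
  have hxC : (x : ℂ) ≠ 0 := by exact_mod_cast hx.ne'
  have hPL : P ≠ L := fun h => by
    have := congrArg Complex.im h
    simp [hP, hL] at this
    exact hθ0.ne' this
  have hNL : -P ≠ L := fun h => by
    have := congrArg Complex.im h
    simp [hP, hL] at this
    exact hθ0.ne' this
  have hPN : P ≠ -P := fun h => by
    have := congrArg Complex.im h
    simp [hP] at this
    linarith
  have heL : Complex.exp L = x := by rw [hL, ← Complex.ofReal_exp, Real.exp_log hx]
  have heP : Complex.exp (b * P) = -1 := by
    rw [hP, ← mul_assoc, ← Complex.ofReal_mul, hbθ, Complex.exp_pi_mul_I]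
  have heN : Complex.exp (b * -P) = -1 := by
    rw [mul_neg, Complex.exp_neg, heP]; norm_num
  have hmP : P.im ∈ Set.Ioo (-π) π := by simp [hP]; constructor <;> linarith
  have hmN : (-P).im ∈ Set.Ioo (-π) π := by simp [hP]; constructor <;> linarith
  have hmL : L.im ∈ Set.Ioo (-π) π := by simp [hL, hpi]
  have hne1 : ∀ z : ℂ, z.im ∈ Set.Icc (-π) π → z ≠ P → z ≠ -P → 1 + Complex.exp (b * z) ≠ 0 :=
    fun z hz h1 h2 h => (eq_of_exp_mul_eq_neg_one hb0 hb2 hz (by linear_combination h)).elim h1 h2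
  have hne2 : ∀ z : ℂ, z.im ∈ Set.Icc (-π) π → z ≠ L → Complex.exp z - x ≠ 0 :=
    fun z hz h1 h => h1 (eq_log_of_exp_eq hx hz (by linear_combination h))
  let H : ℂ → ℂ := fun z => Complex.exp ((1 - b) * z) / (1 + Complex.exp (b * z)) *
    (Complex.exp z / (Complex.exp z - x))
  let ρ : ℂ → ℂ := fun z => if z = L then Complex.exp ((1 - b) * L) / (1 + Complex.exp (b * L))
    else Complex.exp z ^ 2 / (b * (Complex.exp z - x))
  have hpole : ∀ p : ℂ, Complex.exp (b * p) = -1 → Complex.exp p - x ≠ 0 →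
      Tendsto (fun z => (z - p) * H z) (𝓝[≠] p)
        (𝓝 (Complex.exp p ^ 2 / (b * (Complex.exp p - x)))) := by
    intro p hp hpx
    have hd : HasDerivAt (fun z : ℂ => 1 + Complex.exp (b * z)) (-b) p := by
      have := (((hasDerivAt_id p).const_mul (b : ℂ)).cexp).const_add 1
      exact this.congr_deriv (by simp [hp])
    have hg : ContinuousAt (fun z : ℂ => Complex.exp ((1 - b) * z) *
        (Complex.exp z / (Complex.exp z - x))) p := by
      have : ContinuousAt (fun z : ℂ => Complex.exp z / (Complex.exp z - x)) p :=
        ContinuousAt.div (by fun_prop) (by fun_prop) hpx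
      exact ContinuousAt.mul (by fun_prop) this
    have := tendsto_sub_mul_div hd (by rw [hp]; norm_num) (neg_ne_zero.2 hbC) hg
    have e : Complex.exp ((1 - b) * p) = -Complex.exp p := by
      rw [sub_mul, one_mul, Complex.exp_sub, hp, div_neg, div_one]
    rw [e] at this
    refine (this.congr fun z => ?_).trans (le_of_eq (congrArg 𝓝 ?_))
    · simp only [H]; ring
    · field_simp
  have hres : ∀ p ∈ ({L, P, -P} : Finset ℂ),
      Tendsto (fun z => (z - p) * H z) (𝓝[≠] p) (𝓝 (ρ p)) := by
    intro p hp
    simp only [Finset.mem_insert, Finset.mem_singleton] at hp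
    rcases hp with rfl | rfl | rfl
    · have hd : HasDerivAt (fun z : ℂ => Complex.exp z - x) x L := by
        have := (Complex.hasDerivAt_exp L).sub_const (x : ℂ)
        rwa [heL] at this
      have hn := hne1 L ⟨hmL.1.le, hmL.2.le⟩ hPL.symm hNL.symm
      have hg : ContinuousAt (fun z : ℂ => Complex.exp ((1 - b) * z) / (1 + Complex.exp (b * z)) *
          Complex.exp z) L := by
        have : ContinuousAt (fun z : ℂ => Complex.exp ((1 - b) * z) / (1 + Complex.exp (b * z))) L :=
          ContinuousAt.div (by fun_prop) (by fun_prop) hn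
        exact ContinuousAt.mul this (by fun_prop)
      have := tendsto_sub_mul_div hd (by simp [heL]) hxC hg
      refine (this.congr fun z => ?_).trans (le_of_eq (congrArg 𝓝 ?_))
      · simp only [H]; ring
      · simp only [ρ, if_true, heL]; field_simp
    · simp only [ρ, if_neg hPL]
      exact hpole _ heP (hne2 _ ⟨hmP.1.le, hmP.2.le⟩ hPL)
    · simp only [ρ, if_neg hNL]
      exact hpole _ heN (hne2 _ ⟨hmN.1.le, hmN.2.le⟩ hNL)
  have hdiff : ∀ z : ℂ, z.im ∈ Set.Icc (-π) π → z ∉ ({L, P, -P} : Finset ℂ) →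
      DifferentiableAt ℂ H z := by
    intro z hz hzS
    simp only [Finset.mem_insert, Finset.mem_singleton, not_or] at hzS
    have h1 := hne1 z hz hzS.2.1 hzS.2.2
    have h2 := hne2 z hz hzS.1
    refine DifferentiableAt.mul (DifferentiableAt.div (by fun_prop) (by fun_prop) h1)
      (DifferentiableAt.div (by fun_prop) (by fun_prop) h2)
  have htop : Tendsto H (comap Complex.re atTop) (𝓝 0) := by
    have h1 := tendsto_exp_ofReal_mul (a := 1 - 2 * b)
      (tendsto_id.const_mul_atTop_of_neg (by linarith : 1 - 2 * b < 0))
    have hc : Tendsto (fun z : ℂ => (b : ℂ) * z) (comap Complex.re atTop)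
        (comap Complex.re atTop) := by
      rw [tendsto_comap_iff]
      refine ((tendsto_id.const_mul_atTop hb0).comp tendsto_comap).congr fun z => ?_
      simp
    have h2 := (tendsto_exp_div_exp_sub_atTop (-1)).comp hc
    have h3 := (h1.mul h2).mul (tendsto_exp_div_exp_sub_atTop (x : ℂ))
    rw [zero_mul, zero_mul] at h3
    refine h3.congr fun z => ?_
    simp only [H, Function.comp]
    rw [sub_neg_eq_add, add_comm (Complex.exp (b * z)) 1,
      show (1 - b : ℂ) * z = (1 - 2 * b : ℝ) * z + b * z by push_cast; ring, Complex.exp_add]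
    ring
  have hbot : Tendsto H (comap Complex.re atBot) (𝓝 0) := by
    have h1 := tendsto_exp_ofReal_mul (a := 2 - b)
      (tendsto_id.const_mul_atBot (by linarith : 0 < 2 - b))
    have h2 := tendsto_exp_ofReal_mul (tendsto_id.const_mul_atBot hb0)
    have h3 : Tendsto (fun z : ℂ => Complex.exp z) (comap Complex.re atBot) (𝓝 0) := by
      simpa using tendsto_exp_ofReal_mul (a := 1) (l := atBot) (by simp only [one_mul]; exact tendsto_id)
    have h4 := (h1.div (h2.const_add 1) (by simp)).div (h3.sub_const (x : ℂ))
      (by simpa using hxC)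
    rw [zero_div, zero_div] at h4
    refine h4.congr fun z => ?_
    simp only [H, Pi.div_apply]
    rw [show ((2 - b : ℝ) : ℂ) * z = (1 - b) * z + z by push_cast; ring, Complex.exp_add]
    ring
  have hJ : (fun v : ℝ => H (v + (-π : ℝ) * I) - H (v + π * I)) = fun v : ℝ => 2 * π * I *
      ((Real.exp v * (cutDensity b (Real.exp v) / (x + Real.exp v)) : ℝ) : ℂ) :=
    funext fun v => boundary_jump hb1 hb2 hx v
  have hci := integral_comp_exp_mul_exp fun u => cutDensity b u / (x + u)
  have hInt := hci.1.1 (integrableOn_cutDensity_div hb1 hb2 hx)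
  have main := integral_strip_eq_sum_residues {L, P, -P} ρ (by
    intro p hp
    simp only [Finset.mem_insert, Finset.mem_singleton] at hp
    rcases hp with rfl | rfl | rfl
    exacts [hmL, hmP, hmN]) hdiff hres htop hbot (by rw [hJ]; exact hInt.ofReal.const_mul _)
  rw [hJ, integral_const_mul, integral_complex_ofReal, ← hci.2, Finset.sum_insert (by
    simp [hPL.symm, hNL.symm]), Finset.sum_pair hPN] at main
  have h2pi : (2 * π * I : ℂ) ≠ 0 := by simp [hpi.ne']
  have main := mul_left_cancel₀ h2pi main
  simp only [ρ, if_true, if_neg hPL, if_neg hNL] at main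
  have hLb : ∀ r : ℝ, Complex.exp (r * L) = (x ^ r : ℝ) := fun r => by
    rw [hL, ← Complex.ofReal_mul, ← Complex.ofReal_exp, Real.rpow_def_of_pos hx, mul_comm]
  have hL1 := hLb (1 - b)
  rw [Complex.ofReal_sub, Complex.ofReal_one] at hL1
  rw [hL1, hLb b] at main
  have hPe : Complex.exp P = Real.cos θ + Real.sin θ * I := by
    rw [hP, Complex.exp_mul_I, Complex.ofReal_cos, Complex.ofReal_sin]
  have hNe : Complex.exp (-P) = Real.cos θ - Real.sin θ * I := by
    rw [hP, ← neg_mul, Complex.exp_mul_I, Complex.cos_neg, Complex.sin_neg, Complex.ofReal_cos,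
      Complex.ofReal_sin]
    ring
  have hP0 := hne2 P ⟨hmP.1.le, hmP.2.le⟩ hPL
  have hN0 := hne2 (-P) ⟨hmN.1.le, hmN.2.le⟩ hNL
  rw [Real.cos_sub_pi, Real.sin_sub_pi, Real.cos_two_mul, Real.sin_two_mul]
  rw [hPe] at hP0 main
  rw [hNe] at hN0 main
  have hcs := Real.sin_sq_add_cos_sq θ
  set C := Real.cos θ
  set s := Real.sin θ
  have hq : (x + -C) ^ 2 + s ^ 2 ≠ 0 := by positivity
  have hsC : (s : ℂ) ^ 2 = 1 - C ^ 2 := by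
    have : s ^ 2 = 1 - C ^ 2 := by linarith
    exact_mod_cast this
  have hsum : ((C + s * I) ^ 2 / (b * (C + s * I - x)) + (C - s * I) ^ 2 / (b * (C - s * I - x)) : ℂ)
      = ((2 / b * (((x + -C) * -(2 * C ^ 2 - 1) - s * -(2 * s * C)) / ((x + -C) ^ 2 + s ^ 2)) : ℝ)
        : ℂ) := by
    have hqC : ((x + -C : ℂ) ^ 2 + s ^ 2) ≠ 0 := by exact_mod_cast hq
    have hprod : (C + s * I - x : ℂ) * (C - s * I - x) = (x + -C) ^ 2 + s ^ 2 := by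
      linear_combination (-(s : ℂ) ^ 2) * I_sq
    have hnum : ((C + s * I) ^ 2 * (C - s * I - x) + (C + s * I - x) * (C - s * I) ^ 2 : ℂ) =
        2 * ((x + -C) * -(2 * C ^ 2 - 1) - s * -(2 * s * C)) := by
      linear_combination (-2 * (s : ℂ) ^ 2 * (C + x)) * I_sq - 2 * (C - x : ℂ) * hsC
    rw [← div_div, ← div_div, div_right_comm, div_right_comm _ (b : ℂ), ← add_div,
      div_add_div _ _ hP0 hN0, hprod, hnum]
    push_cast
    field_simp
  rw [hsum] at main
  have main' : (∫ u in Set.Ioi 0, cutDensity b u / (x + u)) = x ^ (1 - b) / (1 + x ^ b) +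
      2 / b * (((x + -C) * -(2 * C ^ 2 - 1) - s * -(2 * s * C)) / ((x + -C) ^ 2 + s ^ 2)) := by
    exact_mod_cast main
  rw [main']
  ring

end PartialFraction

section CutLaplace

open Set Filter Topology

/-- The Laplace transform of `cutDensity b`. -/
noncomputable def cutLaplace (b t : ℝ) : ℝ :=
  ∫ u in Ioi 0, Real.exp (-(t * u)) * cutDensity b u

variable {b : ℝ}

theorem integral_exp_neg_mul_cutLaplace (hb1 : 3 / 2 < b) (hb2 : b < 2) {x : ℝ} (hx : 0 < x) :
    IntegrableOn (fun t => Real.exp (-(t * x)) * cutLaplace b t) (Ioi 0) ∧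
    ∫ t in Ioi 0, Real.exp (-(t * x)) * cutLaplace b t =
      ∫ u in Ioi 0, cutDensity b u / (x + u) := by
  have hE : ∀ y : ℝ, 0 < y → IntegrableOn (fun t : ℝ => Real.exp (-(t * y))) (Ioi 0) ∧
      ∫ t in Ioi (0 : ℝ), Real.exp (-(t * y)) = 1 / y := fun y hy => by
    have := integral_exp_neg_mul_cos hy 0 0
    simp only [zero_mul, add_zero, Real.cos_zero, mul_one, sub_zero] at this
    refine ⟨this.1, this.2.trans ?_⟩
    field_simp
    ring
  let F : ℝ × ℝ → ℝ := fun z => Real.exp (-(z.1 * (x + z.2))) * cutDensity b z.2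
  have hFm : AEStronglyMeasurable F
      ((volume.restrict (Ioi 0)).prod (volume.restrict (Ioi (0 : ℝ)))) := by
    have := measurable_cutDensity b
    exact Measurable.aestronglyMeasurable (by fun_prop)
  have hInt : ∀ u : ℝ, 0 < u → ∫ t in Ioi (0 : ℝ), F (t, u) = cutDensity b u / (x + u) :=
    fun u hu => by
      simp only [F]
      rw [integral_mul_const, (hE (x + u) (by positivity)).2]
      ring
  have hF : Integrable F ((volume.restrict (Ioi 0)).prod (volume.restrict (Ioi (0 : ℝ)))) := by
    rw [integrable_prod_iff' hFm]
    constructor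
    · filter_upwards [ae_restrict_mem measurableSet_Ioi] with u hu
      exact (hE (x + u) (add_pos hx hu)).1.mul_const (cutDensity b u)
    · refine (integrableOn_cutDensity_div hb1 hb2 hx).congr ?_
      filter_upwards [ae_restrict_mem measurableSet_Ioi] with u hu
      rw [← hInt u hu]
      refine integral_congr_ae (ae_of_all _ fun t => ?_)
      have := cutDensity_nonneg hb1 hb2 (le_of_lt hu)
      exact (Real.norm_of_nonneg (by positivity)).symm
  have hlap : ∀ t, ∫ u in Ioi (0 : ℝ), F (t, u) = Real.exp (-(t * x)) * cutLaplace b t := fun t => by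
    rw [cutLaplace, ← integral_const_mul]
    refine integral_congr_ae (ae_of_all _ fun u => ?_)
    simp only [F]
    rw [mul_add, neg_add, Real.exp_add, mul_assoc]
  constructor
  · exact hF.integral_prod_left.congr (ae_of_all _ hlap)
  · calc _ = ∫ t in Ioi (0 : ℝ), ∫ u in Ioi (0 : ℝ), F (t, u) := by simp only [hlap]
      _ = ∫ u in Ioi (0 : ℝ), ∫ t in Ioi (0 : ℝ), F (t, u) := integral_integral_swap hF
      _ = _ := setIntegral_congr_fun measurableSet_Ioi hInt

theorem isCM_of_le_cutLaplace (hb1 : 3 / 2 < b) (hb2 : b < 2) (h : ∀ t, 0 < t →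
    2 / b * (Real.exp (-(t * -Real.cos (π / b))) *
      Real.cos (Real.sin (π / b) * t + (2 * (π / b) - π))) ≤ cutLaplace b t) :
    IsCM fun x => x ^ (1 - b) / (1 + x ^ b) := by
  set f : ℝ → ℝ := fun t => cutLaplace b t - 2 / b * (Real.exp (-(t * -Real.cos (π / b))) *
      Real.cos (Real.sin (π / b) * t + (2 * (π / b) - π))) with hf
  have hpi := pi_pos
  have hc : 0 < -Real.cos (π / b) := by
    rw [neg_pos]
    apply Real.cos_neg_of_pi_div_two_lt_of_lt
    · rw [div_lt_div_iff₀ (by norm_num) (by linarith)]; nlinarith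
    · rw [div_lt_iff₀ (by linarith)]; nlinarith
  have key : ∀ x, 0 < x → IntegrableOn (fun t => Real.exp (-(t * x)) * f t) (Ioi 0) ∧
      ∫ t in Ioi 0, Real.exp (-(t * x)) * f t = x ^ (1 - b) / (1 + x ^ b) := by
    intro x hx
    have h1 := integral_exp_neg_mul_cutLaplace hb1 hb2 hx
    have h2 := integral_exp_neg_mul_cos (add_pos hx hc) (Real.sin (π / b)) (2 * (π / b) - π)
    have e : (fun t => Real.exp (-(t * x)) * f t) = fun t => Real.exp (-(t * x)) * cutLaplace b t -
        2 / b * (Real.exp (-(t * (x + -Real.cos (π / b)))) *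
          Real.cos (Real.sin (π / b) * t + (2 * (π / b) - π))) := by
      funext t
      rw [hf, mul_add t x, neg_add, Real.exp_add]
      ring
    rw [e]
    refine ⟨h1.1.sub (h2.1.const_mul _), ?_⟩
    rw [integral_sub h1.1 (h2.1.const_mul _), integral_const_mul, h1.2, h2.2,
      rpow_div_one_add_rpow_eq hb1 hb2 hx]
  exact (IsCM.of_laplace (fun t ht => sub_nonneg.2 (h t ht)) fun x hx => (key x hx).1).congr
    fun x hx => (key x hx).2

end CutLaplace

section Moments

open Set Filter Topology

theorem tendsto_integral_div_add_mul {g : ℝ → ℝ} (hg : IntegrableOn g (Ioi 0)) :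
    Tendsto (fun x => ∫ u in Ioi 0, x / (x + u) * g u) atTop (𝓝 (∫ u in Ioi 0, g u)) := by
  refine tendsto_integral_filter_of_dominated_convergence (fun u => ‖g u‖) ?_ ?_ hg.norm ?_
  · refine Eventually.of_forall fun x => AEStronglyMeasurable.mul ?_ hg.aestronglyMeasurable
    exact Measurable.aestronglyMeasurable (by fun_prop)
  · filter_upwards [eventually_gt_atTop 0] with x hx
    filter_upwards [ae_restrict_mem measurableSet_Ioi] with u hu
    have hu : 0 < u := hu
    rw [norm_mul, Real.norm_of_nonneg (by positivity)]
    exact mul_le_of_le_one_left (norm_nonneg _) ((div_le_one (by positivity)).2 (by linarith))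
  · filter_upwards [ae_restrict_mem measurableSet_Ioi] with u hu
    have h1 : Tendsto (fun x : ℝ => 1 - u / (x + u)) atTop (𝓝 (1 - 0)) :=
      ((tendsto_atTop_add_const_right _ u tendsto_id).const_div_atTop u).const_sub 1
    have h2 : Tendsto (fun x : ℝ => x / (x + u)) atTop (𝓝 1) := by
      rw [sub_zero] at h1
      refine h1.congr' ?_
      filter_upwards [eventually_gt_atTop 0] with x hx
      have hu : 0 < u := hu
      field_simp
      ring
    simpa using h2.mul_const (g u)

theorem tendsto_mul_div_sq_add_sq (c s A B : ℝ) :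
    Tendsto (fun x => x * (A * x + B) / ((x + c) ^ 2 + s ^ 2)) atTop (𝓝 A) := by
  have hi : Tendsto (fun x : ℝ => x⁻¹) atTop (𝓝 0) := tendsto_inv_atTop_zero
  have h := ((hi.const_mul B).const_add A).div (((hi.const_mul c).const_add 1).pow 2 |>.add
    ((hi.const_mul s).pow 2)) (by norm_num)
  have e : (A + B * 0) / ((1 + c * 0) ^ 2 + (s * 0) ^ 2) = A := by norm_num
  rw [e] at h
  refine h.congr' ?_
  filter_upwards [eventually_gt_atTop 0] with x hx
  simp only [Pi.div_apply]
  rw [show A + B * x⁻¹ = (x * (A * x + B)) / x ^ 2 by field_simp,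
    show (1 + c * x⁻¹) ^ 2 + (s * x⁻¹) ^ 2 = ((x + c) ^ 2 + s ^ 2) / x ^ 2 by field_simp,
    div_div_div_cancel_right₀ (by positivity)]

variable {b : ℝ}

theorem tendsto_sq_mul_rpow_div (hb1 : 3 / 2 < b) :
    Tendsto (fun x : ℝ => x ^ 2 * (x ^ (1 - b) / (1 + x ^ b))) atTop
    (𝓝 0) := by
  refine squeeze_zero' (g := fun x : ℝ => x ^ (-(2 * b - 3))) ?_ ?_
    (tendsto_rpow_neg_atTop (by linarith))
  · filter_upwards [eventually_gt_atTop 0] with x hx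
    positivity
  · filter_upwards [eventually_gt_atTop 0] with x hx
    have : x ^ (-(2 * b - 3)) = x ^ 2 * (x ^ (1 - b) / x ^ b) := by
      rw [← Real.rpow_sub hx, ← Real.rpow_natCast, ← Real.rpow_add hx]
      congr 1; push_cast; ring
    rw [this]
    gcongr
    linarith [Real.rpow_pos_of_pos hx b]

theorem integral_cutDensity (hb1 : 3 / 2 < b) (hb2 : b < 2) :
    ∫ u in Ioi 0, cutDensity b u = 2 / b * Real.cos (2 * (π / b) - π) := by
  refine tendsto_nhds_unique (tendsto_integral_div_add_mul (integrableOn_cutDensity hb1 hb2).1) ?_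
  have hstar := fun x hx => rpow_div_one_add_rpow_eq hb1 hb2 (x := x) hx
  set c := -Real.cos (π / b)
  set s := Real.sin (π / b)
  set φ := 2 * (π / b) - π
  have h1 := (tendsto_inv_atTop_zero (𝕜 := ℝ)).mul (tendsto_sq_mul_rpow_div hb1)
  have h2 := (tendsto_mul_div_sq_add_sq c s (Real.cos φ) (c * Real.cos φ - s * Real.sin φ)).const_mul
    (2 / b)
  have h3 := h1.add h2
  rw [mul_zero, zero_add] at h3
  refine h3.congr' ?_
  filter_upwards [eventually_gt_atTop 0] with x hx
  have e : ∫ u in Ioi 0, x / (x + u) * cutDensity b u =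
      x * ∫ u in Ioi 0, cutDensity b u / (x + u) := by
    rw [← integral_const_mul]
    congr 1; funext u; ring
  rw [e, eq_add_of_sub_eq (hstar x hx).symm]
  generalize x ^ (1 - b) / (1 + x ^ b) = L
  field_simp
  ring

theorem integral_mul_cutDensity (hb1 : 3 / 2 < b) (hb2 : b < 2) :
    ∫ u in Ioi 0, u * cutDensity b u = 2 / b * (-Real.cos (π / b) * Real.cos (2 * (π / b) - π) +
      Real.sin (π / b) * Real.sin (2 * (π / b) - π)) := by
  refine tendsto_nhds_unique (tendsto_integral_div_add_mul (integrableOn_cutDensity hb1 hb2).2) ?_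
  have hI := integral_cutDensity hb1 hb2
  have hstar := fun x hx => rpow_div_one_add_rpow_eq hb1 hb2 (x := x) hx
  set c := -Real.cos (π / b)
  set s := Real.sin (π / b)
  set φ := 2 * (π / b) - π
  have h2 := (tendsto_mul_div_sq_add_sq c s (c * Real.cos φ + s * Real.sin φ)
    (Real.cos φ * (c ^ 2 + s ^ 2))).const_mul (2 / b)
  have h3 := h2.sub (tendsto_sq_mul_rpow_div hb1)
  rw [sub_zero] at h3
  refine h3.congr' ?_
  filter_upwards [eventually_gt_atTop 0, eventually_gt_atTop (-c)] with x hx hxc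
  have e : ∫ u in Ioi 0, x / (x + u) * (u * cutDensity b u) =
      x * ((∫ u in Ioi 0, cutDensity b u) - x * ∫ u in Ioi 0, cutDensity b u / (x + u)) := by
    rw [← integral_const_mul, ← integral_sub (integrableOn_cutDensity hb1 hb2).1
      ((integrableOn_cutDensity_div hb1 hb2 hx).const_mul x), ← integral_const_mul]
    refine setIntegral_congr_fun measurableSet_Ioi fun u hu => ?_
    have hu : 0 < u := hu
    field_simp
    ring
  have hq : (x + c) ^ 2 + s ^ 2 ≠ 0 := by
    have : 0 < x + c := by linarith
    positivity
  rw [e, hI, eq_add_of_sub_eq (hstar x hx).symm, ← sub_eq_zero]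
  generalize x ^ (1 - b) / (1 + x ^ b) = L
  have hb0 : b ≠ 0 := by linarith
  field_simp
  ring

end Moments

section CutLaplaceBounds

open Set Filter Topology

theorem cos_sub_mul_sin_le_exp (τ : ℝ) {a : ℝ} (ha0 : 0 ≤ a) (haπ : a ≤ π) :
    Real.cos a - τ * Real.sin a ≤ Real.exp (-(a * τ)) := by
  have hd : ∀ x, HasDerivAt (fun x => Real.exp (x * τ) * (Real.cos x - τ * Real.sin x))
      (-(Real.exp (x * τ) * ((1 + τ ^ 2) * Real.sin x))) x := fun x =>
    (((hasDerivAt_id x).mul_const τ).exp.mul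
      ((Real.hasDerivAt_cos x).sub ((Real.hasDerivAt_sin x).const_mul τ))).congr_deriv (by
        simp only [id, Pi.sub_apply]; ring)
  have hanti : AntitoneOn (fun x => Real.exp (x * τ) * (Real.cos x - τ * Real.sin x)) (Icc 0 π) := by
    refine antitoneOn_of_deriv_nonpos (convex_Icc 0 π)
      (fun x _ => (hd x).continuousAt.continuousWithinAt)
      (fun x _ => (hd x).differentiableAt.differentiableWithinAt) fun x hx => ?_
    rw [interior_Icc] at hx
    rw [(hd x).deriv, neg_nonpos]
    have := Real.sin_pos_of_pos_of_lt_pi hx.1 hx.2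
    positivity
  have := hanti ⟨le_rfl, ha0.trans haπ⟩ ⟨ha0, haπ⟩ ha0
  simp only [zero_mul, Real.exp_zero, Real.cos_zero, Real.sin_zero, mul_zero, sub_zero,
    mul_one] at this
  rw [Real.exp_neg, ← one_div, le_div_iff₀ (Real.exp_pos _)]
  linarith

theorem Gamma_le_one_of_mem_Icc {x : ℝ} (hx : x ∈ Icc (1 : ℝ) 2) : Real.Gamma x ≤ 1 := by
  have h := Real.convexOn_Gamma.2 (show (1 : ℝ) ∈ Ioi (0 : ℝ) by simp)
    (show (2 : ℝ) ∈ Ioi (0 : ℝ) by simp)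
    (show 0 ≤ 2 - x by linarith [hx.2]) (show 0 ≤ x - 1 by linarith [hx.1]) (by ring)
  simp only [smul_eq_mul, Real.Gamma_one, Real.Gamma_two] at h
  rw [show (2 - x) * 1 + (x - 1) * 2 = x by ring] at h
  linarith

theorem three_div_pi_mul_le_sin {x : ℝ} (hx0 : 0 ≤ x) (hx : x ≤ π / 6) :
    3 / π * x ≤ Real.sin x := by
  have hpi := pi_pos
  have h := strictConcaveOn_sin_Icc.concaveOn.2 (show (0 : ℝ) ∈ Icc 0 π from ⟨le_rfl, hpi.le⟩)
    (show π / 6 ∈ Icc 0 π from ⟨by positivity, by linarith⟩)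
    (show 0 ≤ 1 - 6 * x / π by rw [sub_nonneg, div_le_one hpi]; linarith)
    (show 0 ≤ 6 * x / π by positivity) (by ring)
  simp only [smul_eq_mul, Real.sin_zero, Real.sin_pi_div_six] at h
  rw [show (1 - 6 * x / π) * 0 + 6 * x / π * (π / 6) = x by field_simp; ring] at h
  calc 3 / π * x = (1 - 6 * x / π) * 0 + 6 * x / π * (1 / 2) := by ring
    _ ≤ _ := h

variable {b : ℝ}

theorem integrableOn_exp_mul_cutDensity (hb1 : 3 / 2 < b) (hb2 : b < 2) {t : ℝ} (ht : 0 < t) :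
    IntegrableOn (fun u => Real.exp (-(t * u)) * cutDensity b u) (Ioi 0) := by
  refine (integrableOn_cutDensity hb1 hb2).1.norm.mono' ?_ ?_
  · have := measurable_cutDensity b
    exact Measurable.aestronglyMeasurable (by fun_prop)
  · filter_upwards [ae_restrict_mem measurableSet_Ioi] with u hu
    have hu : 0 < u := hu
    rw [norm_mul, Real.norm_of_nonneg (Real.exp_pos _).le]
    refine mul_le_of_le_one_left (norm_nonneg _) (Real.exp_le_one_iff.2 ?_)
    rw [neg_nonpos]; positivity

theorem cutLaplace_nonneg (hb1 : 3 / 2 < b) (hb2 : b < 2) (t : ℝ) : 0 ≤ cutLaplace b t :=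
  setIntegral_nonneg measurableSet_Ioi fun _ hu =>
    mul_nonneg (Real.exp_pos _).le (cutDensity_nonneg hb1 hb2 (le_of_lt hu))

theorem exp_mul_integral_le_cutLaplace (hb1 : 3 / 2 < b) (hb2 : b < 2) {t m : ℝ} (ht : 0 < t)
    (hm : m * ∫ u in Ioi 0, cutDensity b u = ∫ u in Ioi 0, u * cutDensity b u) :
    Real.exp (-(t * m)) * ∫ u in Ioi 0, cutDensity b u ≤ cutLaplace b t := by
  have hi := integrableOn_cutDensity hb1 hb2
  have h1 : ∫ u in Ioi 0, Real.exp (-(t * m)) *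
      ((1 + t * m) * cutDensity b u - t * (u * cutDensity b u)) =
      Real.exp (-(t * m)) * ∫ u in Ioi 0, cutDensity b u := by
    rw [integral_const_mul, integral_sub (hi.1.const_mul _) (hi.2.const_mul _), integral_const_mul,
      integral_const_mul, ← hm]
    ring
  rw [← h1]
  refine setIntegral_mono_on (((hi.1.const_mul _).sub (hi.2.const_mul _)).const_mul _)
    (integrableOn_exp_mul_cutDensity hb1 hb2 ht) measurableSet_Ioi fun u hu => ?_
  have h0 := cutDensity_nonneg hb1 hb2 (le_of_lt hu)
  have h2 : Real.exp (-(t * u)) = Real.exp (-(t * m)) * Real.exp (t * m - t * u) := by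
    rw [← Real.exp_add]; ring_nf
  rw [h2, mul_assoc]
  gcongr
  nlinarith [Real.add_one_le_exp (t * m - t * u)]

theorem le_cutLaplace_of_mul_le_pi (hb1 : 3 / 2 < b) (hb2 : b < 2)
    {t : ℝ} (ht : 0 < t) (hst : Real.sin (π / b) * t ≤ π) :
    2 / b * (Real.exp (-(t * -Real.cos (π / b))) *
      Real.cos (Real.sin (π / b) * t + (2 * (π / b) - π))) ≤ cutLaplace b t := by
  have hpi := pi_pos
  have hb0 : 0 < b := by linarith
  have hθ1 : π / 2 < π / b := by rw [div_lt_div_iff₀ (by norm_num) hb0]; nlinarith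
  have hθ2 : π / b < 2 * π / 3 := by rw [div_lt_div_iff₀ hb0 (by norm_num)]; nlinarith
  have I0 := integral_cutDensity hb1 hb2
  have I1 := integral_mul_cutDensity hb1 hb2
  have hs : 0 ≤ Real.sin (π / b) := Real.sin_nonneg_of_nonneg_of_le_pi (by positivity) (by linarith)
  have hcos : 0 < Real.cos (2 * (π / b) - π) := Real.cos_pos_of_mem_Ioo ⟨by linarith, by linarith⟩
  set s := Real.sin (π / b)
  set c := -Real.cos (π / b)
  set φ := 2 * (π / b) - π
  have hm : (c + s * (Real.sin φ / Real.cos φ)) * ∫ u in Ioi 0, cutDensity b u =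
      ∫ u in Ioi 0, u * cutDensity b u := by
    rw [I0, I1]; field_simp
  refine le_trans ?_ (exp_mul_integral_le_cutLaplace hb1 hb2 ht hm)
  have h := cos_sub_mul_sin_le_exp (Real.sin φ / Real.cos φ) (mul_nonneg hs ht.le) hst
  have e1 : Real.cos (s * t + φ) =
      Real.cos φ * (Real.cos (s * t) - Real.sin φ / Real.cos φ * Real.sin (s * t)) := by
    rw [Real.cos_add]; field_simp
  have e2 : Real.exp (-(t * (c + s * (Real.sin φ / Real.cos φ)))) =
      Real.exp (-(t * c)) * Real.exp (-(s * t * (Real.sin φ / Real.cos φ))) := by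
    rw [← Real.exp_add]; ring_nf
  rw [e1, e2, I0]
  calc 2 / b * (Real.exp (-(t * c)) * (Real.cos φ *
        (Real.cos (s * t) - Real.sin φ / Real.cos φ * Real.sin (s * t))))
      ≤ 2 / b * (Real.exp (-(t * c)) * (Real.cos φ *
        Real.exp (-(s * t * (Real.sin φ / Real.cos φ))))) := by gcongr
    _ = _ := by ring

theorem cos_nonpos_of_pi_le_mul (hb1 : 3 / 2 < b) (hb2 : b < 2)
    {t : ℝ} (hst : π ≤ Real.sin (π / b) * t) (ht : t ≤ 4) :
    Real.cos (Real.sin (π / b) * t + (2 * (π / b) - π)) ≤ 0 := by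
  have hpi := pi_pos
  have hb0 : 0 < b := by linarith
  have hθ1 : π / 2 < π / b := by rw [div_lt_div_iff₀ (by norm_num) hb0]; nlinarith
  have hθ2 : π / b < 2 * π / 3 := by rw [div_lt_div_iff₀ hb0 (by norm_num)]; nlinarith
  have hs : Real.sin (π / b) ≤ √3 / 2 + (2 * π / 3 - π / b) / 2 := by
    rw [← Real.sin_pi_sub, show π - π / b = π / 3 + (2 * π / 3 - π / b) by ring, Real.sin_add,
      Real.sin_pi_div_three, Real.cos_pi_div_three]
    have h1 := Real.cos_le_one (2 * π / 3 - π / b)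
    have h2 := Real.sin_le (x := 2 * π / 3 - π / b) (by linarith)
    nlinarith [Real.sqrt_nonneg 3]
  have hs0 : 0 < Real.sin (π / b) := Real.sin_pos_of_pos_of_lt_pi (by positivity) (by linarith)
  have h3 : √3 ≤ 1.7321 := by rw [Real.sqrt_le_left (by norm_num)]; norm_num
  have := Real.pi_gt_d2
  apply Real.cos_nonpos_of_pi_div_two_le_of_le
  · linarith
  · have : Real.sin (π / b) * t ≤ Real.sin (π / b) * 4 := by gcongr
    linarith

theorem rpow_sub_rpow_le_cutDensity (hb1 : 3 / 2 < b) (hb2 : b < 2) {u : ℝ} (hu : 0 < u) :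
    -Real.sin (π * b) / π * (u ^ (1 - b) - u ^ (1 + b)) ≤ cutDensity b u := by
  have hq := cos_pi_mul_nonneg hb1 hb2
  have hs := neg_sin_pi_mul_pos hb1 hb2
  have hpi := pi_pos
  have hU : 0 < u ^ b := Real.rpow_pos_of_pos hu _
  have hV : 0 < u ^ (1 - b) := Real.rpow_pos_of_pos hu _
  have e : u ^ (1 + b) = u ^ (1 - b) * (u ^ b) ^ 2 := by
    rw [← Real.rpow_natCast, ← Real.rpow_mul hu.le, ← Real.rpow_add hu]
    congr 1; push_cast; ring
  rw [cutDensity, e]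
  set q := Real.cos (π * b)
  set U := u ^ b
  set V := u ^ (1 - b)
  have h : 1 - U ^ 2 ≤ (1 + 2 * q * U) / (1 + 2 * q * U + U ^ 2) := by
    rw [le_div_iff₀ (by positivity)]
    have : 0 ≤ 2 * q * U * U ^ 2 := by positivity
    nlinarith [sq_nonneg (U ^ 2)]
  calc _ = -Real.sin (π * b) / π * (V * (1 - U ^ 2)) := by ring
    _ ≤ _ := by gcongr

theorem rpow_mul_le_cutLaplace (hb1 : 3 / 2 < b) (hb2 : b < 2) {t : ℝ} (ht : 4 ≤ t) :
    (1 / t) ^ (2 - b) * (1 - 35 / 32 * (2 - b)) ≤ cutLaplace b t := by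
  have hpi := pi_pos
  have ht0 : 0 < t := by linarith
  have hI : ∀ a : ℝ, 0 < a → IntegrableOn (fun u : ℝ => Real.exp (-(t * u)) * u ^ (a - 1)) (Ioi 0) ∧
      ∫ u in Ioi (0 : ℝ), Real.exp (-(t * u)) * u ^ (a - 1) = (1 / t) ^ a * Real.Gamma a :=
    fun a ha => by
      constructor
      · refine (integrableOn_rpow_mul_exp_neg_mul ha ht0).congr_fun (fun u _ => ?_) measurableSet_Ioi
        simp only [mul_comm u t]; ring
      · rw [← Real.integral_rpow_mul_exp_neg_mul_Ioi ha ht0]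
        congr 1; funext u; ring
  have h1 := hI (2 - b) (by linarith)
  have h2 := hI (2 + b) (by linarith)
  rw [show 2 - b - 1 = 1 - b by ring] at h1
  rw [show 2 + b - 1 = 1 + b by ring] at h2
  set κ := -Real.sin (π * b) / π with hκ
  have hκ0 : 0 < κ := div_pos (neg_sin_pi_mul_pos hb1 hb2) hpi
  have hsin : Real.sin (π * (2 - b)) = -Real.sin (π * b) := by
    rw [show π * (2 - b) = 2 * π - π * b by ring, Real.sin_two_pi_sub]
  have hκ1 : κ ≤ 2 - b := by
    rw [hκ, ← hsin, div_le_iff₀ hpi]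
    linarith [Real.sin_le (x := π * (2 - b)) (mul_nonneg hpi.le (by linarith))]
  have hlow : κ * ((1 / t) ^ (2 - b) * Real.Gamma (2 - b) - (1 / t) ^ (2 + b) * Real.Gamma (2 + b))
      ≤ cutLaplace b t := by
    rw [← h1.2, ← h2.2, ← integral_sub h1.1 h2.1, ← integral_const_mul]
    refine setIntegral_mono_on ((h1.1.sub h2.1).const_mul _)
      (integrableOn_exp_mul_cutDensity hb1 hb2 ht0) measurableSet_Ioi fun u hu => ?_
    calc _ = Real.exp (-(t * u)) * (κ * (u ^ (1 - b) - u ^ (1 + b))) := by ring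
      _ ≤ _ := by gcongr; exact rpow_sub_rpow_le_cutDensity hb1 hb2 hu
  refine le_trans ?_ hlow
  have hG1 := Gamma_le_one_of_mem_Icc (x := b) ⟨by linarith, hb2.le⟩
  have hGb : Real.Gamma b = (b - 1) * Real.Gamma (b - 1) := by
    have := Real.Gamma_add_one (s := b - 1) (by linarith)
    rwa [sub_add_cancel] at this
  have hG0 : 0 < Real.Gamma (b - 1) := Real.Gamma_pos_of_pos (by linarith)
  have hκΓ : b - 1 ≤ κ * Real.Gamma (2 - b) := by
    have hr := Real.Gamma_mul_Gamma_one_sub (2 - b)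
    rw [show 1 - (2 - b) = b - 1 by ring, hsin] at hr
    have : κ * Real.Gamma (2 - b) * Real.Gamma (b - 1) = 1 := by
      rw [mul_assoc, hr, hκ]
      have := (neg_sin_pi_mul_pos hb1 hb2).ne'
      rw [div_mul_div_cancel₀ hpi.ne', div_self this]
    by_contra! hlt
    nlinarith
  have hG2 : Real.Gamma (2 + b) ≤ 6 := by
    rw [show 2 + b = (b + 1) + 1 by ring, Real.Gamma_add_one (by linarith),
      Real.Gamma_add_one (by linarith)]
    calc (b + 1) * (b * Real.Gamma b) ≤ 3 * (2 * 1) := by gcongr; linarith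
      _ = 6 := by norm_num
  have hG20 : 0 < Real.Gamma (2 + b) := Real.Gamma_pos_of_pos (by linarith)
  have ht1 : (1 / t) ^ (2 + b) ≤ (1 / t) ^ (2 - b) * (1 / 64) := by
    rw [show 2 + b = (2 - b) + 2 * b by ring, Real.rpow_add (by positivity)]
    gcongr
    calc (1 / t) ^ (2 * b) ≤ (1 / t) ^ (3 : ℝ) :=
          Real.rpow_le_rpow_of_exponent_ge (by positivity)
            ((div_le_one ht0).2 (by linarith)) (by linarith)
      _ ≤ (1 / 4) ^ (3 : ℝ) := by gcongr
      _ = 1 / 64 := by norm_num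
  have hT : 0 < (1 / t) ^ (2 - b) := by positivity
  have hA : (1 / t) ^ (2 - b) * (b - 1) ≤ κ * ((1 / t) ^ (2 - b) * Real.Gamma (2 - b)) := by
    nlinarith
  have hB : κ * ((1 / t) ^ (2 + b) * Real.Gamma (2 + b)) ≤
      (2 - b) * ((1 / t) ^ (2 - b) * (1 / 64) * 6) := by
    gcongr
  linarith

theorem exp_neg_mul_le_rpow (hb1 : 3 / 2 < b) (hb2 : b < 2) {t : ℝ} (ht : 4 ≤ t) :
    2 / b * Real.exp (-(t * -Real.cos (π / b))) ≤ (1 / t) ^ (2 - b) * (1 - 35 / 32 * (2 - b)) := by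
  have hpi := pi_pos
  have hb0 : 0 < b := by linarith
  have ht0 : 0 < t := by linarith
  have hθ1 : π / 2 < π / b := by rw [div_lt_div_iff₀ (by norm_num) hb0]; nlinarith
  have hθ2 : π / b < 2 * π / 3 := by rw [div_lt_div_iff₀ hb0 (by norm_num)]; nlinarith
  have hc : 3 * (2 - b) / (2 * b) ≤ -Real.cos (π / b) := by
    have h := three_div_pi_mul_le_sin (x := π / b - π / 2) (by linarith) (by linarith)
    rw [Real.sin_sub_pi_div_two] at h
    refine le_trans (le_of_eq ?_) h
    field_simp
  set c := -Real.cos (π / b)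
  obtain ⟨δ, rfl⟩ : ∃ δ, b = 2 - δ := ⟨2 - b, by ring⟩
  have hδ0 : 0 < δ := by linarith
  have hδ1 : δ < 1 / 2 := by linarith
  rw [show 2 - (2 - δ) = δ by ring] at *
  have hlog : Real.log t ≤ 2 * Real.log 2 + (t / 4 - 1) := by
    have h := Real.log_le_sub_one_of_pos (show 0 < t / 4 by positivity)
    rw [Real.log_div ht0.ne' (by norm_num), show (4 : ℝ) = 2 ^ 2 by norm_num, Real.log_pow] at h
    push_cast at h
    linarith
  have hl2 := Real.log_two_lt_d9
  have hcδ : 3 / 4 * δ + 3 / 8 * δ ^ 2 + 3 / 16 * δ ^ 3 ≤ c := by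
    refine le_trans ?_ hc
    rw [le_div_iff₀ (by linarith)]
    nlinarith [pow_pos hδ0 4]
  set y := 1.6137 * δ + 3 / 2 * δ ^ 2 + 3 / 4 * δ ^ 3 with hy
  have hy0 : 0 ≤ y := by positivity
  have hY : y ≤ t * c - δ * Real.log t := by
    have h1 : δ * Real.log t ≤ δ * (1.3863 + (t / 4 - 1)) := by gcongr; linarith
    have h2 : 0 ≤ (c - δ / 4) * (t - 4) :=
      mul_nonneg (by linarith [sq_nonneg δ, pow_pos hδ0 3]) (by linarith)
    linarith
  have hexp : 1 + y + y ^ 2 / 2 ≤ Real.exp (t * c - δ * Real.log t) :=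
    (Real.quadratic_le_exp_of_nonneg hy0).trans (Real.exp_le_exp.2 hY)
  have hpoly : 2 ≤ (2 - δ) * ((1 - 35 / 32 * δ) * (1 + y + y ^ 2 / 2)) := by
    have e : (2 - δ) * ((1 - 35 / 32 * δ) * (1 + y + y ^ 2 / 2)) = 2 + 2 * δ * (399 / 20000 +
        77705447 / 100000000 * δ - 2641071219 / 6400000000 * δ ^ 2 -
        3034720617 / 2560000000 * δ ^ 3 - 17259 / 20000 * δ ^ 4 - 120123 / 512000 * δ ^ 5 +
        171 / 1024 * δ ^ 6 + 315 / 2048 * δ ^ 7) := by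
      rw [hy]; ring
    have h2 : δ ^ 2 ≤ δ / 2 := by nlinarith
    have h3 : δ ^ 3 ≤ δ / 4 := by nlinarith
    have h4 : δ ^ 4 ≤ δ / 8 := by nlinarith
    have h5 : δ ^ 5 ≤ δ / 16 := by nlinarith
    rw [e, le_add_iff_nonneg_right]
    refine mul_nonneg (by positivity) ?_
    linarith [pow_pos hδ0 6, pow_pos hδ0 7]
  have hr : (1 / t) ^ δ = Real.exp (-(t * c)) * Real.exp (t * c - δ * Real.log t) := by
    rw [← Real.exp_add, Real.rpow_def_of_pos (by positivity), one_div, Real.log_inv]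
    ring_nf
  rw [hr, mul_assoc, mul_comm (2 / (2 - δ))]
  gcongr
  rw [div_le_iff₀ hb0]
  have : 0 < 1 - 35 / 32 * δ := by linarith
  calc 2 ≤ (2 - δ) * ((1 - 35 / 32 * δ) * (1 + y + y ^ 2 / 2)) := hpoly
    _ ≤ (2 - δ) * ((1 - 35 / 32 * δ) * Real.exp (t * c - δ * Real.log t)) := by gcongr
    _ = _ := by ring

theorem isCM_rpow_div_one_add_rpow (hb1 : 3 / 2 < b) (hb2 : b < 2) :
    IsCM fun x => x ^ (1 - b) / (1 + x ^ b) := by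
  refine isCM_of_le_cutLaplace hb1 hb2 fun t ht => ?_
  have hb0 : 0 < b := by linarith
  rcases le_total (Real.sin (π / b) * t) π with h | h
  · exact le_cutLaplace_of_mul_le_pi hb1 hb2 ht h
  rcases le_total t 4 with h4 | h4
  · refine le_trans ?_ (cutLaplace_nonneg hb1 hb2 t)
    exact mul_nonpos_of_nonneg_of_nonpos (by positivity) (mul_nonpos_of_nonneg_of_nonpos
      (Real.exp_pos _).le (cos_nonpos_of_pi_le_mul hb1 hb2 h h4))
  · refine le_trans ?_ ((exp_neg_mul_le_rpow hb1 hb2 h4).trans (rpow_mul_le_cutLaplace hb1 hb2 h4))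
    gcongr
    exact mul_le_of_le_one_right (Real.exp_pos _).le (Real.cos_le_one _)

end CutLaplaceBounds

section Pushforward

open Set Filter Topology
open scoped ENNReal

theorem lintegral_comp_abs (f : ℝ → ℝ≥0∞) : ∫⁻ t, f |t| = 2 * ∫⁻ t in Ioi 0, f t := by
  have h1 : ∫⁻ t in Ioi 0, f |t| = ∫⁻ t in Ioi 0, f t :=
    setLIntegral_congr_fun measurableSet_Ioi fun t ht => by rw [abs_of_pos ht]
  have h2 : ∫⁻ t in Iic 0, f |t| = ∫⁻ t in Ioi 0, f t := by
    rw [setLIntegral_congr Iio_ae_eq_Iic.symm, ← h1]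
    have := (Measure.measurePreserving_neg (volume : Measure ℝ)).setLIntegral_comp_preimage_emb
      (MeasurableEquiv.neg ℝ).measurableEmbedding (fun t => f |t|) (Ioi 0)
    simpa using this
  rw [← lintegral_add_compl (fun t => f |t|) (measurableSet_Ioi (a := (0 : ℝ))), compl_Ioi, h1, h2,
    two_mul]

theorem lintegral_Ioi_comp_rpow (f : ℝ → ℝ≥0∞) {r : ℝ} (hr : r ≠ 0) :
    ∫⁻ t in Ioi 0, f t = ∫⁻ x in Ioi 0, ENNReal.ofReal (|r| * x ^ (r - 1)) * f (x ^ r) := by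
  have himg : (fun x : ℝ => x ^ r) '' Ioi 0 = Ioi 0 := by
    ext y
    constructor
    · rintro ⟨x, hx, rfl⟩
      exact Real.rpow_pos_of_pos hx r
    · intro hy
      exact ⟨y ^ r⁻¹, Real.rpow_pos_of_pos hy _, Real.rpow_inv_rpow (le_of_lt hy) hr⟩
  have hinj : InjOn (fun x : ℝ => x ^ r) (Ioi 0) := fun x hx y hy h => by
    have := congrArg (fun z : ℝ => z ^ r⁻¹) h
    simpa only [Real.rpow_rpow_inv (le_of_lt hx) hr, Real.rpow_rpow_inv (le_of_lt hy) hr] using this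
  have h := lintegral_image_eq_lintegral_abs_deriv_mul measurableSet_Ioi
    (fun x hx => (Real.hasDerivAt_rpow_const (p := r) (Or.inl (ne_of_gt hx))).hasDerivWithinAt)
    hinj f
  rw [himg] at h
  rw [h]
  refine setLIntegral_congr_fun measurableSet_Ioi fun x hx => ?_
  rw [abs_mul, abs_of_pos (Real.rpow_pos_of_pos hx (r - 1))]

theorem lintegral_one_add_rpow_inv {α : ℝ} (hα : 1 < α) :
    ∫⁻ t in Ioi 0, ENNReal.ofReal ((1 + t ^ α)⁻¹) =
      ENNReal.ofReal (π / (α * Real.sin (π / α))) := by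
  have hα0 : 0 < α := by linarith
  have hα1 : 1 / α < 1 := (div_lt_one hα0).2 hα
  have h1 : ∀ y : ℝ, 0 < y → ENNReal.ofReal y⁻¹ =
      ∫⁻ s in Ioi 0, ENNReal.ofReal (Real.exp (-(s * y))) := fun y hy => by
    have h := integral_exp_neg_mul_cos hy 0 0
    simp only [zero_mul, add_zero, Real.cos_zero, mul_one, sub_zero] at h
    rw [← ofReal_integral_eq_lintegral_ofReal h.1 (ae_of_all _ fun s => (Real.exp_pos _).le), h.2]
    congr 1
    field_simp
    ring
  have h2 : ∀ s : ℝ, 0 < s → ∫⁻ t in Ioi 0, ENNReal.ofReal (Real.exp (-(s * (1 + t ^ α)))) =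
      ENNReal.ofReal (Real.Gamma (1 / α + 1) * (s ^ ((1 - 1 / α) - 1) * Real.exp (-(s * 1)))) :=
    fun s hs => by
      have hi : IntegrableOn (fun t : ℝ => Real.exp (-s * t ^ α)) (Ioi 0) := by
        simpa using integrableOn_rpow_mul_exp_neg_mul_rpow (s := 0) (by norm_num) hα0 hs
      have e : (fun t : ℝ => Real.exp (-(s * (1 + t ^ α)))) =
          fun t => Real.exp (-(s * 1)) * Real.exp (-s * t ^ α) := by
        funext t
        rw [← Real.exp_add]; ring_nf
      rw [← ofReal_integral_eq_lintegral_ofReal (e ▸ hi.const_mul _)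
        (ae_of_all _ fun t => (Real.exp_pos _).le), e, integral_const_mul,
        integral_exp_neg_mul_rpow hα0 hs]
      congr 1
      rw [show 1 - 1 / α - 1 = -1 / α by ring]
      ring
  have h3 : IntegrableOn (fun s : ℝ => Real.Gamma (1 / α + 1) *
      (s ^ ((1 - 1 / α) - 1) * Real.exp (-(s * 1)))) (Ioi 0) :=
    (integrableOn_rpow_mul_exp_neg_mul (by linarith) one_pos).const_mul _
  have h4 : ∫ s in Ioi (0 : ℝ), s ^ ((1 - 1 / α) - 1) * Real.exp (-(s * 1)) =
      Real.Gamma (1 - 1 / α) := by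
    rw [Real.Gamma_eq_integral (by linarith)]
    refine setIntegral_congr_fun measurableSet_Ioi fun s _ => ?_
    simp only [mul_one]
    ring
  calc ∫⁻ t in Ioi 0, ENNReal.ofReal ((1 + t ^ α)⁻¹)
      = ∫⁻ t in Ioi 0, ∫⁻ s in Ioi 0, ENNReal.ofReal (Real.exp (-(s * (1 + t ^ α)))) :=
        setLIntegral_congr_fun measurableSet_Ioi fun t ht => h1 _ (by
          have := Real.rpow_pos_of_pos ht α
          positivity)
    _ = ∫⁻ s in Ioi 0, ∫⁻ t in Ioi 0, ENNReal.ofReal (Real.exp (-(s * (1 + t ^ α)))) :=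
        lintegral_lintegral_swap (Measurable.aemeasurable (by fun_prop))
    _ = ∫⁻ s in Ioi 0, ENNReal.ofReal (Real.Gamma (1 / α + 1) *
          (s ^ ((1 - 1 / α) - 1) * Real.exp (-(s * 1)))) :=
        setLIntegral_congr_fun measurableSet_Ioi h2
    _ = _ := by
        have hG := Real.Gamma_mul_Gamma_one_sub (1 / α)
        rw [← ofReal_integral_eq_lintegral_ofReal h3, integral_const_mul, h4,
          Real.Gamma_add_one (by positivity), mul_assoc, hG, mul_one_div, one_div_mul_eq_div,
          div_div, mul_comm α]
        filter_upwards [ae_restrict_mem measurableSet_Ioi] with s hs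
        have hs : 0 < s := hs
        have := Real.Gamma_pos_of_pos (s := 1 / α + 1) (by positivity)
        positivity

theorem alphaCauchy_univ {α : ℝ} (hα : 1 < α) : alphaCauchy α univ = 1 := by
  have hα0 : 0 < α := by linarith
  have hs : 0 < Real.sin (π / α) :=
    Real.sin_pos_of_pos_of_lt_pi (by positivity) (div_lt_self pi_pos hα)
  have hpi := pi_pos
  rw [alphaCauchy, withDensity_apply _ MeasurableSet.univ, Measure.restrict_univ,
    lintegral_comp_abs fun t => ENNReal.ofReal (α * Real.sin (π / α) / (2 * π) * (1 + t ^ α)⁻¹)]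
  simp_rw [ENNReal.ofReal_mul (show 0 ≤ α * Real.sin (π / α) / (2 * π) by positivity)]
  rw [lintegral_const_mul _ (by fun_prop), lintegral_one_add_rpow_inv hα,
    ← ENNReal.ofReal_mul (by positivity), show (2 : ℝ≥0∞) = ENNReal.ofReal 2 by simp,
    ← ENNReal.ofReal_mul (by positivity), ← ENNReal.ofReal_one]
  congr 1
  field_simp

theorem map_abs_rpow_alphaCauchy {α : ℝ} (hα : 1 < α) {r : ℝ} (hr : r ≠ 0) :
    Measure.map (fun t : ℝ => |t| ^ r) (alphaCauchy α) =
      (volume.restrict (Ioi 0)).withDensity fun x => ENNReal.ofReal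
        (α * Real.sin (π / α) / π * |r⁻¹| * (x ^ (r⁻¹ - 1) / (1 + x ^ (r⁻¹ * α)))) := by
  have hα0 : 0 < α := by linarith
  have hs : 0 < Real.sin (π / α) :=
    Real.sin_pos_of_pos_of_lt_pi (by positivity) (div_lt_self pi_pos hα)
  have hpi := pi_pos
  have hm : Measurable fun t : ℝ => |t| ^ r := by fun_prop
  ext A hA
  rw [Measure.map_apply hm hA, alphaCauchy, withDensity_apply _ (hm hA), withDensity_apply _ hA,
    ← lintegral_indicator (hm hA), ← lintegral_indicator hA]
  let G : ℝ → ℝ≥0∞ := fun y => A.indicator (fun _ =>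
    ENNReal.ofReal (α * Real.sin (π / α) / (2 * π) * (1 + y ^ α)⁻¹)) (y ^ r)
  have e : (fun t : ℝ => ((fun t : ℝ => |t| ^ r) ⁻¹' A).indicator (fun t =>
      ENNReal.ofReal (α * Real.sin (π / α) / (2 * π) * (1 + |t| ^ α)⁻¹)) t) = fun t => G |t| := by
    funext t
    by_cases h : |t| ^ r ∈ A
    · simp [G, h]
    · simp [G, h]
  rw [e, lintegral_comp_abs G, lintegral_Ioi_comp_rpow G (inv_ne_zero hr),
    ← lintegral_const_mul' _ _ (by simp)]
  refine setLIntegral_congr_fun measurableSet_Ioi fun x hx => ?_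
  have hx : 0 < x := hx
  by_cases h : x ∈ A
  · simp only [G, Real.rpow_inv_rpow hx.le hr, indicator_of_mem h]
    rw [show (2 : ℝ≥0∞) = ENNReal.ofReal 2 by simp, ← ENNReal.ofReal_mul (by positivity),
      ← ENNReal.ofReal_mul (by positivity), ← Real.rpow_mul hx.le]
    congr 1
    field_simp
  · simp only [G, Real.rpow_inv_rpow hx.le hr, indicator_of_notMem h, mul_zero]

theorem isInfinitelyDivisible_map_abs_rpow_alphaCauchy {α : ℝ} (hα : 1 < α) {r : ℝ} (hr : r ≠ 0)
    {a b : ℝ} (ha : 0 < a) (hab : a < b)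
    (hdens : ∀ x : ℝ, 0 < x → x ^ (r⁻¹ - 1) / (1 + x ^ (r⁻¹ * α)) = x ^ (a - 1) / (1 + x ^ b))
    (hCM : IsCM fun x => x ^ (a - 2) / (1 + x ^ b)) :
    IsInfinitelyDivisible (Measure.map (fun t : ℝ => |t| ^ r) (alphaCauchy α)) := by
  have hα0 : 0 < α := by linarith
  have hpi := pi_pos
  have hs : 0 < Real.sin (π / α) :=
    Real.sin_pos_of_pos_of_lt_pi (by positivity) (div_lt_self pi_pos hα)
  set K := α * Real.sin (π / α) / π * |r⁻¹| with hK
  have hK0 : 0 < K := by have := abs_pos.2 (inv_ne_zero hr); positivity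
  have hxg : ∀ x : ℝ, 0 < x → x * (K * (x ^ (a - 2) / (1 + x ^ b))) =
      K * (x ^ (a - 1) / (1 + x ^ b)) := fun x hx => by
    rw [show a - 1 = a - 2 + 1 by ring, Real.rpow_add_one hx.ne']; ring
  have hmap := map_abs_rpow_alphaCauchy hα hr
  have hd : (volume.restrict (Ioi 0)).withDensity (fun x => ENNReal.ofReal
      (K * (x ^ (r⁻¹ - 1) / (1 + x ^ (r⁻¹ * α))))) = (volume.restrict (Ioi 0)).withDensity
      fun x => ENNReal.ofReal (x * (K * (x ^ (a - 2) / (1 + x ^ b)))) := by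
    refine withDensity_congr_ae ?_
    filter_upwards [ae_restrict_mem measurableSet_Ioi] with x hx
    rw [hdens x hx, hxg x hx]
  have hmass : ∫⁻ x in Ioi (0 : ℝ), ENNReal.ofReal (x * (K * (x ^ (a - 2) / (1 + x ^ b)))) = 1 := by
    rw [← setLIntegral_univ, ← withDensity_apply _ MeasurableSet.univ, ← hd, ← hmap,
      Measure.map_apply (by fun_prop) MeasurableSet.univ, preimage_univ, alphaCauchy_univ hα]
  rw [hmap, hd]
  refine isInfinitelyDivisible_withDensity_of_isCM
    (F := fun x => K * ((x ^ (a - 1) + (x + 1) ^ (a - 1)) / (1 + x ^ b)))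
    (hCM.const_mul hK0.le) (fun x hx => by positivity) ?_ (Integrable.const_mul ?_ K) ?_ ?_
  · refine continuousOn_const.mul (ContinuousOn.div ?_ ?_ fun x hx => ?_)
    · exact continuousOn_id.rpow_const fun x hx => Or.inl (ne_of_gt hx)
    · exact continuousOn_const.add (continuousOn_id.rpow_const fun x hx => Or.inl (ne_of_gt hx))
    · have := Real.rpow_pos_of_pos hx b
      positivity
  · have hm : Measurable fun x : ℝ => (x ^ (a - 1) + (x + 1) ^ (a - 1)) / (1 + x ^ b) := by fun_prop
    change IntegrableOn _ _ _
    rw [← Ioc_union_Ioi_eq_Ioi zero_le_one]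
    refine IntegrableOn.union
      (Integrable.mono' (g := fun x : ℝ => x ^ (a - 1) + (1 + 2 ^ (a - 1))) ?_
        hm.aestronglyMeasurable ?_)
      (Integrable.mono' (g := fun x : ℝ => (2 + 2 ^ (a - 1)) * x ^ (a - 1 - b)) ?_
        hm.aestronglyMeasurable ?_)
    · refine Integrable.add ?_ (integrable_const _)
      exact (intervalIntegrable_iff_integrableOn_Ioc_of_le zero_le_one).1
        (intervalIntegral.intervalIntegrable_rpow' (by linarith))
    · filter_upwards [ae_restrict_mem measurableSet_Ioc] with x hx
      have hx0 : 0 < x := hx.1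
      have h1 := Real.rpow_pos_of_pos hx0 b
      have h2 := Real.rpow_pos_of_pos hx0 (a - 1)
      have h3 := Real.rpow_pos_of_pos (show 0 < x + 1 by linarith) (a - 1)
      rw [Real.norm_of_nonneg (by positivity)]
      have h4 : (x + 1) ^ (a - 1) ≤ 1 + 2 ^ (a - 1) := by
        rcases le_total (a - 1) 0 with h | h
        · have := Real.rpow_le_one_of_one_le_of_nonpos (show 1 ≤ x + 1 by linarith) h
          have := Real.rpow_pos_of_pos (show (0 : ℝ) < 2 by norm_num) (a - 1)
          linarith
        · have := Real.rpow_le_rpow (show 0 ≤ x + 1 by linarith)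
            (show x + 1 ≤ 2 by linarith [hx.2]) h
          linarith
      exact (div_le_self (by positivity) (by linarith)).trans (by linarith)
    · exact (integrableOn_Ioi_rpow_of_lt (by linarith) one_pos).const_mul _
    · filter_upwards [ae_restrict_mem measurableSet_Ioi] with x hx
      have hx1 : 1 < x := hx
      have hx0 : 0 < x := one_pos.trans hx1
      have h1 := Real.rpow_pos_of_pos hx0 b
      have h2 := Real.rpow_pos_of_pos hx0 (a - 1)
      have h3 := Real.rpow_pos_of_pos (show 0 < x + 1 by linarith) (a - 1)
      have h5 := Real.rpow_pos_of_pos (show (0 : ℝ) < 2 by norm_num) (a - 1)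
      rw [Real.norm_of_nonneg (by positivity), Real.rpow_sub hx0 (a - 1) b, ← mul_div_assoc]
      have h4 : (x + 1) ^ (a - 1) ≤ (1 + 2 ^ (a - 1)) * x ^ (a - 1) := by
        rcases le_total (a - 1) 0 with h | h
        · have := Real.rpow_le_rpow_of_nonpos hx0 (show x ≤ x + 1 by linarith) h
          nlinarith
        · have := Real.rpow_le_rpow (show 0 ≤ x + 1 by linarith)
            (show x + 1 ≤ 2 * x by linarith) h
          rw [Real.mul_rpow zero_le_two hx0.le] at this
          nlinarith
      exact div_le_div₀ (by positivity) (by linarith) h1 (by linarith)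
  · intro x hx y hy
    have hx : 0 < x := hx
    have hxy : x ≤ y := hy.1
    have hy0 : 0 < y := hx.trans_le hxy
    have h1 := Real.rpow_pos_of_pos hx b
    have h2 := Real.rpow_pos_of_pos hx (a - 1)
    have h3 := Real.rpow_pos_of_pos (show 0 < x + 1 by linarith) (a - 1)
    have h5 := Real.rpow_le_rpow hx.le hxy (show 0 ≤ b by linarith)
    have h4 : y ^ (a - 1) ≤ x ^ (a - 1) + (x + 1) ^ (a - 1) := by
      rcases le_total (a - 1) 0 with h | h
      · linarith [Real.rpow_le_rpow_of_nonpos hx hxy h]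
      · linarith [Real.rpow_le_rpow hy0.le hy.2 h]
    rw [hxg y hy0]
    exact mul_le_mul_of_nonneg_left
      (div_le_div₀ (by positivity) h4 (by positivity) (by linarith)) hK0.le
  · rw [integral_eq_lintegral_of_nonneg_ae, hmass, ENNReal.toReal_one]
    · filter_upwards [ae_restrict_mem measurableSet_Ioi] with x hx
      have hx : 0 < x := hx
      positivity
    · exact Measurable.aestronglyMeasurable (by fun_prop)

end Pushforward

theorem abs_alphaCauchy_rpow_infinitelyDivisible (α p ε : ℝ) (hα : 1 < α) (hp : 0 < p)
    (hε : ε = 1 ∨ ε = -1)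
    (h : (ε = 1 ∧ 1 < α ∧ α ≤ 2 ∧ (α + 1) / 3 ≤ p) ∨
         (ε = 1 ∧ 2 < α ∧ α / 2 ≤ p) ∨
         (ε = -1 ∧ 1 < α ∧ α ≤ 2 ∧ α / 2 ≤ p) ∨
         (ε = -1 ∧ 2 < α ∧ (2 * α - 1) / 3 ≤ p)) :
    IsInfinitelyDivisible (Measure.map (fun t : ℝ => |t| ^ (ε * p)) (alphaCauchy α)) := by
  have hα0 : 0 < α := by linarith
  have hpos : (IsCM fun x => x ^ (1 / p - 2) / (1 + x ^ (α / p))) →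
      IsInfinitelyDivisible (Measure.map (fun t : ℝ => |t| ^ (1 * p)) (alphaCauchy α)) := fun hCM =>
    isInfinitelyDivisible_map_abs_rpow_alphaCauchy hα (by positivity) (by positivity)
      (div_lt_div_of_pos_right hα hp)
      (fun x _ => by rw [one_mul, inv_eq_one_div, one_div_mul_eq_div]) hCM
  have hneg : (IsCM fun x => x ^ ((α - 1) / p - 2) / (1 + x ^ (α / p))) →
      IsInfinitelyDivisible (Measure.map (fun t : ℝ => |t| ^ (-1 * p)) (alphaCauchy α)) := fun hCM => by
    refine isInfinitelyDivisible_map_abs_rpow_alphaCauchy hα (by simpa using hp.ne')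
      (div_pos (by linarith) hp) (div_lt_div_of_pos_right (by linarith) hp) (fun x hx => ?_) hCM
    have h1 := Real.rpow_pos_of_pos hx (α / p)
    rw [show (α - 1) / p - 1 = α / p + ((-1 * p)⁻¹ - 1) by field_simp; ring, Real.rpow_add hx,
      show (-1 * p)⁻¹ * α = -(α / p) by field_simp, Real.rpow_neg hx.le]
    field_simp
    ring
  rcases h with ⟨rfl, -, hα2, hp0⟩ | ⟨rfl, hα2, hp0⟩ | ⟨rfl, -, hα2, hp0⟩ | ⟨rfl, hα2, hp0⟩
  · apply hpos
    have hCM : IsCM fun x => x ^ (3 / (α + 1) - 2) / (1 + x ^ (3 * α / (α + 1))) := by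
      rcases hα2.eq_or_lt with rfl | hα2
      · have := IsCM.rpow_div_one_add_sq (a := 1) le_rfl
        norm_num at this ⊢
        exact this
      · have := isCM_rpow_div_one_add_rpow (b := 3 * α / (α + 1))
          (by rw [lt_div_iff₀ (by linarith)]; linarith) (by rw [div_lt_iff₀ (by linarith)]; linarith)
        rwa [show 3 / (α + 1) - 2 = 1 - 3 * α / (α + 1) by field_simp; ring]
    have := hCM.rpow_div_one_add_rpow_of_le (q := p / ((α + 1) / 3))
      ((one_le_div (by linarith)).2 hp0)
    rwa [show 3 / (α + 1) / (p / ((α + 1) / 3)) = 1 / p by field_simp,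
      show 3 * α / (α + 1) / (p / ((α + 1) / 3)) = α / p by field_simp] at this
  · apply hpos
    have := (IsCM.rpow_div_one_add_sq (a := 2 / α)
      ((div_le_one hα0).2 hα2.le)).rpow_div_one_add_rpow_of_le (q := p / (α / 2))
      ((one_le_div (by linarith)).2 hp0)
    rwa [show 2 / α / (p / (α / 2)) = 1 / p by field_simp,
      show 2 / (p / (α / 2)) = α / p by field_simp] at this
  · apply hneg
    have := (IsCM.rpow_div_one_add_sq (a := 2 * (α - 1) / α)
      ((div_le_one hα0).2 (by linarith))).rpow_div_one_add_rpow_of_le (q := p / (α / 2))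
      ((one_le_div (by linarith)).2 hp0)
    rwa [show 2 * (α - 1) / α / (p / (α / 2)) = (α - 1) / p by field_simp,
      show 2 / (p / (α / 2)) = α / p by field_simp] at this
  · apply hneg
    have h0 : 0 < 2 * α - 1 := by linarith
    have h0ne : α * 2 - 1 ≠ 0 := (by linarith : 0 < α * 2 - 1).ne'
    have hCM := isCM_rpow_div_one_add_rpow (b := 3 * α / (2 * α - 1))
      (by rw [lt_div_iff₀ h0]; linarith) (by rw [div_lt_iff₀ h0]; linarith)
    rw [show 1 - 3 * α / (2 * α - 1) = 3 * (α - 1) / (2 * α - 1) - 2 by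
      field_simp; ring] at hCM
    have := hCM.rpow_div_one_add_rpow_of_le (q := p / ((2 * α - 1) / 3))
      ((one_le_div (by linarith)).2 hp0)
    rwa [show 3 * (α - 1) / (2 * α - 1) / (p / ((2 * α - 1) / 3)) = (α - 1) / p by field_simp,
      show 3 * α / (2 * α - 1) / (p / ((2 * α - 1) / 3)) = α / p by field_simp] at this
end

section
/- As α → ∞, the law of |C_α| (the pushforward of the α-Cauchy distribution under t ↦ |t|) converges weakly to the uniform distribution on (0,1), and the α-Cauchy distribution itself converges weakly to the uniform distribution on (−1,1). -/
open MeasureTheory Real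
open scoped ENNReal

open Filter Topology Set

lemma tendsto_mul_sin_pi_div_atTop :
    Tendsto (fun α : ℝ => α * Real.sin (π / α) / (2 * π)) atTop (𝓝 2⁻¹) := by
  have hs : Tendsto (fun α : ℝ => Real.sinc (π / α) * 2⁻¹) atTop (𝓝 2⁻¹) := by
    have h := (Real.continuous_sinc.tendsto 0).comp
      (tendsto_const_nhds.div_atTop tendsto_id : Tendsto (fun α : ℝ => π / α) atTop (𝓝 0))
    simpa [Function.comp_def] using h.mul_const (2⁻¹ : ℝ)
  refine hs.congr' ?_
  filter_upwards [eventually_gt_atTop 0] with α hα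
  rw [Real.sinc_of_ne_zero (by positivity)]
  field_simp

lemma mul_sin_pi_div_nonneg {α : ℝ} (hα : 2 ≤ α) : 0 ≤ α * Real.sin (π / α) / (2 * π) := by
  have : 0 ≤ Real.sin (π / α) :=
    Real.sin_nonneg_of_nonneg_of_le_pi (by positivity) (div_le_self pi_pos.le (by linarith))
  positivity

lemma mul_sin_pi_div_le {α : ℝ} (hα : 2 ≤ α) : α * Real.sin (π / α) / (2 * π) ≤ 2⁻¹ := by
  have hα0 : 0 < α := by linarith
  have : α * Real.sin (π / α) ≤ α * (π / α) :=
    mul_le_mul_of_nonneg_left (Real.sin_le (by positivity)) hα0.le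
  rw [mul_div_cancel₀ _ hα0.ne'] at this
  rw [div_le_iff₀ (by positivity)]
  linarith

lemma inv_one_add_abs_rpow_le {α : ℝ} (hα : 2 ≤ α) (t : ℝ) :
    (1 + |t| ^ α)⁻¹ ≤ 2 * (1 + t ^ 2)⁻¹ := by
  have hp : 0 ≤ |t| ^ α := by positivity
  rw [← div_eq_mul_inv, inv_eq_one_div, div_le_div_iff₀ (by positivity) (by positivity)]
  rcases le_total |t| 1 with ht | ht
  · have : t ^ 2 ≤ 1 := by rwa [sq_le_one_iff_abs_le_one]
    linarith
  · have : t ^ 2 ≤ |t| ^ α := by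
      have h := Real.rpow_le_rpow_of_exponent_le ht hα
      rwa [Real.rpow_two, sq_abs] at h
    linarith

lemma tendsto_inv_one_add_abs_rpow {t : ℝ} (ht : |t| ≠ 1) :
    Tendsto (fun α : ℝ => (1 + |t| ^ α)⁻¹) atTop (𝓝 ((Ioo (-1 : ℝ) 1).indicator 1 t)) := by
  rcases lt_or_gt_of_ne ht with h | h
  · rw [indicator_of_mem (by simpa [abs_lt] using h)]
    have h0 := tendsto_rpow_atTop_of_base_lt_one |t| (by linarith [abs_nonneg t]) h
    simpa using (h0.const_add 1).inv₀ (by norm_num)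
  · rw [indicator_of_notMem (by rw [mem_Ioo, ← abs_lt]; exact h.not_gt)]
    exact (tendsto_atTop_add_const_left _ 1
      (tendsto_rpow_atTop_of_base_gt_one |t| h)).inv_tendsto_atTop

lemma integral_alphaCauchy {α : ℝ} (hα : 2 ≤ α) (f : ℝ → ℝ) :
    ∫ t, f t ∂(alphaCauchy α) =
      ∫ t, α * Real.sin (π / α) / (2 * π) * (1 + |t| ^ α)⁻¹ * f t := by
  rw [alphaCauchy, integral_withDensity_eq_integral_toReal_smul (by fun_prop)
    (ae_of_all _ fun _ => ENNReal.ofReal_lt_top)]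
  refine integral_congr_ae (ae_of_all _ fun t => ?_)
  have := mul_sin_pi_div_nonneg hα
  simp only [smul_eq_mul]
  rw [ENNReal.toReal_ofReal (by positivity)]

lemma tendsto_integral_alphaCauchy (f : BoundedContinuousFunction ℝ ℝ) :
    Tendsto (fun α : ℝ => ∫ t, f t ∂(alphaCauchy α)) atTop
      (𝓝 (∫ t, f t ∂((2 : ℝ≥0∞)⁻¹ • volume.restrict (Ioo (-1 : ℝ) 1)))) := by
  have hlim : ∫ t, f t ∂((2 : ℝ≥0∞)⁻¹ • volume.restrict (Ioo (-1 : ℝ) 1)) =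
      ∫ t, 2⁻¹ * (Ioo (-1 : ℝ) 1).indicator 1 t * f t := by
    rw [integral_smul_measure, ← integral_indicator measurableSet_Ioo, ← integral_smul]
    refine integral_congr_ae (ae_of_all _ fun t => ?_)
    by_cases ht : t ∈ Ioo (-1 : ℝ) 1 <;> simp [ht, indicator]
  rw [hlim]
  have hcongr : (fun α : ℝ => ∫ t, α * Real.sin (π / α) / (2 * π) * (1 + |t| ^ α)⁻¹ * f t)
      =ᶠ[atTop] fun α : ℝ => ∫ t, f t ∂(alphaCauchy α) := by
    filter_upwards [eventually_ge_atTop 2] with α hα using (integral_alphaCauchy hα f).symm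
  refine Tendsto.congr' hcongr ?_
  refine tendsto_integral_filter_of_dominated_convergence
    (fun t => 2⁻¹ * (2 * (1 + t ^ 2)⁻¹) * ‖f‖) ?_ ?_ ?_ ?_
  · exact Eventually.of_forall fun α => (by fun_prop : Measurable _).aestronglyMeasurable
  · filter_upwards [eventually_ge_atTop 2] with α hα
    refine ae_of_all _ fun t => ?_
    have hc := mul_sin_pi_div_nonneg hα
    rw [norm_mul, Real.norm_of_nonneg (by positivity)]
    gcongr
    · exact mul_sin_pi_div_le hα
    · exact inv_one_add_abs_rpow_le hα t
    · exact f.norm_coe_le_norm t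
  · exact ((integrable_inv_one_add_sq.const_mul 2).const_mul _).mul_const _
  · have hae : ∀ᵐ t : ℝ, t ∉ ({1, -1} : Set ℝ) :=
      measure_eq_zero_iff_ae_notMem.1 ((toFinite _).measure_zero _)
    filter_upwards [hae] with t ht
    have ht' : |t| ≠ 1 := by
      rw [Ne, abs_eq zero_le_one]
      simpa using ht
    exact (tendsto_mul_sin_pi_div_atTop.mul (tendsto_inv_one_add_abs_rpow ht')).mul_const _

lemma integral_comp_abs_uniform (f : ℝ → ℝ) :
    ∫ t, f |t| ∂((2 : ℝ≥0∞)⁻¹ • volume.restrict (Ioo (-1 : ℝ) 1)) =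
      ∫ t, f t ∂(volume.restrict (Ioo (0 : ℝ) 1)) := by
  have h := integral_comp_abs (f := (Iio (1 : ℝ)).indicator f)
  rw [setIntegral_indicator measurableSet_Iio, Ioi_inter_Iio] at h
  rw [integral_smul_measure, ← integral_indicator measurableSet_Ioo]
  have : ∀ t : ℝ, (Ioo (-1 : ℝ) 1).indicator (fun t => f |t|) t =
      (Iio (1 : ℝ)).indicator f |t| := fun t => by
    simp only [indicator, mem_Ioo, mem_Iio, abs_lt]
  simp_rw [this, h]
  simp

/-- As `α → ∞`, the law of `|C_α|` converges weakly to the uniform distribution on `(0,1)`,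
and the `α`-Cauchy distribution converges weakly to the uniform distribution on `(−1,1)`. -/
theorem alphaCauchy_tendsto_uniform :
    (∀ f : BoundedContinuousFunction ℝ ℝ,
      Filter.Tendsto
        (fun α : ℝ => ∫ t, f t ∂(Measure.map (fun t : ℝ => |t|) (alphaCauchy α)))
        Filter.atTop
        (nhds (∫ t, f t ∂(volume.restrict (Set.Ioo (0 : ℝ) 1))))) ∧
    (∀ f : BoundedContinuousFunction ℝ ℝ,
      Filter.Tendsto (fun α : ℝ => ∫ t, f t ∂(alphaCauchy α)) Filter.atTop
        (nhds (∫ t, f t ∂((2 : ℝ≥0∞)⁻¹ • volume.restrict (Set.Ioo (-1 : ℝ) 1))))) := by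
  refine ⟨fun f => ?_, tendsto_integral_alphaCauchy⟩
  have h := tendsto_integral_alphaCauchy
    (f.compContinuous ⟨fun t : ℝ => |t|, continuous_abs⟩)
  simp only [BoundedContinuousFunction.compContinuous_apply, ContinuousMap.coe_mk] at h
  rw [integral_comp_abs_uniform] at h
  refine h.congr fun α => ?_
  rw [integral_map continuous_abs.aemeasurable f.continuous.aestronglyMeasurable]
end

section
/- Let α > 1, and let G₁ and G₂ be independent random variables where G₁ has the Gamma distribution with shape 1/α and G₂ has the Gamma distribution with shape 1 − 1/α. Then the random variable G₁^{1/α} · G₂^{−1/α} has the half α-Cauchy distribution, i.e. its law has density (α·sin(π/α)/π)·(1+t^α)^{−1} on (0,∞). -/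
open MeasureTheory Real

/-- The Gamma distribution with shape `c` (and rate 1): density `x^{c−1}e^{−x}/Γ(c)`
on `(0,∞)`. -/
noncomputable def gammaDist (c : ℝ) : Measure ℝ :=
  (volume.restrict (Set.Ioi (0 : ℝ))).withDensity
    fun x => ENNReal.ofReal (x ^ (c - 1) * Real.exp (-x) / Real.Gamma c)

open Set in
lemma gammaDist_ne_zero {c : ℝ} (hc : 0 < c) : gammaDist c ≠ 0 := by
  intro h
  rw [gammaDist, withDensity_eq_zero_iff (by fun_prop)] at h
  have h0 : ∀ᵐ x : ℝ ∂(volume.restrict (Ioi 0)), False := by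
    filter_upwards [h, ae_restrict_mem measurableSet_Ioi] with x hx hx0
    have hx0 : 0 < x := hx0
    have hΓ := Gamma_pos_of_pos hc
    have : 0 < x ^ (c - 1) * Real.exp (-x) / Gamma c := by positivity
    simp only [Pi.zero_apply, ENNReal.ofReal_eq_zero] at hx
    linarith
  rw [ae_iff] at h0
  simp at h0

instance (c : ℝ) : SFinite (gammaDist c) := by
  unfold gammaDist
  infer_instance

lemma lintegral_gammaDist (c : ℝ) {f : ℝ → ENNReal} (hf : Measurable f) :
    ∫⁻ x, f x ∂gammaDist c =
      ∫⁻ x in Set.Ioi 0, ENNReal.ofReal (x ^ (c - 1) * Real.exp (-x) / Gamma c) * f x := by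
  rw [gammaDist, lintegral_withDensity_eq_lintegral_mul _ (by fun_prop) hf]
  rfl

/-- The change of variables `x = y * t ^ α` on the positive half-line. -/
lemma lintegral_Ioi_comp_mul_rpow {α y : ℝ} (hα : 0 < α) (hy : 0 < y) (f : ℝ → ENNReal) :
    ∫⁻ x in Set.Ioi 0, f x =
      ∫⁻ t in Set.Ioi 0, ENNReal.ofReal (y * (α * t ^ (α - 1))) * f (y * t ^ α) := by
  have himage : (fun t : ℝ => y * t ^ α) '' Set.Ioi 0 = Set.Ioi 0 := by
    ext x
    constructor
    · rintro ⟨t, ht, rfl⟩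
      exact mul_pos hy (rpow_pos_of_pos ht _)
    · intro hx
      have hxy : 0 < x / y := div_pos hx hy
      refine ⟨(x / y) ^ α⁻¹, rpow_pos_of_pos hxy _, ?_⟩
      simp only
      rw [rpow_inv_rpow hxy.le hα.ne']
      field_simp
  have hinj : Set.InjOn (fun t : ℝ => y * t ^ α) (Set.Ioi 0) := by
    intro s hs t ht hst
    exact (rpow_left_inj hs.le ht.le hα.ne').1 (mul_left_cancel₀ hy.ne' hst)
  have hderiv : ∀ t ∈ Set.Ioi (0 : ℝ), HasDerivWithinAt (fun t : ℝ => y * t ^ α)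
      (y * (α * t ^ (α - 1))) (Set.Ioi 0) t := fun t ht =>
    ((hasDerivAt_rpow_const (Or.inl (ne_of_gt ht))).const_mul y).hasDerivWithinAt
  have h := lintegral_image_eq_lintegral_abs_deriv_mul measurableSet_Ioi hderiv hinj f
  rw [himage] at h
  rw [h]
  refine setLIntegral_congr_fun measurableSet_Ioi fun t ht => ?_
  have ht : 0 < t := ht
  rw [abs_of_pos (by positivity)]

lemma lintegral_exp_neg_mul_Ioi {b : ℝ} (hb : 0 < b) :
    ∫⁻ y in Set.Ioi 0, ENNReal.ofReal (Real.exp (-(b * y))) = ENNReal.ofReal b⁻¹ := by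
  simp_rw [← neg_mul]
  rw [← ofReal_integral_eq_lintegral_ofReal (integrableOn_exp_mul_Ioi (neg_lt_zero.2 hb) 0)
    (ae_of_all _ fun y => (Real.exp_pos _).le), integral_exp_mul_Ioi (neg_lt_zero.2 hb)]
  simp [neg_div_neg_eq]

lemma gamma_densities_mul_jacobian {α y t : ℝ} (hα0 : 0 < α) (hy : 0 < y) (ht : 0 < t) :
    y ^ (1 - 1 / α - 1) * Real.exp (-y) / Gamma (1 - 1 / α) *
        (y * (α * t ^ (α - 1))) *
          ((y * t ^ α) ^ (1 / α - 1) * Real.exp (-(y * t ^ α)) / Gamma (1 / α)) =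
      α * Real.sin (π / α) / π * Real.exp (-((1 + t ^ α) * y)) := by
  have hrefl : Gamma (1 / α) * Gamma (1 - 1 / α) = π / Real.sin (π / α) := by
    rw [Gamma_mul_Gamma_one_sub, mul_one_div]
  have hconst : Real.sin (π / α) / π = (Gamma (1 / α) * Gamma (1 - 1 / α))⁻¹ := by
    rw [hrefl, inv_div]
  have hy_pow : y ^ (1 - 1 / α - 1) * (y * y ^ (1 / α - 1)) = 1 := by
    nth_rewrite 2 [← rpow_one y]
    rw [← rpow_add hy, ← rpow_add hy]
    ring_nf
    exact rpow_zero y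
  have ht_pow : t ^ (α - 1) * (t ^ α) ^ (1 / α - 1) = 1 := by
    rw [← rpow_mul ht.le, ← rpow_add ht]
    have : α - 1 + α * (1 / α - 1) = 0 := by field_simp; ring
    rw [this, rpow_zero]
  have hexp : Real.exp (-((1 + t ^ α) * y)) = Real.exp (-y) * Real.exp (-(y * t ^ α)) := by
    rw [← Real.exp_add]; ring_nf
  rw [mul_rpow hy.le (by positivity), hexp, mul_div_assoc α, hconst]
  calc _ = (y ^ (1 - 1 / α - 1) * (y * y ^ (1 / α - 1))) *
        (t ^ (α - 1) * (t ^ α) ^ (1 / α - 1)) *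
        (α * (Gamma (1 / α) * Gamma (1 - 1 / α))⁻¹ *
          (Real.exp (-y) * Real.exp (-(y * t ^ α)))) := by
        rw [mul_inv]; ring
    _ = _ := by rw [hy_pow, ht_pow]; ring

lemma lintegral_gammaDist_quotient_rpow {α : ℝ} (hα : 1 < α) {f : ℝ → ENNReal}
    (hf : Measurable f) :
    ∫⁻ y, ∫⁻ x, f (x ^ (1 / α) * y ^ (-(1 / α))) ∂gammaDist (1 / α) ∂gammaDist (1 - 1 / α) =
      ∫⁻ t in Set.Ioi 0,
        ENNReal.ofReal (α * Real.sin (π / α) / π * (1 + t ^ α)⁻¹) * f t := by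
  have hα0 : 0 < α := by linarith
  have hinv : 1 / α < 1 := by rw [div_lt_one hα0]; exact hα
  have hΓ₁ : 0 < Gamma (1 / α) := Gamma_pos_of_pos (by positivity)
  have hΓ₂ : 0 < Gamma (1 - 1 / α) := Gamma_pos_of_pos (by linarith)
  have hC : 0 ≤ α * Real.sin (π / α) / π := by
    have := sin_pos_of_pos_of_lt_pi (by positivity) (div_lt_self pi_pos hα)
    positivity
  have hinner : Measurable fun y : ℝ =>
      ∫⁻ x, f (x ^ (1 / α) * y ^ (-(1 / α))) ∂gammaDist (1 / α) :=
    Measurable.lintegral_prod_left' (f := fun p : ℝ × ℝ => f (p.1 ^ (1 / α) * p.2 ^ (-(1 / α))))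
      (by fun_prop)
  rw [lintegral_gammaDist _ hinner]
  calc _ = ∫⁻ y in Set.Ioi 0, ∫⁻ t in Set.Ioi 0,
        ENNReal.ofReal (α * Real.sin (π / α) / π) *
          ENNReal.ofReal (Real.exp (-((1 + t ^ α) * y))) * f t := by
        refine setLIntegral_congr_fun measurableSet_Ioi fun y hy => ?_
        have hy : 0 < y := hy
        rw [lintegral_gammaDist _ (by fun_prop), lintegral_Ioi_comp_mul_rpow hα0 hy,
          ← lintegral_const_mul _ (by fun_prop)]
        refine setLIntegral_congr_fun measurableSet_Ioi fun t ht => ?_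
        have ht : 0 < t := ht
        have harg : (y * t ^ α) ^ (1 / α) * y ^ (-(1 / α)) = t := by
          rw [mul_rpow hy.le (by positivity), ← rpow_mul ht.le, mul_one_div_cancel hα0.ne',
            rpow_one, mul_right_comm, ← rpow_add hy, add_neg_cancel, rpow_zero, one_mul]
        rw [harg, ← ENNReal.ofReal_mul hC, ← gamma_densities_mul_jacobian hα0 hy ht,
          ← mul_assoc, ← mul_assoc, ← ENNReal.ofReal_mul (by positivity),
          ← ENNReal.ofReal_mul (by positivity)]
    _ = ∫⁻ t in Set.Ioi 0, ∫⁻ y in Set.Ioi 0,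
        ENNReal.ofReal (α * Real.sin (π / α) / π) *
          ENNReal.ofReal (Real.exp (-((1 + t ^ α) * y))) * f t :=
        lintegral_lintegral_swap (Measurable.aemeasurable (by fun_prop))
    _ = _ := by
        refine setLIntegral_congr_fun measurableSet_Ioi fun t ht => ?_
        have ht : 0 < t := ht
        rw [lintegral_mul_const _ (by fun_prop), lintegral_const_mul _ (by fun_prop),
          lintegral_exp_neg_mul_Ioi (by positivity), ← ENNReal.ofReal_mul hC]

/-- If `G₁, G₂` are independent with Gamma distributions of shapes `1/α` and `1−1/α`,
then `G₁^{1/α} · G₂^{−1/α}` has the half `α`-Cauchy distribution, with density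
`α·sin(π/α)/π · (1+t^α)⁻¹` on `(0,∞)`. -/
theorem gamma_quotient_rpow_half_alphaCauchy (α : ℝ) (hα : 1 < α)
    {Ω : Type*} [MeasurableSpace Ω] (P : Measure Ω) [IsProbabilityMeasure P]
    (G₁ G₂ : Ω → ℝ) (hind : ProbabilityTheory.IndepFun G₁ G₂ P)
    (h₁ : Measure.map G₁ P = gammaDist (1 / α))
    (h₂ : Measure.map G₂ P = gammaDist (1 - 1 / α)) :
    Measure.map (fun ω => G₁ ω ^ (1 / α) * G₂ ω ^ (-(1 / α))) P =
      (volume.restrict (Set.Ioi (0 : ℝ))).withDensity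
        fun t => ENNReal.ofReal (α * Real.sin (π / α) / π * (1 + t ^ α)⁻¹) := by
  have hinv : 1 / α < 1 := by rw [div_lt_one (by linarith)]; exact hα
  have hG₁ : AEMeasurable G₁ P := by
    by_contra h
    exact gammaDist_ne_zero (by positivity) (h₁.symm.trans (Measure.map_of_not_aemeasurable h))
  have hG₂ : AEMeasurable G₂ P := by
    by_contra h
    exact gammaDist_ne_zero (by linarith) (h₂.symm.trans (Measure.map_of_not_aemeasurable h))
  have hmeas : Measurable fun p : ℝ × ℝ => p.1 ^ (1 / α) * p.2 ^ (-(1 / α)) := by fun_prop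
  have hjoint : Measure.map (fun ω => (G₁ ω, G₂ ω)) P =
      (gammaDist (1 / α)).prod (gammaDist (1 - 1 / α)) := by
    rw [(ProbabilityTheory.indepFun_iff_map_prod_eq_prod_map_map hG₁ hG₂).1 hind, h₁, h₂]
  refine Measure.ext_of_lintegral _ fun f hf => ?_
  have hcomp : Measure.map (fun ω => G₁ ω ^ (1 / α) * G₂ ω ^ (-(1 / α))) P =
      Measure.map (fun p : ℝ × ℝ => p.1 ^ (1 / α) * p.2 ^ (-(1 / α)))
        ((gammaDist (1 / α)).prod (gammaDist (1 - 1 / α))) := by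
    rw [← hjoint, AEMeasurable.map_map_of_aemeasurable hmeas.aemeasurable (hG₁.prodMk hG₂)]
    rfl
  rw [hcomp, lintegral_map hf hmeas,
    lintegral_prod_symm _ (Measurable.aemeasurable (by fun_prop)),
    lintegral_gammaDist_quotient_rpow hα hf,
    lintegral_withDensity_eq_lintegral_mul _ (by fun_prop) hf]
  rfl
end
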